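/- arXiv:2109.06009 — 4 statements merged into one kernel-verified Lean document; each statement's English description precedes it below -/
import Mathlib

section
/- For all integers n ≥ 2 and 1 ≤ r ≤ n−1, the entropy constant of the Bernoulli–Laplace model with r particles on n sites satisfies κ(n,r) = r(n−r)·log 2 / log C(n,r), where C(n,r) is the binomial coefficient. Precisely, (r(n−r) log 2 / log C(n,r)) is the largest κ ≥ 0 such that κ·Ent f ≤ (1/2)∑_{x,y∈V} μ[ent_{xy} f] for all f : Ω_{n,r} → ℝ≥0. -/
open Finset

namespace Stmt5

variable {V : Type*} [Fintype V] [DecidableEq V] {r : ℕ}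

/-- A configuration of `r` indistinguishable particles on `V`: the set of occupied sites. -/
def Config (V : Type*) [Fintype V] [DecidableEq V] (r : ℕ) := {A : Finset V // A.card = r}

instance : Fintype (Config V r) := by unfold Config; infer_instance

/-- The configuration obtained by swapping the occupation numbers at `x` and `y`. -/
def swapCfg (x y : V) (η : Config V r) : Config V r :=
  ⟨η.1.image (Equiv.swap x y), by
    rw [Finset.card_image_of_injective _ (Equiv.injective _)]; exact η.2⟩

/-- `ψ(s,t)`: the local entropy functional. -/
noncomputable def psi (s t : ℝ) : ℝ :=
  s / 2 * Real.log (2 * s / (s + t)) + t / 2 * Real.log (2 * t / (s + t))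

/-- The local entropy `ent_{xy} f` at the edge `xy`, evaluated at configuration `η`. -/
noncomputable def entEdge (x y : V) (f : Config V r → ℝ) (η : Config V r) : ℝ :=
  if (x ∈ η.1 ∧ y ∉ η.1) ∨ (y ∈ η.1 ∧ x ∉ η.1) then psi (f η) (f (swapCfg x y η)) else 0

/-- Expectation w.r.t. the uniform distribution `μ` on configurations. -/
noncomputable def mean (f : Config V r → ℝ) : ℝ :=
  (∑ η : Config V r, f η) / (Fintype.card (Config V r) : ℝ)

/-- The global entropy `Ent f = μ[f log (f / μ f)]`. -/
noncomputable def Ent (f : Config V r → ℝ) : ℝ :=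
  mean (fun η => f η * Real.log (f η / mean f))

end Stmt5

namespace BernoulliLaplace

/-- The function `s ↦ log (1 + ω eˢ) - log (1 + ω e⁻ˢ)` lies below its chords through the origin. -/
lemma log_ratio_le_chord {ω : ℝ} (hω : 0 < ω) (hω1 : ω ≤ 1) {s t : ℝ} (hs : 0 ≤ s) (hst : s ≤ t) :
    t * (Real.log (1 + ω * Real.exp s) - Real.log (1 + ω * Real.exp (-s))) ≤
      s * (Real.log (1 + ω * Real.exp t) - Real.log (1 + ω * Real.exp (-t))) := by
  set R : ℝ → ℝ := fun u => Real.log (1 + ω * Real.exp u) - Real.log (1 + ω * Real.exp (-u))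
    with hR
  have hpos : ∀ u : ℝ, 0 < 1 + ω * Real.exp u := fun u => by positivity
  have hderiv : ∀ u, HasDerivAt R
      (ω * Real.exp u / (1 + ω * Real.exp u) + ω / (Real.exp u + ω)) u := by
    intro u
    have h1 := (((Real.hasDerivAt_exp u).const_mul ω).const_add 1).log (hpos u).ne'
    have h2 := ((((hasDerivAt_neg u).exp).const_mul ω).const_add 1).log (hpos (-u)).ne'
    refine (h1.sub h2).congr_deriv ?_
    rw [Real.exp_neg]
    have := Real.exp_pos u
    have h3 : Real.exp u + ω ≠ 0 := by positivity
    have h4 : 1 + ω * (Real.exp u)⁻¹ ≠ 0 := by positivity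
    field_simp
    ring
  have hconv : ConvexOn ℝ (Set.Ici (0 : ℝ)) R := by
    refine MonotoneOn.convexOn_of_deriv (convex_Ici 0)
      (fun u _ => (hderiv u).continuousAt.continuousWithinAt)
      (fun u _ => (hderiv u).differentiableAt.differentiableWithinAt) ?_
    intro u hu v hv huv
    rw [interior_Ici] at hu hv
    rw [(hderiv u).deriv, (hderiv v).deriv]
    have hE : (1 : ℝ) ≤ Real.exp u := Real.one_le_exp (le_of_lt hu)
    have hEF : Real.exp u ≤ Real.exp v := Real.exp_le_exp.2 huv
    generalize Real.exp u = E at *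
    generalize Real.exp v = G at *
    have hG : 1 ≤ G := hE.trans hEF
    have e1 : ω * G / (1 + ω * G) - ω * E / (1 + ω * E)
        = ω * (G - E) / ((1 + ω * E) * (1 + ω * G)) := by
      have : 1 + ω * G ≠ 0 := by positivity
      have : 1 + ω * E ≠ 0 := by positivity
      field_simp
      ring
    have e2 : ω / (E + ω) - ω / (G + ω) = ω * (G - E) / ((E + ω) * (G + ω)) := by
      have : G + ω ≠ 0 := by positivity
      have : E + ω ≠ 0 := by positivity
      field_simp
      ring
    have e3 : ω * (G - E) / ((E + ω) * (G + ω)) ≤ ω * (G - E) / ((1 + ω * E) * (1 + ω * G)) := by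
      apply div_le_div_of_nonneg_left
      · exact mul_nonneg hω.le (by linarith)
      · positivity
      · apply mul_le_mul
        · nlinarith
        · nlinarith
        · positivity
        · positivity
    linarith
  have hR0 : R 0 = 0 := by simp [hR]
  rcases hs.eq_or_lt with rfl | hs
  · change t * R 0 ≤ 0 * R t
    simp [hR0]
  have ht : 0 < t := hs.trans_le hst
  have h := hconv.2 (Set.mem_Ici.2 le_rfl) (Set.mem_Ici.2 ht.le)
    (show 0 ≤ 1 - s / t by rw [sub_nonneg, div_le_one ht]; exact hst)
    (show 0 ≤ s / t by positivity) (by ring)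
  have h5 : (1 - s / t) • (0 : ℝ) + (s / t) • t = s := by
    simp only [smul_eq_mul]; field_simp; ring
  rw [h5, hR0] at h
  simp only [smul_eq_mul, mul_zero, zero_add] at h
  change t * R s ≤ s * R t
  calc t * R s ≤ t * (s / t * R t) := by gcongr
    _ = s * R t := by field_simp

/-- The two-point bound along the curve containing all interior critical points, up to a
critical point. -/
lemma two_point_curve {ω c d : ℝ} (hω : 0 < ω) (hω1 : ω ≤ 1) (hd : 0 < d) (hc : c = ω * d)
    (hnorm : Real.log 2 + c * Real.log ω = (c + d) * Real.log (1 + ω)) {t : ℝ} (ht : 0 ≤ t)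
    (hcrit : 2 * c * t + (d - c) *
      (Real.log (1 + ω * Real.exp t) - Real.log (1 + ω * Real.exp (-t))) = t) :
    Real.exp (c * Real.log ω + c * t - c * Real.log (1 + ω * Real.exp t)
        - d * Real.log (1 + ω * Real.exp (-t)))
      + Real.exp (c * Real.log ω - c * t - c * Real.log (1 + ω * Real.exp (-t))
        - d * Real.log (1 + ω * Real.exp t)) ≤ 1 := by
  have hpos : ∀ u : ℝ, 0 < 1 + ω * Real.exp u := fun u => by positivity
  have hcd : 0 ≤ d - c := by rw [hc]; nlinarith
  set l₁ : ℝ → ℝ := fun u => c * Real.log ω + c * u - c * Real.log (1 + ω * Real.exp u)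
        - d * Real.log (1 + ω * Real.exp (-u)) with hl₁
  set l₂ : ℝ → ℝ := fun u => c * Real.log ω - c * u - c * Real.log (1 + ω * Real.exp (-u))
        - d * Real.log (1 + ω * Real.exp u) with hl₂
  set M : ℝ → ℝ := fun u => c / (1 + ω * Real.exp u) + d * ω / (Real.exp u + ω) with hM
  have hlog₁ : ∀ u, HasDerivAt (fun u => Real.log (1 + ω * Real.exp u))
      (ω * Real.exp u / (1 + ω * Real.exp u)) u := fun u =>
    (((Real.hasDerivAt_exp u).const_mul ω).const_add 1).log (hpos u).ne'
  have hlog₂ : ∀ u, HasDerivAt (fun u => Real.log (1 + ω * Real.exp (-u)))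
      (-(ω / (Real.exp u + ω))) u := fun u => by
    refine (((((hasDerivAt_neg u).exp).const_mul ω).const_add 1).log (hpos (-u)).ne').congr_deriv ?_
    rw [Real.exp_neg]
    have := Real.exp_pos u
    have h3 : Real.exp u + ω ≠ 0 := by positivity
    have h4 : 1 + ω * (Real.exp u)⁻¹ ≠ 0 := by positivity
    field_simp
  have hd₁ : ∀ u, HasDerivAt l₁ (M u) u := fun u => by
    refine (((((hasDerivAt_id u).const_mul c).const_add (c * Real.log ω)).sub
      ((hlog₁ u).const_mul c)).sub ((hlog₂ u).const_mul d)).congr_deriv ?_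
    have := Real.exp_pos u
    simp only [hM]
    have h3 : Real.exp u + ω ≠ 0 := by positivity
    have h4 := (hpos u).ne'
    field_simp
    ring
  have hd₂ : ∀ u, HasDerivAt l₂ (-(Real.exp u * M u)) u := fun u => by
    refine (((((hasDerivAt_id u).const_mul c).const_sub (c * Real.log ω)).sub
      ((hlog₂ u).const_mul c)).sub ((hlog₁ u).const_mul d)).congr_deriv ?_
    have := Real.exp_pos u
    simp only [hM, hc]
    have h3 : Real.exp u + ω ≠ 0 := by positivity
    have h4 := (hpos u).ne'
    field_simp
    ring
  have hder : ∀ u, HasDerivAt (fun u => Real.exp (l₁ u) + Real.exp (l₂ u))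
      (Real.exp (l₁ u) * M u + Real.exp (l₂ u) * -(Real.exp u * M u)) u := fun u =>
    (hd₁ u).exp.add (hd₂ u).exp
  have hanti : AntitoneOn (fun u => Real.exp (l₁ u) + Real.exp (l₂ u)) (Set.Icc 0 t) := by
    refine antitoneOn_of_deriv_nonpos (convex_Icc 0 t)
      (fun u _ => (hder u).continuousAt.continuousWithinAt)
      (fun u _ => (hder u).differentiableAt.differentiableWithinAt) ?_
    intro u hu
    rw [interior_Icc] at hu
    rw [(hder u).deriv]
    have hMu : 0 ≤ M u := by
      have h0 : 0 ≤ c := by rw [hc]; positivity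
      have := hpos u
      have := Real.exp_pos u
      simp only [hM]
      positivity
    have hle : l₁ u ≤ l₂ u + u := by
      have hch := mul_le_mul_of_nonneg_left (log_ratio_le_chord hω hω1 hu.1.le hu.2.le) hcd
      have h2 := congrArg (fun v => u * v) hcrit
      beta_reduce at h2
      have h3 : t * (2 * c * u + (d - c) * (Real.log (1 + ω * Real.exp u)
          - Real.log (1 + ω * Real.exp (-u)))) ≤ t * u := by linarith
      have h4 := le_of_mul_le_mul_left h3 (hu.1.trans hu.2)
      simp only [hl₁, hl₂]
      linarith
    have hexp : Real.exp (l₁ u) ≤ Real.exp (l₂ u) * Real.exp u := by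
      rw [← Real.exp_add]; exact Real.exp_le_exp.2 hle
    nlinarith [mul_le_mul_of_nonneg_right hexp hMu]
  have h := hanti (Set.left_mem_Icc.2 ht) (Set.right_mem_Icc.2 ht) ht
  have h0 : Real.exp (l₁ 0) + Real.exp (l₂ 0) = 1 := by
    have e1 : l₁ 0 = -Real.log 2 := by simp [hl₁]; linarith
    have e2 : l₂ 0 = -Real.log 2 := by simp [hl₂]; linarith
    rw [e1, e2, Real.exp_neg, Real.exp_log two_pos]; norm_num
  linarith

/-- At an interior critical point with `p` having at least the balanced odds, the two-point
functional is at most `1`. -/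
lemma two_point_critical {ω c d : ℝ} (hω : 0 < ω) (hω1 : ω ≤ 1) (hd : 0 < d) (hc : c = ω * d)
    (hnorm : Real.log 2 + c * Real.log ω = (c + d) * Real.log (1 + ω)) {p q : ℝ}
    (hp : 0 < p) (hp1 : p < 1) (hq : 0 < q) (hq1 : q < 1)
    (h₁ : c * (1 - p) * (p ^ c * (1 - q) ^ d) = d * p * (q ^ c * (1 - p) ^ d))
    (h₂ : c * (1 - q) * (q ^ c * (1 - p) ^ d) = d * q * (p ^ c * (1 - q) ^ d))
    (hpω : ω * (1 - p) ≤ p) :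
    p ^ c * (1 - q) ^ d + q ^ c * (1 - p) ^ d ≤ 1 := by
  have hp' : 0 < 1 - p := by linarith
  have hq' : 0 < 1 - q := by linarith
  set t := Real.log (p / (ω * (1 - p))) with ht
  have het : Real.exp t = p / (ω * (1 - p)) := Real.exp_log (by positivity)
  have ht0 : 0 ≤ t := Real.log_nonneg (by rw [le_div_iff₀ (by positivity)]; linarith)
  have hX : 0 < p ^ c * (1 - q) ^ d := by positivity
  have hY : 0 < q ^ c * (1 - p) ^ d := by positivity
  have hodds : ω ^ 2 * ((1 - p) * (1 - q)) = p * q := by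
    have h3 : d ^ 2 * (p ^ c * (1 - q) ^ d) * (q ^ c * (1 - p) ^ d) *
        (ω ^ 2 * ((1 - p) * (1 - q)) - p * q) = 0 := by
      have := congrArg₂ (· * ·) h₁ h₂
      beta_reduce at this
      have hω' : ω = c / d := by rw [hc]; field_simp
      have hdω : d * (c / d) = c := by field_simp
      rw [hω']
      linear_combination this + (c + d * (c / d)) * hdω * ((1 - p) * (1 - q)) *
        (p ^ c * (1 - q) ^ d) * (q ^ c * (1 - p) ^ d)
    have h4 : d ^ 2 * (p ^ c * (1 - q) ^ d) * (q ^ c * (1 - p) ^ d) ≠ 0 := by positivity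
    have := (mul_eq_zero.1 h3).resolve_left h4
    linarith
  have hp2 : 1 + ω * Real.exp t = (1 - p)⁻¹ := by
    rw [het]; field_simp; ring
  have hq2 : 1 + ω * Real.exp (-t) = (1 - q)⁻¹ := by
    rw [Real.exp_neg, het]; field_simp
    linear_combination hodds
  have hlp : Real.log p = Real.log ω + t + Real.log (1 - p) := by
    rw [ht, Real.log_div (by positivity) (by positivity), Real.log_mul (by positivity)
      (by positivity)]
    ring
  have hlq : Real.log q = Real.log ω - t + Real.log (1 - q) := by
    have : Real.log (ω ^ 2 * ((1 - p) * (1 - q))) = Real.log (p * q) := by rw [hodds]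
    rw [Real.log_mul (by positivity) (by positivity), Real.log_mul (by positivity) (by positivity),
      Real.log_mul (by positivity) (by positivity), Real.log_pow] at this
    push_cast at this
    linarith
  have hlX : Real.log (p ^ c * (1 - q) ^ d) = c * Real.log p + d * Real.log (1 - q) := by
    rw [Real.log_mul (by positivity) (by positivity), Real.log_rpow hp, Real.log_rpow hq']
  have hlY : Real.log (q ^ c * (1 - p) ^ d) = c * Real.log q + d * Real.log (1 - p) := by
    rw [Real.log_mul (by positivity) (by positivity), Real.log_rpow hq, Real.log_rpow hp']
  have hXY : Real.log (p ^ c * (1 - q) ^ d) = t + Real.log (q ^ c * (1 - p) ^ d) := by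
    have : p ^ c * (1 - q) ^ d = Real.exp t * (q ^ c * (1 - p) ^ d) := by
      rw [het, div_mul_eq_mul_div, eq_div_iff (by positivity)]
      apply mul_left_cancel₀ hd.ne'
      rw [hc] at h₁ ⊢
      linear_combination h₁
    rw [this, Real.log_mul (Real.exp_pos t).ne' hY.ne', Real.log_exp]
  have hcrit : 2 * c * t + (d - c) *
      (Real.log (1 + ω * Real.exp t) - Real.log (1 + ω * Real.exp (-t))) = t := by
    rw [hp2, hq2, Real.log_inv, Real.log_inv]
    rw [hlX, hlY, hlp, hlq] at hXY
    linear_combination hXY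
  have h := two_point_curve hω hω1 hd hc hnorm ht0 hcrit
  rw [hp2, hq2, Real.log_inv, Real.log_inv] at h
  rw [← Real.exp_log hX, ← Real.exp_log hY, hlX, hlY, hlp, hlq]
  convert h using 3 <;> ring

lemma two_point_of_le_one {ω c d : ℝ} (hω : 0 < ω) (hω1 : ω ≤ 1) (hd : 0 < d) (hc : c = ω * d)
    (hnorm : Real.log 2 + c * Real.log ω = (c + d) * Real.log (1 + ω)) {p q : ℝ}
    (hp : p ∈ Set.Icc (0 : ℝ) 1) (hq : q ∈ Set.Icc (0 : ℝ) 1) :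
    p ^ c * (1 - q) ^ d + q ^ c * (1 - p) ^ d ≤ 1 := by
  have hc0 : 0 < c := by rw [hc]; positivity
  set F : ℝ × ℝ → ℝ := fun z => z.1 ^ c * (1 - z.2) ^ d + z.2 ^ c * (1 - z.1) ^ d with hF
  have hcont : Continuous F := by
    have h1 := Real.continuous_rpow_const hc0.le
    have h2 := Real.continuous_rpow_const hd.le
    exact ((h1.comp continuous_fst).mul (h2.comp (continuous_const.sub continuous_snd))).add
      ((h1.comp continuous_snd).mul (h2.comp (continuous_const.sub continuous_fst)))
  obtain ⟨⟨a, b⟩, hab, hmax⟩ := (isCompact_Icc.prod isCompact_Icc).exists_isMaxOn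
    (s := Set.Icc (0 : ℝ) 1 ×ˢ Set.Icc (0 : ℝ) 1) ⟨(p, q), hp, hq⟩ hcont.continuousOn
  refine (hmax (Set.mk_mem_prod hp hq) : F (p, q) ≤ F (a, b)).trans ?_
  obtain ⟨⟨ha0, ha1⟩, hb0, hb1⟩ := hab
  simp only at ha0 ha1 hb0 hb1
  simp only [hF]
  rcases ha0.eq_or_lt with rfl | ha0
  · simpa [Real.zero_rpow hc0.ne'] using Real.rpow_le_one hb0 hb1 hc0.le
  rcases hb0.eq_or_lt with rfl | hb0
  · simpa [Real.zero_rpow hc0.ne'] using Real.rpow_le_one ha0.le ha1 hc0.le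
  rcases ha1.eq_or_lt with rfl | ha1
  · simpa [Real.zero_rpow hd.ne'] using Real.rpow_le_one (by linarith) (by linarith) hd.le
  rcases hb1.eq_or_lt with rfl | hb1
  · simpa [Real.zero_rpow hd.ne'] using Real.rpow_le_one (by linarith) (by linarith) hd.le
  have key : ∀ u v : ℝ, 0 < u → u < 1 → 0 < v → v < 1 →
      (∀ w ∈ Set.Icc (0 : ℝ) 1, w ^ c * (1 - v) ^ d + v ^ c * (1 - w) ^ d
        ≤ u ^ c * (1 - v) ^ d + v ^ c * (1 - u) ^ d) →
      c * (1 - u) * (u ^ c * (1 - v) ^ d) = d * u * (v ^ c * (1 - u) ^ d) := by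
    intro u v hu hu1 hv hv1 hle
    have hu' : 0 < 1 - u := by linarith
    have hlm : IsLocalMax (fun w : ℝ => w ^ c * (1 - v) ^ d + v ^ c * (1 - w) ^ d) u := by
      filter_upwards [Icc_mem_nhds hu hu1] with w hw using hle w hw
    have hder := ((Real.hasDerivAt_rpow_const (p := c) (Or.inl hu.ne')).mul_const ((1 - v) ^ d)).add
      ((((hasDerivAt_id u).const_sub 1).rpow_const (p := d) (Or.inl hu'.ne')).const_mul (v ^ c))
    have h0 := hlm.hasDerivAt_eq_zero hder
    have e1 : u ^ c = u ^ (c - 1) * u := by rw [Real.rpow_sub_one hu.ne']; field_simp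
    have e2 : (1 - u) ^ d = (1 - u) ^ (d - 1) * (1 - u) := by
      rw [Real.rpow_sub_one hu'.ne']; field_simp
    simp only [id] at h0
    rw [e1, e2]
    linear_combination (1 - u) * u * h0
  have h₁ := key a b ha0 ha1 hb0 hb1 fun w hw =>
    hmax (Set.mk_mem_prod hw ⟨hb0.le, hb1.le⟩)
  have h₂ := key b a hb0 hb1 ha0 ha1 fun w hw => by
    have : F (a, w) ≤ F (a, b) := hmax (Set.mk_mem_prod ⟨ha0.le, ha1.le⟩ hw)
    simp only [hF] at this
    linarith
  rcases le_total (ω * (1 - a)) a with h | h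
  · exact two_point_critical hω hω1 hd hc hnorm ha0 ha1 hb0 hb1 h₁ h₂ h
  · have hodds : ω * (1 - b) ≤ b := by
      have ha' : 0 < 1 - a := by linarith
      have hb' : 0 < 1 - b := by linarith
      have hX : 0 < a ^ c * (1 - b) ^ d := by positivity
      have hY : 0 < b ^ c * (1 - a) ^ d := by positivity
      have hYX : b ^ c * (1 - a) ^ d ≥ a ^ c * (1 - b) ^ d := by
        by_contra! hlt
        rw [hc] at h₁
        have h5 : d * a * (b ^ (ω * d) * (1 - a) ^ d) < d * a * (a ^ (ω * d) * (1 - b) ^ d) := by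
          rw [← hc]; gcongr
        have h6 : d * a * (a ^ (ω * d) * (1 - b) ^ d)
            ≤ d * (ω * (1 - a)) * (a ^ (ω * d) * (1 - b) ^ d) := by
          rw [← hc]; gcongr
        linarith
      have h7 : d * (ω * (1 - b)) * (b ^ c * (1 - a) ^ d) ≤ d * b * (b ^ c * (1 - a) ^ d) := by
        calc d * (ω * (1 - b)) * (b ^ c * (1 - a) ^ d)
            = d * b * (a ^ c * (1 - b) ^ d) := by
              rw [← h₂, show c * (1 - b) = d * (ω * (1 - b)) by rw [hc]; ring]
          _ ≤ _ := by gcongr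
      have h8 := le_of_mul_le_mul_right h7 hY
      exact le_of_mul_le_mul_left h8 hd
    rw [add_comm]
    exact two_point_critical hω hω1 hd hc hnorm hb0 hb1 ha0 ha1 h₂ h₁ hodds

/-- The two-point inequality. The hypothesis says that the maximum of `pᶜ (1 - p)ᵈ` is `1 / 2`. -/
lemma two_point {ρ L c d : ℝ} (hρ : 0 < ρ) (hρ1 : ρ < 1) (hL : L * Real.binEntropy ρ = Real.log 2)
    (hc : c = ρ * L) (hd : d = (1 - ρ) * L) {p q : ℝ}
    (hp : p ∈ Set.Icc (0 : ℝ) 1) (hq : q ∈ Set.Icc (0 : ℝ) 1) :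
    p ^ c * (1 - q) ^ d + q ^ c * (1 - p) ^ d ≤ 1 := by
  have hρ' : 0 < 1 - ρ := by linarith
  have hL0 : 0 < L := by
    by_contra! h
    have := mul_nonpos_of_nonpos_of_nonneg h (Real.binEntropy_pos hρ hρ1).le
    rw [hL] at this
    linarith [Real.log_pos one_lt_two]
  rw [Real.binEntropy, Real.log_inv, Real.log_inv] at hL
  rcases le_total ρ (1 - ρ) with h | h
  · refine two_point_of_le_one (ω := ρ / (1 - ρ)) (by positivity) ((div_le_one hρ').2 h)
      (by rw [hd]; positivity) (by rw [hc, hd]; field_simp) ?_ hp hq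
    have : 1 + ρ / (1 - ρ) = (1 - ρ)⁻¹ := by field_simp; ring
    rw [this, Real.log_div hρ.ne' hρ'.ne', Real.log_inv, ← hL, hc, hd]
    ring
  · have h' := two_point_of_le_one (ω := (1 - ρ) / ρ) (c := d) (d := c) (p := 1 - q) (q := 1 - p)
      (by positivity) ((div_le_one hρ).2 h)
      (by rw [hc]; positivity) (by rw [hc, hd]; field_simp) ?_
      ⟨by linarith [hq.2], by linarith [hq.1]⟩ ⟨by linarith [hp.2], by linarith [hp.1]⟩
    · rw [sub_sub_cancel, sub_sub_cancel] at h'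
      linarith
    · have : 1 + (1 - ρ) / ρ = ρ⁻¹ := by field_simp; ring
      rw [this, Real.log_div hρ'.ne' hρ.ne', Real.log_inv, ← hL, hc, hd]
      ring

section TotalEntropy

variable {V : Type*} [Fintype V]

/-- The Shannon entropy of an unnormalized law, as a function homogeneous of degree one. -/
noncomputable def totalEntropy (f : Finset V → ℝ) : ℝ :=
  ∑ B, Real.negMulLog (f B) - Real.negMulLog (∑ B, f B)

lemma totalEntropy_nonneg {f : Finset V → ℝ} (hf : ∀ B, 0 ≤ f B) : 0 ≤ totalEntropy f := by
  rw [totalEntropy, sub_nonneg, Real.negMulLog, neg_mul, sum_mul, ← sum_neg_distrib]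
  refine sum_le_sum fun B _ => ?_
  rw [Real.negMulLog, neg_mul, neg_le_neg_iff]
  rcases (hf B).eq_or_lt with h | h
  · simp [← h]
  · have := single_le_sum (fun B _ => hf B) (mem_univ B)
    gcongr

end TotalEntropy

section EdgeEntropy

variable {V : Type*} [DecidableEq V]

/-- The set of occupied sites after swapping the occupation numbers at `x` and `y`. -/
def swapSites (x y : V) (B : Finset V) : Finset V := B.image (Equiv.swap x y)

lemma mem_swapSites {x y z : V} {B : Finset V} :
    z ∈ swapSites x y B ↔ Equiv.swap x y z ∈ B := by
  simp only [swapSites, mem_image]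
  constructor
  · rintro ⟨w, hw, rfl⟩
    simpa using hw
  · intro h
    exact ⟨_, h, by simp⟩

lemma swapSites_swapSites (x y : V) (B : Finset V) : swapSites x y (swapSites x y B) = B := by
  ext z
  simp [mem_swapSites]

lemma swapSites_comm (x y : V) (B : Finset V) : swapSites x y B = swapSites y x B := by
  rw [swapSites, swapSites, Equiv.swap_comm]

lemma card_swapSites (x y : V) (B : Finset V) : (swapSites x y B).card = B.card :=
  card_image_of_injective _ (Equiv.injective _)

variable [Fintype V]

lemma sum_swapSites (x y : V) (Φ : Finset V → ℝ) : ∑ B, Φ (swapSites x y B) = ∑ B, Φ B :=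
  Equiv.sum_comp
    (⟨swapSites x y, swapSites x y, swapSites_swapSites x y, swapSites_swapSites x y⟩ :
      Finset V ≃ Finset V) Φ

/-- The contribution of the configuration `B`, with a particle at `x` and a hole at `y`, to the
conditional entropy along the edge `xy`. -/
noncomputable def edgeTerm (f : Finset V → ℝ) (x y : V) (B : Finset V) : ℝ :=
  if x ∈ B ∧ y ∉ B then f B * Real.log ((f B + f (swapSites x y B)) / f B) else 0

/-- The sum over all pairs of sites in `A` of the conditional entropies of the pair given the
other sites, for the (unnormalized) law `f`. -/
noncomputable def edgeEntropy (A : Finset V) (f : Finset V → ℝ) : ℝ :=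
  ∑ x ∈ A, ∑ y ∈ A, ∑ B, edgeTerm f x y B

/-- The restriction of `f` to configurations with a hole at `z`. -/
def restrictHole (f : Finset V → ℝ) (z : V) (B : Finset V) : ℝ := if z ∈ B then 0 else f B

/-- The restriction of `f` to configurations with a particle at `z`. -/
def restrictParticle (f : Finset V → ℝ) (z : V) (B : Finset V) : ℝ := if z ∈ B then f B else 0

/-- The mass of the configurations with a particle at `z`. -/
def occupation (f : Finset V → ℝ) (z : V) : ℝ := ∑ B, restrictParticle f z B

/-- The Shannon entropy of the occupation number at `z`. -/
noncomputable def siteEntropy (f : Finset V → ℝ) (z : V) : ℝ :=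
  Real.negMulLog (occupation f z) + Real.negMulLog (∑ B, f B - occupation f z)
    - Real.negMulLog (∑ B, f B)

lemma sum_restrictHole (f : Finset V → ℝ) (z : V) :
    ∑ B, restrictHole f z B = ∑ B, f B - occupation f z := by
  rw [occupation, ← sum_sub_distrib]
  refine sum_congr rfl fun B _ => ?_
  unfold restrictHole restrictParticle
  split_ifs <;> simp

lemma occupation_nonneg {f : Finset V → ℝ} (hf : ∀ B, 0 ≤ f B) (z : V) : 0 ≤ occupation f z :=
  sum_nonneg fun B _ => by unfold restrictParticle; split_ifs; exacts [hf B, le_rfl]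

lemma le_occupation {f : Finset V → ℝ} (hf : ∀ B, 0 ≤ f B) {z : V} {B : Finset V} (hz : z ∈ B) :
    f B ≤ occupation f z := by
  have h := single_le_sum (f := restrictParticle f z) (s := univ)
    (fun B _ => by unfold restrictParticle; split_ifs; exacts [hf B, le_rfl]) (mem_univ B)
  simpa [occupation, restrictParticle, hz] using h

lemma le_sum_sub_occupation {f : Finset V → ℝ} (hf : ∀ B, 0 ≤ f B) {z : V} {B : Finset V}
    (hz : z ∉ B) : f B ≤ ∑ B, f B - occupation f z := by
  rw [← sum_restrictHole]
  have h := single_le_sum (f := restrictHole f z) (s := univ)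
    (fun B _ => by unfold restrictHole; split_ifs; exacts [le_rfl, hf B]) (mem_univ B)
  simpa [restrictHole, hz] using h

lemma occupation_le {f : Finset V → ℝ} (hf : ∀ B, 0 ≤ f B) (z : V) :
    occupation f z ≤ ∑ B, f B :=
  sum_le_sum fun B _ => by unfold restrictParticle; split_ifs; exacts [le_rfl, hf B]

/-- The chain rule for the entropy. -/
lemma totalEntropy_eq (f : Finset V → ℝ) (z : V) :
    totalEntropy f = totalEntropy (restrictHole f z) + totalEntropy (restrictParticle f z)
      + siteEntropy f z := by
  have h : ∑ B, Real.negMulLog (f B) = ∑ B, Real.negMulLog (restrictHole f z B)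
      + ∑ B, Real.negMulLog (restrictParticle f z B) := by
    rw [← sum_add_distrib]
    refine sum_congr rfl fun B _ => ?_
    unfold restrictHole restrictParticle
    split_ifs <;> simp
  simp only [totalEntropy, siteEntropy]
  rw [h, sum_restrictHole]
  simp only [occupation]
  ring

/-- Restricting to a hole at a random site multiplies the edge entropy by the number of holes
that are not involved in a given exchange. -/
lemma sum_edgeEntropy_restrictHole {A : Finset V} {f : Finset V → ℝ} {r : ℕ}
    (hsupp : ∀ B, f B ≠ 0 → (B ∩ A).card = r) :
    ∑ z ∈ A, edgeEntropy (A.erase z) (restrictHole f z)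
      = ((A.card : ℝ) - r - 1) * edgeEntropy A f := by
  have h1 : ∀ z ∈ A, edgeEntropy (A.erase z) (restrictHole f z)
      = ∑ x ∈ A, ∑ y ∈ A, ∑ B, if z ∈ (A \ B).erase y then edgeTerm f x y B else 0 := by
    intro z hz
    rw [edgeEntropy, ← filter_ne' A z, sum_filter]
    refine sum_congr rfl fun x hx => ?_
    rw [sum_filter]
    by_cases hxz : x = z
    · subst hxz
      simp only [ne_eq, not_true_eq_false, if_false]
      symm
      refine sum_eq_zero fun y _ => sum_eq_zero fun B _ => ?_
      unfold edgeTerm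
      simp only [mem_erase, mem_sdiff]
      split_ifs <;> simp_all
    · simp only [ne_eq, hxz, not_false_eq_true, if_true]
      refine sum_congr rfl fun y hy => ?_
      by_cases hyz : y = z
      · simp [hyz]
      · simp only [hyz, not_false_eq_true, if_true]
        refine sum_congr rfl fun B _ => ?_
        have hsw : z ∈ swapSites x y B ↔ z ∈ B := by
          rw [mem_swapSites, Equiv.swap_apply_of_ne_of_ne (Ne.symm hxz) (Ne.symm hyz)]
        simp only [edgeTerm, restrictHole, hsw, mem_erase, mem_sdiff]
        by_cases hzB : z ∈ B
        · simp [hzB]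
        · simp [hzB, hz, Ne.symm hyz]
  rw [sum_congr rfl h1, sum_comm, edgeEntropy, mul_sum]
  refine sum_congr rfl fun x hx => ?_
  rw [sum_comm, mul_sum]
  refine sum_congr rfl fun y hy => ?_
  rw [sum_comm, mul_sum]
  refine sum_congr rfl fun B _ => ?_
  by_cases h0 : edgeTerm f x y B = 0
  · simp [h0]
  have hxy : x ∈ B ∧ y ∉ B := by
    by_contra h; exact h0 (by simp only [edgeTerm, if_neg h])
  have hfB : f B ≠ 0 := by
    intro h; exact h0 (by simp [edgeTerm, h])
  rw [← sum_filter, sum_const, nsmul_eq_mul]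
  congr 1
  have h2 : {z ∈ A | z ∈ (A \ B).erase y} = (A \ B).erase y := by
    ext z; simp only [mem_filter, mem_erase, mem_sdiff]; tauto
  have hmem : y ∈ A \ B := mem_sdiff.2 ⟨hy, hxy.2⟩
  have h3 := card_erase_add_one hmem
  have h4 := card_sdiff_add_card_inter A B
  rw [inter_comm, hsupp B hfB] at h4
  rw [h2]
  have h5 : ((A \ B).erase y).card + 1 + r = A.card := by omega
  rw [← h5]; push_cast; ring

/-- Restricting to a particle at a random site multiplies the edge entropy by the number of
particles that are not involved in a given exchange. -/
lemma sum_edgeEntropy_restrictParticle {A : Finset V} {f : Finset V → ℝ} {r : ℕ}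
    (hsupp : ∀ B, f B ≠ 0 → (B ∩ A).card = r) :
    ∑ z ∈ A, edgeEntropy (A.erase z) (restrictParticle f z)
      = ((r : ℝ) - 1) * edgeEntropy A f := by
  have h1 : ∀ z ∈ A, edgeEntropy (A.erase z) (restrictParticle f z)
      = ∑ x ∈ A, ∑ y ∈ A, ∑ B, if z ∈ (B ∩ A).erase x then edgeTerm f x y B else 0 := by
    intro z hz
    rw [edgeEntropy, ← filter_ne' A z, sum_filter]
    refine sum_congr rfl fun x hx => ?_
    rw [sum_filter]
    by_cases hxz : x = z
    · simp [hxz]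
    · simp only [ne_eq, hxz, not_false_eq_true, if_true]
      refine sum_congr rfl fun y hy => ?_
      by_cases hyz : y = z
      · subst hyz
        simp only [not_true_eq_false, if_false]
        symm
        refine sum_eq_zero fun B _ => ?_
        unfold edgeTerm
        simp only [mem_erase, mem_inter]
        split_ifs <;> simp_all
      · simp only [hyz, not_false_eq_true, if_true]
        refine sum_congr rfl fun B _ => ?_
        have hsw : z ∈ swapSites x y B ↔ z ∈ B := by
          rw [mem_swapSites, Equiv.swap_apply_of_ne_of_ne (Ne.symm hxz) (Ne.symm hyz)]
        simp only [edgeTerm, restrictParticle, hsw, mem_erase, mem_inter]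
        by_cases hzB : z ∈ B
        · simp [hzB, hz, Ne.symm hxz]
        · simp [hzB]
  rw [sum_congr rfl h1, sum_comm, edgeEntropy, mul_sum]
  refine sum_congr rfl fun x hx => ?_
  rw [sum_comm, mul_sum]
  refine sum_congr rfl fun y hy => ?_
  rw [sum_comm, mul_sum]
  refine sum_congr rfl fun B _ => ?_
  by_cases h0 : edgeTerm f x y B = 0
  · simp [h0]
  have hxy : x ∈ B ∧ y ∉ B := by
    by_contra h; exact h0 (by simp only [edgeTerm, if_neg h])
  have hfB : f B ≠ 0 := by
    intro h; exact h0 (by simp [edgeTerm, h])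
  rw [← sum_filter, sum_const, nsmul_eq_mul]
  congr 1
  have h2 : {z ∈ A | z ∈ (B ∩ A).erase x} = (B ∩ A).erase x := by
    ext z; simp only [mem_filter, mem_erase, mem_inter]; tauto
  have hmem : x ∈ B ∩ A := mem_inter.2 ⟨hxy.1, hx⟩
  have h3 := card_erase_add_one hmem
  rw [hsupp B hfB] at h3
  rw [h2, ← h3]; push_cast; ring

/-- The variational (Gibbs) upper bound on the edge entropy. -/
lemma edgeEntropy_le {A : Finset V} {f : Finset V → ℝ} (hf : ∀ B, 0 ≤ f B) {t : V → V → ℝ}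
    (ht : ∀ x y, 0 ≤ t x y) (htt : ∀ x y, t x y + t y x ≤ 1)
    (hpos : ∀ x y B, 0 < f B → x ∈ B → y ∉ B → 0 < t x y) :
    edgeEntropy A f
      ≤ ∑ x ∈ A, ∑ y ∈ A, ∑ B, if x ∈ B ∧ y ∉ B then f B * -Real.log (t x y) else 0 := by
  set m : V → V → ℝ := fun x y => ∑ B, if x ∈ B ∧ y ∉ B then f B else 0 with hm
  have hm0 : ∀ x y, 0 ≤ m x y := fun x y =>
    sum_nonneg fun B _ => by split_ifs; exacts [hf B, le_rfl]
  have hswap : ∀ x y, ∑ B, (if x ∈ B ∧ y ∉ B then f (swapSites x y B) else 0) = m y x := by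
    intro x y
    rw [hm, ← sum_swapSites x y]
    refine sum_congr rfl fun B _ => ?_
    simp [mem_swapSites, swapSites_swapSites]
  have hterm : ∀ x y, ∑ B, edgeTerm f x y B
      ≤ (∑ B, if x ∈ B ∧ y ∉ B then f B * -Real.log (t x y) else 0)
        + ((m x y + m y x) * t x y - m x y) := by
    intro x y
    rw [← hswap x y, hm]
    simp only
    rw [← sum_add_distrib, sum_mul, ← sum_sub_distrib, ← sum_add_distrib]
    refine sum_le_sum fun B _ => ?_
    unfold edgeTerm
    by_cases hxy : x ∈ B ∧ y ∉ B
    · simp only [if_pos hxy]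
      rcases (hf B).eq_or_lt with h | h
      · simp only [← h]
        have := mul_nonneg (hf (swapSites x y B)) (ht x y)
        simpa using this
      · have htp := hpos x y B h hxy.1 hxy.2
        have hs := hf (swapSites x y B)
        have hq : 0 < (f B + f (swapSites x y B)) / f B := by positivity
        have hl := Real.log_le_sub_one_of_pos (mul_pos hq htp)
        rw [Real.log_mul hq.ne' htp.ne'] at hl
        have h2 := mul_le_mul_of_nonneg_left hl h.le
        have h3 : f B * ((f B + f (swapSites x y B)) / f B * t x y - 1)
            = (f B + f (swapSites x y B)) * t x y - f B := by field_simp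
        rw [h3] at h2
        linarith
    · simp only [if_neg hxy]; simp
  have hcorr : ∑ x ∈ A, ∑ y ∈ A, ((m x y + m y x) * t x y - m x y) ≤ 0 := by
    have h1 : ∑ x ∈ A, ∑ y ∈ A, ((m x y + m y x) * t x y - m x y)
        = ∑ x ∈ A, ∑ y ∈ A, ((m y x + m x y) * t y x - m y x) := sum_comm
    have h2 : ∑ x ∈ A, ∑ y ∈ A, ((m x y + m y x) * t x y - m x y)
        + ∑ x ∈ A, ∑ y ∈ A, ((m y x + m x y) * t y x - m y x) ≤ 0 := by
      rw [← sum_add_distrib]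
      refine sum_nonpos fun x _ => ?_
      rw [← sum_add_distrib]
      refine sum_nonpos fun y _ => ?_
      nlinarith [hm0 x y, hm0 y x, htt x y]
    linarith
  calc edgeEntropy A f
      ≤ ∑ x ∈ A, ∑ y ∈ A, ((∑ B, if x ∈ B ∧ y ∉ B then f B * -Real.log (t x y) else 0)
        + ((m x y + m y x) * t x y - m x y)) :=
        sum_le_sum fun x _ => sum_le_sum fun y _ => hterm x y
    _ ≤ _ := by
      simp only [sum_add_distrib]
      linarith

/-- Summing over exchanges a function that splits into a particle part and a hole part. -/
lemma sum_exchanges {A : Finset V} {f : Finset V → ℝ} {r : ℕ}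
    (hsupp : ∀ B, f B ≠ 0 → (B ∩ A).card = r) (α β : V → ℝ) :
    ∑ x ∈ A, ∑ y ∈ A, ∑ B, (if x ∈ B ∧ y ∉ B then f B * (α x + β y) else 0)
      = ((A.card : ℝ) - r) * ∑ x ∈ A, occupation f x * α x
        + r * ∑ y ∈ A, (∑ B, f B - occupation f y) * β y := by
  have hcount : ∀ B, f B ≠ 0 → ((A.filter fun y => y ∉ B).card : ℝ) = A.card - r ∧
      ((A.filter fun x => x ∈ B).card : ℝ) = r := by
    intro B hB
    have h1 : A.filter (fun x => x ∈ B) = B ∩ A := by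
      ext; simp only [mem_filter, mem_inter]; tauto
    have h2 := card_filter_add_card_filter_not (s := A) (fun x => x ∈ B)
    rw [h1, hsupp B hB] at h2 ⊢
    refine ⟨?_, rfl⟩
    rw [← h2]; push_cast; ring
  have e1 : ∑ x ∈ A, ∑ y ∈ A, ∑ B, (if x ∈ B ∧ y ∉ B then f B * α x else 0)
      = ((A.card : ℝ) - r) * ∑ x ∈ A, occupation f x * α x := by
    rw [mul_sum]
    refine sum_congr rfl fun x _ => ?_
    rw [sum_comm, occupation, sum_mul, mul_sum]
    refine sum_congr rfl fun B _ => ?_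
    by_cases hx : x ∈ B
    · simp only [hx, true_and, restrictParticle, if_true]
      rw [← sum_filter, sum_const, nsmul_eq_mul]
      by_cases hB : f B = 0
      · simp [hB]
      · rw [(hcount B hB).1]
    · simp [hx, restrictParticle]
  have e2 : ∑ x ∈ A, ∑ y ∈ A, ∑ B, (if x ∈ B ∧ y ∉ B then f B * β y else 0)
      = r * ∑ y ∈ A, (∑ B, f B - occupation f y) * β y := by
    rw [sum_comm, mul_sum]
    refine sum_congr rfl fun y _ => ?_
    rw [sum_comm, ← sum_restrictHole, sum_mul, mul_sum]
    refine sum_congr rfl fun B _ => ?_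
    by_cases hy : y ∈ B
    · simp [hy, restrictHole]
    · simp only [hy, not_false_eq_true, and_true, restrictHole, if_false]
      rw [← sum_filter, sum_const, nsmul_eq_mul]
      by_cases hB : f B = 0
      · simp [hB]
      · rw [(hcount B hB).2]
  rw [← e1, ← e2, ← sum_add_distrib]
  refine sum_congr rfl fun x _ => ?_
  rw [← sum_add_distrib]
  refine sum_congr rfl fun y _ => ?_
  rw [← sum_add_distrib]
  refine sum_congr rfl fun B _ => ?_
  split_ifs <;> ring

lemma siteEntropy_eq {f : Finset V → ℝ} (hf : ∀ B, 0 ≤ f B) (hF : 0 < ∑ B, f B) (z : V) :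
    siteEntropy f z = occupation f z * -Real.log (occupation f z / ∑ B, f B)
      + (∑ B, f B - occupation f z) * -Real.log (1 - occupation f z / ∑ B, f B) := by
  have h0 := occupation_nonneg hf z
  have h1 := occupation_le hf z
  simp only [siteEntropy]
  generalize occupation f z = P at *
  generalize ∑ B, f B = F at *
  have key : ∀ Q, 0 ≤ Q → Q * -Real.log (Q / F) = Real.negMulLog Q + Q * Real.log F := by
    intro Q hQ
    rcases hQ.eq_or_lt with rfl | hQ
    · simp
    · rw [Real.log_div hQ.ne' hF.ne', Real.negMulLog]; ring
  have e : 1 - P / F = (F - P) / F := by field_simp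
  rw [e, key P h0, key (F - P) (by linarith), Real.negMulLog, Real.negMulLog, Real.negMulLog]
  ring

/-- The edge entropy is controlled by the sum of the single-site entropies. -/
lemma edgeEntropy_le_sum_siteEntropy {A : Finset V} {f : Finset V → ℝ} {r : ℕ}
    (hf : ∀ B, 0 ≤ f B) (hsupp : ∀ B, f B ≠ 0 → (B ∩ A).card = r)
    (hr : 0 < r) (hrA : r < A.card) :
    A.card * Real.binEntropy (r / A.card) * edgeEntropy A f
      ≤ r * (A.card - r) * Real.log 2 * ∑ z ∈ A, siteEntropy f z := by
  have hn : (0 : ℝ) < A.card := by exact_mod_cast hr.trans hrA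
  have hr' : (0 : ℝ) < r := by exact_mod_cast hr
  have hrn : (r : ℝ) < A.card := by exact_mod_cast hrA
  set n : ℝ := (A.card : ℝ) with hn_def
  have hρ : 0 < r / n := by positivity
  have hρ1 : r / n < 1 := (div_lt_one hn).2 hrn
  have hH := Real.binEntropy_pos hρ hρ1
  set F := ∑ B, f B with hF_def
  rcases (sum_nonneg fun B _ => hf B : 0 ≤ F).eq_or_lt with hF | hF
  · have hz : ∀ B, f B = 0 := fun B =>
      (sum_eq_zero_iff_of_nonneg fun B _ => hf B).1 hF.symm B (mem_univ B)
    have e1 : edgeEntropy A f = 0 := by simp [edgeEntropy, edgeTerm, hz]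
    have e2 : ∀ z, siteEntropy f z = 0 := fun z => by
      simp [siteEntropy, occupation, restrictParticle, hz]
    simp [e1, e2]
  set L := Real.log 2 / Real.binEntropy (r / n) with hL
  have hL0 : 0 < L := div_pos (Real.log_pos one_lt_two) hH
  have hLH : L * Real.binEntropy (r / n) = Real.log 2 := by rw [hL]; field_simp
  set c := r / n * L with hc
  set d := (1 - r / n) * L with hd
  have hc0 : 0 < c := by positivity
  have hd0 : 0 < d := mul_pos (by linarith) hL0
  set p : V → ℝ := fun x => occupation f x / F with hp
  have hp01 : ∀ x, p x ∈ Set.Icc (0 : ℝ) 1 := fun x =>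
    ⟨div_nonneg (occupation_nonneg hf x) hF.le, (div_le_one hF).2 (occupation_le hf x)⟩
  have hppos : ∀ x B, 0 < f B → x ∈ B → 0 < p x := fun x B hB hx =>
    div_pos (hB.trans_le (le_occupation hf hx)) hF
  have hppos' : ∀ y B, 0 < f B → y ∉ B → 0 < 1 - p y := fun y B hB hy => by
    have := hB.trans_le (le_sum_sub_occupation hf hy)
    rw [sub_pos, hp, div_lt_one hF]
    linarith
  have hmain := edgeEntropy_le (A := A) hf (t := fun x y => p x ^ c * (1 - p y) ^ d)
    (fun x y => mul_nonneg (Real.rpow_nonneg (hp01 x).1 _)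
      (Real.rpow_nonneg (by linarith [(hp01 y).2]) _))
    (fun x y => two_point hρ hρ1 hLH hc hd (hp01 x) (hp01 y))
    (fun x y B hB hx hy => mul_pos (Real.rpow_pos_of_pos (hppos x B hB hx) _)
      (Real.rpow_pos_of_pos (hppos' y B hB hy) _))
  have hsplit : ∑ x ∈ A, ∑ y ∈ A, ∑ B,
        (if x ∈ B ∧ y ∉ B then f B * -Real.log (p x ^ c * (1 - p y) ^ d) else 0)
      = ∑ x ∈ A, ∑ y ∈ A, ∑ B, (if x ∈ B ∧ y ∉ B then
          f B * (c * -Real.log (p x) + d * -Real.log (1 - p y)) else 0) := by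
    refine sum_congr rfl fun x _ => sum_congr rfl fun y _ => sum_congr rfl fun B _ => ?_
    split_ifs with hxy
    · rcases (hf B).eq_or_lt with h | h
      · simp [← h]
      · have h1 := hppos x B h hxy.1
        have h2 := hppos' y B h hxy.2
        rw [Real.log_mul (by positivity) (by positivity), Real.log_rpow h1, Real.log_rpow h2]
        ring
    · rfl
  rw [hsplit, sum_exchanges hsupp (fun x => c * -Real.log (p x))
    (fun y => d * -Real.log (1 - p y))] at hmain
  have hsum : (n - r) * ∑ x ∈ A, occupation f x * (c * -Real.log (p x))
        + r * ∑ y ∈ A, (F - occupation f y) * (d * -Real.log (1 - p y))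
      = r * (n - r) / n * L * ∑ z ∈ A, siteEntropy f z := by
    rw [mul_sum, mul_sum, mul_sum, ← sum_add_distrib]
    refine sum_congr rfl fun z _ => ?_
    rw [siteEntropy_eq hf hF, ← hF_def, hc, hd]
    simp only [hp]
    field_simp
  rw [← hn_def, ← hF_def, hsum] at hmain
  calc n * Real.binEntropy (r / n) * edgeEntropy A f
      ≤ n * Real.binEntropy (r / n) * (r * (n - r) / n * L * ∑ z ∈ A, siteEntropy f z) := by
        gcongr
    _ = r * (n - r) * (L * Real.binEntropy (r / n)) * ∑ z ∈ A, siteEntropy f z := by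
        field_simp
    _ = _ := by rw [hLH]

/-- The sharp entropy inequality in homogeneous form. -/
lemma edgeEntropy_le_totalEntropy {A : Finset V} {r : ℕ} (hrA : r ≤ A.card) {f : Finset V → ℝ}
    (hf : ∀ B, 0 ≤ f B) (hsupp : ∀ B, f B ≠ 0 → (B ∩ A).card = r) :
    Real.log (A.card.choose r) * edgeEntropy A f
      ≤ r * (A.card - r) * Real.log 2 * totalEntropy f := by
  induction hk : A.card generalizing A r f with
  | zero =>
    obtain rfl : r = 0 := by omega
    simp
  | succ k ih =>
    rw [hk] at hrA
    rcases Nat.eq_zero_or_pos r with rfl | hr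
    · simp
    rcases hrA.eq_or_lt with rfl | hrk
    · simp
    have hrk' : r ≤ k := by omega
    have hr0 : (0 : ℝ) < r := by exact_mod_cast hr
    have hrn : (0 : ℝ) < (k + 1 : ℕ) - r := by
      rw [sub_pos]; exact_mod_cast hrk
    have hlog2 : 0 < Real.log 2 := Real.log_pos one_lt_two
    have hf0 : ∀ z B, 0 ≤ restrictHole f z B := fun z B => by
      unfold restrictHole; split_ifs; exacts [le_rfl, hf B]
    have hf1 : ∀ z B, 0 ≤ restrictParticle f z B := fun z B => by
      unfold restrictParticle; split_ifs; exacts [hf B, le_rfl]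
    have hcard : ∀ z ∈ A, (A.erase z).card = k := fun z hz => by
      rw [card_erase_of_mem hz, hk]; rfl
    have hhole : Real.log (k.choose r) * edgeEntropy A f
        ≤ r * Real.log 2 * ∑ z ∈ A, totalEntropy (restrictHole f z) := by
      have h1 : ∀ z ∈ A, Real.log (k.choose r) * edgeEntropy (A.erase z) (restrictHole f z)
          ≤ r * (k - r) * Real.log 2 * totalEntropy (restrictHole f z) := by
        intro z hz
        refine ih (by rw [hcard z hz]; exact hrk') (hf0 z) (fun B hB => ?_) (hcard z hz)
        have hzB : z ∉ B := fun h => hB (by simp [restrictHole, h])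
        rw [inter_erase, erase_eq_of_notMem (fun h => hzB (mem_inter.1 h).1)]
        exact hsupp B fun h => hB (by simp [restrictHole, h])
      have h2 := sum_le_sum h1
      rw [← mul_sum, ← mul_sum, sum_edgeEntropy_restrictHole hsupp, hk] at h2
      rcases hrk'.eq_or_lt with rfl | hlt
      · simp only [Nat.choose_self, Nat.cast_one, Real.log_one, zero_mul]
        have := sum_nonneg fun z (_ : z ∈ A) => totalEntropy_nonneg (hf0 z)
        positivity
      · have hpos : (0 : ℝ) < k - r := by rw [sub_pos]; exact_mod_cast hlt
        refine le_of_mul_le_mul_left ?_ hpos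
        push_cast at h2
        linarith
    have hpart : Real.log (k.choose (r - 1)) * edgeEntropy A f
        ≤ ((k + 1 : ℕ) - r) * Real.log 2 * ∑ z ∈ A, totalEntropy (restrictParticle f z) := by
      have h1 : ∀ z ∈ A,
          Real.log (k.choose (r - 1)) * edgeEntropy (A.erase z) (restrictParticle f z)
          ≤ (r - 1 : ℕ) * (k - (r - 1 : ℕ)) * Real.log 2
            * totalEntropy (restrictParticle f z) := by
        intro z hz
        refine ih (by rw [hcard z hz]; omega) (hf1 z) (fun B hB => ?_) (hcard z hz)
        have hzB : z ∈ B := by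
          by_contra h; exact hB (by simp [restrictParticle, h])
        rw [inter_erase, card_erase_of_mem (mem_inter.2 ⟨hzB, hz⟩)]
        rw [hsupp B fun h => hB (by simp [restrictParticle, h])]
      have h2 := sum_le_sum h1
      rw [← mul_sum, ← mul_sum, sum_edgeEntropy_restrictParticle hsupp] at h2
      rcases Nat.eq_or_lt_of_le hr with h | hlt
      · rw [← h]
        simp only [Nat.succ_eq_add_one, zero_add, Nat.sub_self, Nat.choose_zero_right,
          Nat.cast_one, Real.log_one, zero_mul]
        have := sum_nonneg fun z (_ : z ∈ A) => totalEntropy_nonneg (hf1 z)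
        rw [← h] at hrn
        have hrn' : (0 : ℝ) < (k + 1 : ℕ) - 1 := by simpa using hrn
        positivity
      · have hpos : (0 : ℝ) < r - 1 := by rw [sub_pos]; exact_mod_cast hlt
        refine le_of_mul_le_mul_left ?_ hpos
        rw [Nat.cast_sub hr] at h2
        push_cast at h2 ⊢
        linarith
    have hchain : ((k + 1 : ℕ) : ℝ) * totalEntropy f
        = ∑ z ∈ A, totalEntropy (restrictHole f z) + ∑ z ∈ A, totalEntropy (restrictParticle f z)
          + ∑ z ∈ A, siteEntropy f z := by
      rw [← sum_add_distrib, ← sum_add_distrib, ← sum_congr rfl fun z _ => totalEntropy_eq f z,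
        sum_const, hk, nsmul_eq_mul]
    have hsite := edgeEntropy_le_sum_siteEntropy hf hsupp hr (by rw [hk]; exact hrk)
    rw [hk] at hsite
    have hN : (0 : ℝ) < (k + 1).choose r := by exact_mod_cast Nat.choose_pos hrA
    set n : ℝ := ((k + 1 : ℕ) : ℝ) with hn
    have hn0 : 0 < n := by rw [hn]; positivity
    have hlogp : Real.log (k.choose (r - 1)) = Real.log ((k + 1).choose r) + Real.log (r / n) := by
      rw [← Real.log_mul hN.ne' (by positivity)]
      congr 1
      have := Nat.add_one_mul_choose_eq k (r - 1)
      rw [Nat.sub_add_cancel hr] at this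
      have h' : n * (k.choose (r - 1)) = (k + 1).choose r * r := by
        rw [hn]; exact_mod_cast this
      field_simp
      linarith
    have hlogh : Real.log (k.choose r) = Real.log ((k + 1).choose r) + Real.log (1 - r / n) := by
      have e : 1 - r / n = (n - r) / n := by field_simp
      rw [← Real.log_mul hN.ne' (by rw [e]; positivity)]
      congr 1
      have h1 := Nat.add_one_mul_choose_eq k (r - 1)
      rw [Nat.sub_add_cancel hr] at h1
      have h1' : n * (k.choose (r - 1)) = (k + 1).choose r * r := by
        rw [hn]; exact_mod_cast h1
      have h2 := Nat.choose_succ_succ k (r - 1)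
      rw [Nat.succ_eq_add_one, Nat.succ_eq_add_one, Nat.sub_add_cancel hr] at h2
      have h2' : ((k + 1).choose r : ℝ) = k.choose (r - 1) + k.choose r := by exact_mod_cast h2
      rw [e]
      field_simp
      linear_combination n * (-h2') - h1'
    have hent : n * Real.binEntropy (r / n)
        = -(r * Real.log (r / n)) - (n - r) * Real.log (1 - r / n) := by
      rw [Real.binEntropy, Real.log_inv, Real.log_inv]
      field_simp
      ring
    rw [hent] at hsite
    rw [hlogh] at hhole
    rw [hlogp] at hpart
    have h1 := mul_le_mul_of_nonneg_left hhole hrn.le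
    have h2 := mul_le_mul_of_nonneg_left hpart hr0.le
    refine le_of_mul_le_mul_left ?_ hn0
    have h3 : n * (r * (n - r) * Real.log 2 * totalEntropy f)
        = r * (n - r) * Real.log 2 * (n * totalEntropy f) := by ring
    rw [h3, hchain]
    linarith

end EdgeEntropy

section Configurations

open Stmt5

variable {V : Type*} [Fintype V] [DecidableEq V] {r : ℕ}

/-- The extension by zero of a function of configurations to all subsets. -/
def extendConfig (f : Config V r → ℝ) (B : Finset V) : ℝ := if h : B.card = r then f ⟨B, h⟩ else 0

lemma extendConfig_coe (f : Config V r → ℝ) (η : Config V r) : extendConfig f η.1 = f η :=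
  dif_pos η.2

lemma extendConfig_of_card_ne (f : Config V r → ℝ) {B : Finset V} (h : B.card ≠ r) :
    extendConfig f B = 0 :=
  dif_neg h

lemma extendConfig_swapSites (f : Config V r → ℝ) (x y : V) (η : Config V r) :
    extendConfig f (swapSites x y η.1) = f (swapCfg x y η) :=
  extendConfig_coe f (swapCfg x y η)

lemma extendConfig_nonneg {f : Config V r → ℝ} (hf : ∀ η, 0 ≤ f η) (B : Finset V) :
    0 ≤ extendConfig f B := by
  unfold extendConfig
  split_ifs
  exacts [hf _, le_rfl]

lemma sum_config {Φ : Finset V → ℝ} (h : ∀ B, B.card ≠ r → Φ B = 0) :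
    ∑ η : Config V r, Φ η.1 = ∑ B, Φ B := by
  rw [← sum_filter_of_ne (p := fun B : Finset V => B.card = r)
    fun B _ hB => by_contra fun h' => hB (h B h')]
  exact (sum_subtype (p := fun B : Finset V => B.card = r) _ (by simp) Φ).symm

lemma card_config : Fintype.card (Config V r) = (Fintype.card V).choose r := by
  have h := Fintype.card_of_subtype (p := fun B : Finset V => B.card = r)
    (powersetCard r univ) (by simp [mem_powersetCard])
  rw [card_powersetCard, card_univ] at h
  rw [← h]
  exact Fintype.card_congr (Equiv.refl _)

lemma psi_eq {s t : ℝ} (hs : 0 ≤ s) (ht : 0 ≤ t) :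
    psi s t = (s * Real.log 2 - s * Real.log ((s + t) / s)) / 2
      + (t * Real.log 2 - t * Real.log ((t + s) / t)) / 2 := by
  have key : ∀ a b : ℝ, 0 ≤ a → 0 ≤ b →
      a / 2 * Real.log (2 * a / (a + b)) = (a * Real.log 2 - a * Real.log ((a + b) / a)) / 2 := by
    intro a b ha hb
    rcases ha.eq_or_lt with rfl | ha
    · simp
    · have e : 2 * a / (a + b) = 2 / ((a + b) / a) := by field_simp
      rw [e, Real.log_div two_ne_zero (by positivity)]
      ring
  rw [psi, key s t hs ht, add_comm s t, ← key t s ht hs, add_comm t s]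

/-- The entropy of a density with respect to the uniform law is, up to normalization, the defect
of its Shannon entropy. -/
lemma card_mul_Ent [Nonempty (Config V r)] {f : Config V r → ℝ} (hf : ∀ η, 0 ≤ f η) :
    Fintype.card (Config V r) * Ent f
      = (∑ η, f η) * Real.log (Fintype.card (Config V r)) - totalEntropy (extendConfig f) := by
  have hN : (0 : ℝ) < Fintype.card (Config V r) := by exact_mod_cast Fintype.card_pos
  have e1 : ∑ B, extendConfig f B = ∑ η, f η := by
    rw [← sum_config fun B => extendConfig_of_card_ne f]
    simp only [extendConfig_coe]
  have e2 : ∑ B, Real.negMulLog (extendConfig f B) = ∑ η, Real.negMulLog (f η) := by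
    rw [← sum_config fun B h => by rw [extendConfig_of_card_ne f h, Real.negMulLog_zero]]
    simp only [extendConfig_coe]
  rw [totalEntropy, e1, e2, Ent, mean, mul_div_cancel₀ _ hN.ne', mean]
  generalize (Fintype.card (Config V r) : ℝ) = N at *
  rcases (sum_nonneg fun η _ => hf η : 0 ≤ ∑ η, f η).eq_or_lt with hF | hF
  · have hz : ∀ η, f η = 0 := fun η =>
      (sum_eq_zero_iff_of_nonneg fun η _ => hf η).1 hF.symm η (mem_univ η)
    simp [hz]
  · generalize hF' : ∑ η, f η = F at *
    have h : ∀ η, f η * Real.log (f η / (F / N))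
        = f η * (Real.log N - Real.log F) - Real.negMulLog (f η) := by
      intro η
      rcases (hf η).eq_or_lt with h | h
      · simp [← h]
      · rw [Real.log_div h.ne' (by positivity), Real.log_div hF.ne' hN.ne', Real.negMulLog]
        ring
    rw [sum_congr rfl fun η _ => h η, sum_sub_distrib, ← sum_mul, hF', Real.negMulLog]
    ring

/-- The number of possible exchanges in a configuration. -/
lemma sum_exchanges_const {A : Finset V} {f : Finset V → ℝ} {k : ℕ}
    (hsupp : ∀ B, f B ≠ 0 → (B ∩ A).card = k) (hA : A.Nonempty) :
    ∑ x ∈ A, ∑ y ∈ A, ∑ B, (if x ∈ B ∧ y ∉ B then f B else 0)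
      = k * (A.card - k) * ∑ B, f B := by
  have h1 := sum_exchanges hsupp (fun _ => 1) (fun _ => 0)
  have h2 := sum_exchanges hsupp (fun _ => 0) (fun _ => 1)
  simp only [add_zero, zero_add, mul_one, mul_zero, sum_const_zero, sum_sub_distrib, sum_const,
    nsmul_eq_mul] at h1 h2
  have hn : (A.card : ℝ) ≠ 0 := by exact_mod_cast hA.card_pos.ne'
  refine mul_left_cancel₀ hn ?_
  linear_combination (k : ℝ) * h1 + ((A.card : ℝ) - k) * h2

lemma half_sum_mean_entEdge [Nonempty V] {f : Config V r → ℝ} (hf : ∀ η, 0 ≤ f η) :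
    (1 / 2) * ∑ x : V, ∑ y : V, mean (entEdge x y f)
      = (r * ((Fintype.card V : ℝ) - r) * Real.log 2 * ∑ η, f η
        - edgeEntropy univ (extendConfig f)) / Fintype.card (Config V r) := by
  set g := extendConfig f with hg
  have hg0 : ∀ B, 0 ≤ g B := extendConfig_nonneg hf
  set D : V → V → ℝ := fun x y =>
    ∑ B, if x ∈ B ∧ y ∉ B then psi (g B) (g (swapSites x y B)) else 0 with hD
  set m : V → V → ℝ := fun x y => ∑ B, if x ∈ B ∧ y ∉ B then g B else 0 with hm
  set T : V → V → ℝ := fun x y => ∑ B, edgeTerm g x y B with hT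
  have hmean : ∀ x y, mean (entEdge x y f) = (D x y + D y x) / Fintype.card (Config V r) := by
    intro x y
    rw [mean]
    congr 1
    rw [hD, ← sum_add_distrib, ← sum_config (r := r)]
    · refine sum_congr rfl fun η _ => ?_
      rw [swapSites_comm y x, hg, extendConfig_coe, extendConfig_swapSites, entEdge]
      by_cases hx : x ∈ η.1 <;> by_cases hy : y ∈ η.1 <;> simp [hx, hy]
    · intro B hB
      have h1 : g B = 0 := extendConfig_of_card_ne f hB
      have h2 : ∀ a b, g (swapSites a b B) = 0 := fun a b =>
        extendConfig_of_card_ne f (by rwa [card_swapSites])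
      simp [h1, h2, psi]
  have hDm : ∀ x y, D x y = (m x y * Real.log 2 - T x y) / 2 + (m y x * Real.log 2 - T y x) / 2 := by
    intro x y
    have h1 : ∀ a b, m a b * Real.log 2 - T a b = ∑ B, if a ∈ B ∧ b ∉ B then
        g B * Real.log 2 - g B * Real.log ((g B + g (swapSites a b B)) / g B) else 0 := by
      intro a b
      rw [hm, hT, sum_mul, ← sum_sub_distrib]
      refine sum_congr rfl fun B _ => ?_
      unfold edgeTerm
      split_ifs <;> simp
    rw [h1, h1, ← sum_swapSites x y (fun B => if y ∈ B ∧ x ∉ B then _ else _), sum_div, sum_div,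
      ← sum_add_distrib]
    refine sum_congr rfl fun B _ => ?_
    rw [swapSites_comm y x, swapSites_swapSites]
    simp only [mem_swapSites, Equiv.swap_apply_left, Equiv.swap_apply_right]
    split_ifs
    · exact psi_eq (hg0 _) (hg0 _)
    · simp
  have hmF : ∑ x, ∑ y, m x y = r * ((Fintype.card V : ℝ) - r) * ∑ η, f η := by
    have h := sum_exchanges_const (A := univ) (f := g) (k := r) (fun B hB => by
      rw [inter_univ]
      exact by_contra fun h => hB (extendConfig_of_card_ne f h)) univ_nonempty
    rw [hm, h, card_univ, ← sum_config fun B => extendConfig_of_card_ne f]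
    simp only [extendConfig_coe]
  have hsymm : ∀ Φ : V → V → ℝ, ∑ x, ∑ y, Φ y x = ∑ x, ∑ y, Φ x y := fun Φ => sum_comm
  have hDsum : ∑ x, ∑ y, D x y = (∑ x, ∑ y, m x y) * Real.log 2 - ∑ x, ∑ y, T x y := by
    simp only [hDm, sum_add_distrib]
    rw [hsymm fun x y => (m x y * Real.log 2 - T x y) / 2]
    simp only [← sum_div, sum_sub_distrib, ← sum_mul]
    ring
  have hE : edgeEntropy univ g = ∑ x, ∑ y, T x y := rfl
  simp only [hmean, ← sum_div, sum_add_distrib]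
  rw [hsymm D, hDsum, hmF, hE]
  ring

lemma one_lt_choose {n k : ℕ} (hk : 1 ≤ k) (hkn : k < n) : 1 < n.choose k := by
  obtain ⟨n, rfl⟩ := Nat.exists_eq_add_of_lt hkn
  obtain ⟨k, rfl⟩ := Nat.exists_eq_add_of_le' hk
  rw [Nat.choose_succ_succ, Nat.succ_eq_add_one]
  have h1 := Nat.choose_pos (n := k + 1 + n) (k := k) (by omega)
  have h2 := Nat.choose_pos (n := k + 1 + n) (k := k + 1) (by omega)
  omega

/-- The entropy inequality for the Bernoulli–Laplace model. -/
lemma log_choose_mul_Ent_le {f : Config V r → ℝ} (hf : ∀ η, 0 ≤ f η) (hr : 1 ≤ r)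
    (hrV : r < Fintype.card V) :
    r * ((Fintype.card V : ℝ) - r) * Real.log 2 * Ent f
      ≤ Real.log ((Fintype.card V).choose r)
        * ((1 / 2) * ∑ x : V, ∑ y : V, mean (entEdge x y f)) := by
  have : Nonempty V := Fintype.card_pos_iff.1 (by omega)
  have hN : 0 < Fintype.card (Config V r) := by
    rw [card_config]; exact Nat.choose_pos hrV.le
  have : Nonempty (Config V r) := Fintype.card_pos_iff.1 hN
  have hN' : (0 : ℝ) < Fintype.card (Config V r) := by exact_mod_cast hN
  have hmain := edgeEntropy_le_totalEntropy (A := univ) (r := r) (by rw [card_univ]; exact hrV.le)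
    (extendConfig_nonneg hf) fun B hB => by
      rw [inter_univ]
      exact by_contra fun h => hB (extendConfig_of_card_ne f h)
  have hEnt := card_mul_Ent hf
  rw [card_univ] at hmain
  rw [half_sum_mean_entEdge hf, mul_div_assoc', le_div_iff₀ hN']
  rw [card_config] at hEnt ⊢
  linear_combination hmain + r * ((Fintype.card V : ℝ) - r) * Real.log 2 * hEnt

/-- The edge entropy of a point mass vanishes. -/
lemma edgeEntropy_single (A C : Finset V) :
    edgeEntropy A (fun B => if B = C then 1 else 0) = 0 := by
  refine sum_eq_zero fun x _ => sum_eq_zero fun y _ => sum_eq_zero fun B _ => ?_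
  simp only [edgeTerm]
  split_ifs with hxy hB hB'
  · have hx : x ∈ swapSites x y B := by rw [hB', ← hB]; exact hxy.1
    rw [mem_swapSites, Equiv.swap_apply_left] at hx
    exact absurd hx hxy.2
  all_goals simp

lemma totalEntropy_single (C : Finset V) :
    totalEntropy (fun B => if B = C then 1 else 0) = 0 := by
  simp [totalEntropy, Real.negMulLog, apply_ite]

/-- A point mass gives the upper bound on the entropy constant. -/
lemma mul_log_choose_le {κ : ℝ} (hr : 1 ≤ r) (hrV : r < Fintype.card V)
    (hκ : ∀ f : Config V r → ℝ, (∀ η, 0 ≤ f η) →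
      κ * Ent f ≤ (1 / 2) * ∑ x : V, ∑ y : V, mean (entEdge x y f)) :
    κ * Real.log ((Fintype.card V).choose r) ≤ r * ((Fintype.card V : ℝ) - r) * Real.log 2 := by
  have : Nonempty V := Fintype.card_pos_iff.1 (by omega)
  have hN : 0 < Fintype.card (Config V r) := by
    rw [card_config]; exact Nat.choose_pos hrV.le
  have : Nonempty (Config V r) := Fintype.card_pos_iff.1 hN
  have hN' : (0 : ℝ) < Fintype.card (Config V r) := by exact_mod_cast hN
  let η₀ : Config V r := Classical.arbitrary _
  set f : Config V r → ℝ := fun η => if η.1 = η₀.1 then 1 else 0 with hf_def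
  have hf : ∀ η, 0 ≤ f η := fun η => by
    rw [hf_def]; positivity
  have hext : extendConfig f = fun B => if B = η₀.1 then 1 else 0 := by
    ext B
    by_cases h : B.card = r
    · exact extendConfig_coe f ⟨B, h⟩
    · rw [extendConfig_of_card_ne f h, if_neg fun h' : B = η₀.1 => h (h' ▸ η₀.2)]
  have hsum : ∑ η, f η = 1 := by
    rw [hf_def, sum_config (Φ := fun B => if B = η₀.1 then (1 : ℝ) else 0)
      fun B h => if_neg fun h' : B = η₀.1 => h (h' ▸ η₀.2)]
    simp
  have hEnt := card_mul_Ent hf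
  have h := hκ f hf
  rw [half_sum_mean_entEdge hf, hext, edgeEntropy_single, hsum, le_div_iff₀ hN'] at h
  rw [hext, totalEntropy_single, hsum] at hEnt
  rw [card_config] at hEnt h
  linear_combination h - κ * hEnt

end Configurations

end BernoulliLaplace

open Stmt5 in
theorem stmt5 {V : Type*} [Fintype V] [DecidableEq V]
    (n r : ℕ) (hn : 2 ≤ n) (hr1 : 1 ≤ r) (hr2 : r ≤ n - 1)
    (hcard : Fintype.card V = n) :
    IsGreatest
      {κ : ℝ | 0 ≤ κ ∧ ∀ f : Config V r → ℝ, (∀ η, 0 ≤ f η) →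
        κ * Ent f ≤ (1 / 2) * ∑ x : V, ∑ y : V, mean (entEdge x y f)}
      ((r : ℝ) * ((n : ℝ) - r) * Real.log 2 / Real.log (Nat.choose n r)) := by
  subst hcard
  have hrV : r < Fintype.card V := by omega
  have hlog : 0 < Real.log ((Fintype.card V).choose r) :=
    Real.log_pos (by exact_mod_cast BernoulliLaplace.one_lt_choose hr1 hrV)
  have hsub : (0 : ℝ) < Fintype.card V - r := by
    rw [sub_pos]; exact_mod_cast hrV
  refine ⟨⟨by positivity, fun f hf => ?_⟩, fun κ hκ => ?_⟩
  · rw [div_mul_eq_mul_div, div_le_iff₀' hlog]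
    exact BernoulliLaplace.log_choose_mul_Ent_le hf hr1 hrV
  · rw [le_div_iff₀ hlog]
    exact BernoulliLaplace.mul_log_choose_le hr1 hrV hκ.2
end

section
/- For every integer n ≥ 1, every real p ≥ 1, and every n×n matrix A with nonnegative real entries, perm(A) ≤ max{1, n!/n^{n/p}} · ∏_{i=1}^n ‖R_i‖_p. -/
open Finset

open Real

/-- Gibbs' inequality. -/
lemma sum_mul_log_le_sum_mul_log {ι : Type*} [Fintype ι] (μ ν : ι → ℝ) (hμ : ∀ i, 0 ≤ μ i)
    (hν : ∀ i, 0 ≤ ν i) (hpos : ∀ i, 0 < μ i → 0 < ν i) (hsum : ∑ i, ν i ≤ ∑ i, μ i) :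
    ∑ i, μ i * log (ν i) ≤ ∑ i, μ i * log (μ i) := by
  have key : ∀ i, μ i * log (ν i) - μ i * log (μ i) ≤ ν i - μ i := by
    intro i
    rcases (hμ i).eq_or_lt with h | h
    · simpa [← h] using hν i
    · have h2 := hpos i h
      rw [← mul_sub, ← log_div h2.ne' h.ne']
      calc _ ≤ μ i * (ν i / μ i - 1) :=
            mul_le_mul_of_nonneg_left (log_le_sub_one_of_pos (by positivity)) h.le
        _ = _ := by field_simp
  have := Finset.sum_le_sum fun i (_ : i ∈ univ) => key i
  simp only [Finset.sum_sub_distrib] at this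
  linarith

lemma Equiv.Perm.sum_eq_sum_decomposeFin {n : ℕ} (g : Equiv.Perm (Fin (n + 1)) → ℝ) :
    ∑ σ, g σ = ∑ p, ∑ e : Equiv.Perm (Fin n), g (Equiv.Perm.decomposeFin.symm (p, e)) := by
  rw [← Fintype.sum_prod_type', ← Equiv.sum_comp (Equiv.Perm.decomposeFin (n := n)).symm]

/-- Sampling a permutation sequentially, the value at `i` being chosen among the unused values with
probability proportional to the weights `b i`, has total mass at most one. -/
lemma sum_perm_prod_div_le_one {n : ℕ} (b : Fin n → Fin n → ℝ) (hb : ∀ i j, 0 ≤ b i j) :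
    ∑ σ : Equiv.Perm (Fin n), ∏ i, (b i (σ i) / ∑ k, if i ≤ k then b i (σ k) else 0) ≤ 1 := by
  induction n with
  | zero => simp
  | succ n ih =>
    rw [Equiv.Perm.sum_eq_sum_decomposeFin]
    have h1 : ∀ p, ∑ e : Equiv.Perm (Fin n),
        ∏ i, (b i (Equiv.Perm.decomposeFin.symm (p, e) i) /
          ∑ k, if i ≤ k then b i (Equiv.Perm.decomposeFin.symm (p, e) k) else 0) ≤
        b 0 p / ∑ k, b 0 k := by
      intro p
      have h2 : ∀ e : Equiv.Perm (Fin n), ∑ k, b 0 (Equiv.Perm.decomposeFin.symm (p, e) k) =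
          ∑ k, b 0 k := fun e => Equiv.sum_comp _ (b 0)
      simp only [Fin.prod_univ_succ, Fin.zero_le, if_true, h2,
        Equiv.Perm.decomposeFin_symm_apply_zero, ← Finset.mul_sum]
      refine mul_le_of_le_one_right (div_nonneg (hb _ _) (sum_nonneg fun _ _ => hb _ _)) ?_
      simpa [Fin.sum_univ_succ, Fin.succ_ne_zero] using
        ih (fun i j => b i.succ (Equiv.swap 0 p j.succ)) fun _ _ => hb _ _
    refine (Finset.sum_le_sum fun p _ => h1 p).trans ?_
    rw [← Finset.sum_div]
    exact div_self_le_one _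

lemma sum_perm_prod_div_le_one_of_order {n : ℕ} (b : Fin n → Fin n → ℝ) (hb : ∀ i j, 0 ≤ b i j)
    (τ : Equiv.Perm (Fin n)) :
    ∑ σ : Equiv.Perm (Fin n), ∏ i, (b i (σ i) / ∑ k, if τ i ≤ τ k then b i (σ k) else 0) ≤ 1 := by
  refine le_of_eq_of_le ?_ (sum_perm_prod_div_le_one (fun i j => b (τ.symm i) j) fun _ _ => hb _ _)
  rw [← Equiv.sum_comp (Equiv.mulRight τ)]
  refine Finset.sum_congr rfl fun σ _ => ?_
  refine Eq.trans ?_ (Equiv.prod_comp τ _)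
  refine Finset.prod_congr rfl fun i _ => ?_
  rw [← Equiv.sum_comp τ (fun k => if τ i ≤ k then b (τ.symm (τ i)) (σ k) else 0)]
  simp

/-- The sum, over all orderings `ρ` of the coordinates of `P`, of `∑ i, P (ρ i) * log T i`, where
`T i` is the tail `∑ k ≥ i, P (ρ k)`. -/
noncomputable def tailLogSum {n : ℕ} (P : Fin n → ℝ) : ℝ :=
  ∑ ρ : Equiv.Perm (Fin n), ∑ i, P (ρ i) * log (∑ k, if i ≤ k then P (ρ k) else 0)

lemma tailLogSum_eq {n : ℕ} (P : Fin n → ℝ) :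
    tailLogSum P = ∑ j, P j * ∑ τ : Equiv.Perm (Fin n),
      log (∑ k, if τ j ≤ τ k then P k else 0) := by
  simp only [Finset.mul_sum, tailLogSum]
  rw [Finset.sum_comm (s := univ (α := Fin n)), ← Equiv.sum_comp (Equiv.inv (Equiv.Perm (Fin n)))]
  refine Finset.sum_congr rfl fun τ _ => ?_
  rw [← Equiv.sum_comp τ]
  refine Finset.sum_congr rfl fun i _ => ?_
  rw [← Equiv.sum_comp τ]
  simp

lemma tailLogSum_succ {n : ℕ} (P : Fin (n + 1) → ℝ) :
    tailLogSum P = (n.factorial : ℝ) * ((∑ k, P k) * log (∑ k, P k)) +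
      ∑ p, tailLogSum fun i : Fin n => P (Equiv.swap 0 p i.succ) := by
  unfold tailLogSum
  rw [Equiv.Perm.sum_eq_sum_decomposeFin, Finset.sum_mul, Finset.mul_sum, ← Finset.sum_add_distrib]
  refine Finset.sum_congr rfl fun p _ => ?_
  have h2 : ∀ e : Equiv.Perm (Fin n), ∑ k, P (Equiv.Perm.decomposeFin.symm (p, e) k) =
          ∑ k, P k := fun e => Equiv.sum_comp _ P
  simp only [Fin.sum_univ_succ (n := n) (fun i => _ * log _), Fin.zero_le, if_true, h2,
        Equiv.Perm.decomposeFin_symm_apply_zero, Finset.sum_add_distrib]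
  simp [Fin.sum_univ_succ, Fin.succ_ne_zero, Fintype.card_perm]

/-- The case of `entropyRatio_mul_sum_le` in which all coordinates but one are equal, their sum
being `z`. -/
lemma negMulLog_bound_of_equal_rest {N K : ℝ} (hN : 1 ≤ N) (hK1 : K ≤ 1) (hNK : 1 ≤ N * K)
    (hK : K * log (N + 1) = N * log ((N + 1) / N)) {z : ℝ} (hz0 : 0 ≤ z) (hz : z ≤ N / (N + 1)) :
    0 ≤ (1 - K) * negMulLog z - K * negMulLog (1 - z) + N * negMulLog (1 - z / N)
      - K * z * log N := by
  have hN0 : 0 < N := by linarith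
  set F : ℝ → ℝ := fun z => (1 - K) * negMulLog z - K * negMulLog (1 - z)
    + N * negMulLog (1 - z / N) - K * z * log N with hF
  set F' : ℝ → ℝ := fun z => -(1 - K) * log z - K * log (1 - z) + log (1 - z / N) - K * log N
    with hF'
  set F'' : ℝ → ℝ := fun z => ((N - K) * z - (1 - K) * N) / (z * (1 - z) * (N - z)) with hF''
  have hcont : Continuous F := by
    have := continuous_negMulLog
    simp only [hF]
    fun_prop
  have hd : ∀ x, 0 < x → x < 1 → HasDerivAt F (F' x) x := by
    intro x h0 h1
    have hxN : x / N < 1 := by rw [div_lt_one hN0]; linarith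
    have e1 := hasDerivAt_negMulLog h0.ne'
    have e2 := (hasDerivAt_negMulLog (x := 1 - x) (by linarith)).comp x
      ((hasDerivAt_id x).const_sub 1)
    have e3 := (hasDerivAt_negMulLog (x := 1 - x / N) (by linarith)).comp x
      (((hasDerivAt_id x).div_const N).const_sub 1)
    have e4 := ((hasDerivAt_id x).const_mul K).mul_const (log N)
    convert! (((e1.const_mul (1 - K)).sub (e2.const_mul K)).add (e3.const_mul N)).sub e4 using 1
    simp only [hF']
    field_simp
    ring
  have hd2 : ∀ x, 0 < x → x < 1 → HasDerivAt F' (F'' x) x := by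
    intro x h0 h1
    have hxN : x / N < 1 := by rw [div_lt_one hN0]; linarith
    have e1 := hasDerivAt_log h0.ne'
    have e2 := ((hasDerivAt_id x).const_sub 1).log (x := x) (by simp; linarith)
    have e3 := (((hasDerivAt_id x).div_const N).const_sub 1).log (x := x) (by simp; linarith)
    convert! (((e1.const_mul (-(1 - K))).sub (e2.const_mul K)).add e3).sub_const (K * log N) using 1
    have h3 : 1 - x ≠ 0 := by linarith
    have h4 : N - x ≠ 0 := by linarith
    simp only [hF'', id]
    have : 1 - x / N = (N - x) / N := by field_simp
    rw [this]
    field_simp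
    ring
  set w := N / (N + 1) with hw
  have hw0 : 0 < w := by positivity
  have hw1 : w < 1 := by rw [hw, div_lt_one (by linarith)]; linarith
  have hFw : F w = 0 := by
    have h1 : 1 - w = 1 / (N + 1) := by rw [hw]; field_simp; ring
    have h2 : 1 - w / N = N / (N + 1) := by rw [hw]; field_simp; ring
    rw [log_div (by linarith) (by linarith)] at hK
    simp only [hF, h1, h2]
    simp only [negMulLog, hw]
    rw [log_div (by linarith) (by linarith), log_div (by linarith) (by linarith), log_one]
    field_simp
    linear_combination (-1-N)*hK
  have hF'w : F' w = 0 := by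
    have h1 : 1 - w = 1 / (N + 1) := by rw [hw]; field_simp; ring
    have h2 : 1 - w / N = N / (N + 1) := by rw [hw]; field_simp; ring
    simp only [hF', h1, h2]
    rw [hw]
    rw [log_div (by linarith) (by linarith), log_div (by linarith) (by linarith), log_one]
    ring
  have hF0 : F 0 = 0 := by simp [hF]
  have hmono : ∀ a, 0 ≤ a → (1 - K) * N ≤ (N - K) * a → a ≤ w → 0 ≤ F a := by
    intro a ha0 ha haw
    have hm : MonotoneOn F' (Set.Ioc a w) := by
      refine monotoneOn_of_deriv_nonneg (convex_Ioc _ _) ?_ ?_ ?_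
      · exact fun x hx => (hd2 x (by linarith [hx.1]) (by linarith [hx.2])).continuousAt.continuousWithinAt
      · intro x hx
        rw [interior_Ioc] at hx
        exact (hd2 x (by linarith [hx.1]) (by linarith [hx.2])).differentiableAt.differentiableWithinAt
      · intro x hx
        rw [interior_Ioc] at hx
        rw [(hd2 x (by linarith [hx.1]) (by linarith [hx.2])).deriv]
        have : (N - K) * a ≤ (N - K) * x := mul_le_mul_of_nonneg_left hx.1.le (by linarith)
        refine div_nonneg (by linarith) (mul_nonneg (mul_nonneg ?_ ?_) ?_) <;> linarith [hx.1, hx.2]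
    have hanti : AntitoneOn F (Set.Icc a w) := by
      refine antitoneOn_of_deriv_nonpos (convex_Icc _ _) hcont.continuousOn ?_ ?_
      · intro x hx
        rw [interior_Icc] at hx
        exact (hd x (by linarith [hx.1]) (by linarith [hx.2])).differentiableAt.differentiableWithinAt
      · intro x hx
        rw [interior_Icc] at hx
        rw [(hd x (by linarith [hx.1]) (by linarith [hx.2])).deriv, ← hF'w]
        exact hm ⟨hx.1, hx.2.le⟩ ⟨hx.1.trans hx.2, le_rfl⟩ hx.2.le
    rw [← hFw]
    exact hanti ⟨le_rfl, haw⟩ ⟨haw, le_rfl⟩ haw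
  change 0 ≤ F z
  by_cases hza : (1 - K) * N ≤ (N - K) * z
  · exact hmono z hz0 hza hz
  push Not at hza
  have hNK2 : 0 < N - K := by
    refine (show 0 ≤ N - K by linarith).lt_of_ne fun h => ?_
    rw [← h, show K = 1 by linarith] at hza
    simp at hza
  set a := (1 - K) * N / (N - K) with ha
  have ha0 : 0 ≤ a := div_nonneg (mul_nonneg (by linarith) hN0.le) hNK2.le
  have haw : a ≤ w := by
    rw [ha, hw, div_le_div_iff₀ hNK2 (by linarith)]
    nlinarith
  have haa : (N - K) * a = (1 - K) * N := by rw [ha]; field_simp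
  have hza' : z ≤ a := by rw [ha, le_div_iff₀ hNK2]; linarith
  have hconc : ConcaveOn ℝ (Set.Icc 0 a) F := by
    refine concaveOn_of_hasDerivWithinAt2_nonpos (f' := F') (f'' := F'') (convex_Icc _ _) hcont.continuousOn ?_ ?_ ?_
    · intro x hx
      rw [interior_Icc] at hx
      exact (hd x (by linarith [hx.1]) (by linarith [hx.2])).hasDerivWithinAt
    · intro x hx
      rw [interior_Icc] at hx
      exact (hd2 x (by linarith [hx.1]) (by linarith [hx.2])).hasDerivWithinAt
    · intro x hx
      rw [interior_Icc] at hx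
      have : (N - K) * x ≤ (N - K) * a := mul_le_mul_of_nonneg_left hx.2.le (by linarith)
      refine div_nonpos_of_nonpos_of_nonneg (by linarith) (mul_nonneg (mul_nonneg ?_ ?_) ?_) <;>
        linarith [hx.1, hx.2]
  have := hconc.min_le_of_mem_Icc (Set.left_mem_Icc.2 ha0) (Set.right_mem_Icc.2 ha0) ⟨hz0, hza'⟩
  rw [hF0, min_eq_left (hmono a ha0 haa.ge haw)] at this
  exact this

/-- The ratio `(∑ i, h (1 - P i)) / ∑ i, h (P i)`, with `h = negMulLog`, at the uniform distribution
`P` on `N + 1` points. -/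
noncomputable def entropyRatio (N : ℝ) : ℝ := N * log ((N + 1) / N) / log (N + 1)

lemma entropyRatio_mul_log {N : ℝ} (hN : 1 ≤ N) :
    entropyRatio N * log (N + 1) = N * log ((N + 1) / N) :=
  div_mul_cancel₀ _ (log_pos (by linarith)).ne'

lemma entropyRatio_pos {N : ℝ} (hN : 1 ≤ N) : 0 < entropyRatio N := by
  refine div_pos (mul_pos (by linarith) (log_pos ?_)) (log_pos (by linarith))
  rw [one_lt_div (by linarith)]
  linarith

lemma entropyRatio_le_one (N : ℕ) (hN : 1 ≤ N) : entropyRatio N ≤ 1 := by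
  have hN' : (1 : ℝ) ≤ N := by exact_mod_cast hN
  rw [entropyRatio, div_le_one (log_pos (by linarith))]
  rcases hN.eq_or_lt with h | h
  · subst h; norm_num
  have h2 : (2 : ℝ) ≤ N := by exact_mod_cast h
  calc (N : ℝ) * log ((N + 1) / N) ≤ N * ((N + 1) / N - 1) := by
        gcongr
        exact log_le_sub_one_of_pos (by positivity)
    _ = 1 := by field_simp; ring
    _ ≤ log (N + 1) := by
        rw [le_log_iff_exp_le (by linarith)]
        linarith [exp_one_lt_three]

lemma one_le_mul_entropyRatio (N : ℕ) (hN : 1 ≤ N) : 1 ≤ N * entropyRatio N := by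
  have hN' : (1 : ℝ) ≤ N := by exact_mod_cast hN
  have hl : 0 < log ((N : ℝ) + 1) := log_pos (by linarith)
  rw [entropyRatio, mul_div_assoc', one_le_div hl]
  have h1 : log 2 ≤ N * log (((N : ℝ) + 1) / N) := by
    rw [← log_pow]
    refine log_le_log two_pos ?_
    have := one_add_mul_le_pow (a := 1 / (N : ℝ)) (le_trans (by norm_num) (by positivity : 0 ≤ 1 / (N : ℝ))) N
    have e : 1 + 1 / (N : ℝ) = (N + 1) / N := by field_simp
    have e2 : (N : ℝ) * (1 / N) = 1 := by field_simp
    rw [e, e2] at this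
    linarith
  have h2 : log ((N : ℝ) + 1) ≤ N * log 2 := by
    rw [← log_pow]
    refine log_le_log (by linarith) ?_
    exact_mod_cast Nat.lt_two_pow_self
  nlinarith

lemma entropyRatio_le_succ {N : ℕ} (hN : 1 ≤ N) :
    entropyRatio N ≤ entropyRatio (N + 1 : ℕ) * (1 + entropyRatio (N + 1 : ℕ)) := by
  have hN' : (1 : ℝ) ≤ N := by exact_mod_cast hN
  set M : ℝ := ((N + 1 : ℕ) : ℝ) with hM
  have hMN : M = N + 1 := by simp [hM]
  have hl : 0 < log M := log_pos (by linarith)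
  have hl1 : 0 < log (M + 1) := log_pos (by linarith)
  set L := log ((M + 1) / M) with hL
  have hL0 : 0 < L := log_pos (by rw [one_lt_div] <;> linarith)
  have hLe : L = log (M + 1) - log M := log_div (by linarith) (by linarith)
  have hmono : N * log (((N : ℝ) + 1) / N) ≤ M * L := by
    have hx1 : (1 : ℝ) ∈ Set.Ioi 0 := by simp
    have hy1 : ((N : ℝ) + 1) / N ∈ Set.Ioi (0 : ℝ) := by simp only [Set.mem_Ioi]; positivity
    have hc := strictConcaveOn_log_Ioi.concaveOn.2 hx1 hy1
      (show 0 ≤ 1 / M by positivity) (show 0 ≤ (N : ℝ) / M by positivity)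
      (by rw [hMN]; field_simp; ring)
    simp only [smul_eq_mul, log_one, mul_zero, zero_add] at hc
    have : 1 / M * 1 + N / M * (((N : ℝ) + 1) / N) = (M + 1) / M := by
      rw [hMN]; field_simp; ring
    rw [this] at hc
    have hM0 : 0 < M := by linarith
    calc _ = M * (N / M * log (((N : ℝ) + 1) / N)) := by field_simp
      _ ≤ _ := mul_le_mul_of_nonneg_left hc hM0.le
  have hpow : log (M + 1) ≤ M * log M := by
    rw [hMN, ← hMN, hM, ← log_pow]
    refine log_le_log (by positivity) ?_
    have : (N + 1) + 1 ≤ (N + 1) ^ (N + 1) :=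
      calc (N + 1) + 1 ≤ 2 ^ (N + 1) := Nat.lt_two_pow_self
        _ ≤ (N + 1) ^ (N + 1) := Nat.pow_le_pow_left (by omega) _
    exact_mod_cast this
  have e1 : entropyRatio N ≤ M * L / log M := by
    rw [entropyRatio, ← hMN] at *
    gcongr
  refine e1.trans ?_
  have e2 : M * L / log M = entropyRatio M * (1 + L / log M) := by
    rw [entropyRatio, ← hL]
    field_simp
    rw [hLe]; ring
  rw [e2]
  have := entropyRatio_pos (N := M) (by linarith)
  gcongr
  rw [entropyRatio, ← hL, div_le_div_iff₀ hl hl1]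
  nlinarith

lemma convexOn_negMulLog_one_sub_sub {K θ : ℝ} (hK : 0 < K) (hθ : θ * (1 + K) = K) :
    ConvexOn ℝ (Set.Icc 0 θ) fun x => negMulLog (1 - x) - K * negMulLog x := by
  have h1 : θ < 1 := by nlinarith
  have hcont : Continuous fun x => negMulLog (1 - x) - K * negMulLog x := by
    have := continuous_negMulLog
    fun_prop
  refine convexOn_of_hasDerivWithinAt2_nonneg (f' := fun x => log (1 - x) + 1 + K * (log x + 1))
    (f'' := fun x => K / x - 1 / (1 - x)) (convex_Icc _ _) hcont.continuousOn ?_ ?_ ?_ <;>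
    intro x hx <;> rw [interior_Icc] at hx <;> obtain ⟨hx0, hxθ⟩ := hx
  · have e1 := hasDerivAt_negMulLog hx0.ne'
    have e2 := (hasDerivAt_negMulLog (x := 1 - x) (by linarith)).comp x
      ((hasDerivAt_id x).const_sub 1)
    refine HasDerivAt.hasDerivWithinAt ?_
    convert! e2.sub (e1.const_mul K) using 1
    ring
  · have e1 := hasDerivAt_log hx0.ne'
    have e2 := ((hasDerivAt_id x).const_sub 1).log (x := x) (by simp; linarith)
    refine HasDerivAt.hasDerivWithinAt ?_
    convert! (e2.add_const 1).add ((e1.add_const 1).const_mul K) using 1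
    simp
    ring
  · have : 0 < 1 - x := by linarith
    rw [sub_nonneg, div_le_div_iff₀ this hx0]
    nlinarith

lemma convexOn_negMulLog_one_sub_mul_sub {κ z : ℝ} (hz : 0 < z) (hzκ : z ≤ κ) (hz1 : z < 1) :
    ConvexOn ℝ (Set.Icc 0 1) fun x => negMulLog (1 - z * x) - κ * z * negMulLog (1 - x) := by
  have hcont : Continuous fun x => negMulLog (1 - z * x) - κ * z * negMulLog (1 - x) := by
    have := continuous_negMulLog
    fun_prop
  refine convexOn_of_hasDerivWithinAt2_nonneg
    (f' := fun x => z * (log (1 - z * x) + 1) - κ * z * (log (1 - x) + 1))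
    (f'' := fun x => κ * z / (1 - x) - z ^ 2 / (1 - z * x))
    (convex_Icc _ _) hcont.continuousOn ?_ ?_ ?_ <;>
    intro x hx <;> rw [interior_Icc] at hx <;> obtain ⟨hx0, hx1⟩ := hx <;>
    have hzx : 0 < 1 - z * x := by nlinarith
  · have e1 := (hasDerivAt_negMulLog (x := 1 - x) (by linarith)).comp x
      ((hasDerivAt_id x).const_sub 1)
    have e2 := (hasDerivAt_negMulLog hzx.ne').comp x
      (((hasDerivAt_id x).const_mul z).const_sub 1)
    refine HasDerivAt.hasDerivWithinAt ?_
    convert! e2.sub (e1.const_mul (κ * z)) using 1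
    ring
  · have e1 := ((hasDerivAt_id x).const_sub 1).log (x := x) (by simp; linarith)
    have e2 := (((hasDerivAt_id x).const_mul z).const_sub 1).log (x := x) hzx.ne'
    refine HasDerivAt.hasDerivWithinAt ?_
    convert! ((e2.add_const 1).const_mul z).sub ((e1.add_const 1).const_mul (κ * z)) using 1
    simp
    ring
  · have : 0 < 1 - x := by linarith
    rw [sub_nonneg, div_le_div_iff₀ hzx this]
    have h : 0 ≤ z * ((κ - z) * (1 - x) + x * (κ * (1 - z))) :=
      mul_nonneg hz.le (add_nonneg (mul_nonneg (by linarith) this.le)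
        (mul_nonneg hx0.le (mul_nonneg (by linarith) (by linarith))))
    nlinarith

lemma ConvexOn.card_mul_le_sum {n : ℕ} {s : Set ℝ} {f : ℝ → ℝ} (hf : ConvexOn ℝ s f) (hn : n ≠ 0)
    (P : Fin n → ℝ) (hP : ∀ i, P i ∈ s) : n * f ((∑ i, P i) / n) ≤ ∑ i, f (P i) := by
  have hn' : (0 : ℝ) < n := by positivity
  have := hf.map_sum_le (t := univ) (w := fun _ => 1 / (n : ℝ)) (p := P) (fun _ _ => by positivity)
    (by simp; field_simp) (fun i _ => hP i)
  simp only [smul_eq_mul, ← Finset.mul_sum] at this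
  rw [one_div_mul_eq_div, one_div_mul_eq_div, le_div_iff₀ hn'] at this
  linarith

/-- Among distributions on `N + 1` points, `(∑ i, h (1 - P i)) / ∑ i, h (P i)` is smallest at the
uniform one. -/
lemma entropyRatio_mul_sum_le (N : ℕ) (hN : 1 ≤ N) (P : Fin (N + 1) → ℝ) (hP : ∀ i, 0 ≤ P i)
    (hsum : ∑ i, P i = 1) :
    entropyRatio N * ∑ i, negMulLog (P i) ≤ ∑ i, negMulLog (1 - P i) := by
  induction N, hN using Nat.le_induction with
  | base =>
    have h1 : entropyRatio 1 = 1 := by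
      have : log 2 ≠ 0 := by positivity
      norm_num [entropyRatio, this]
    rw [Nat.cast_one, h1]
    simp only [Nat.reduceAdd, Fin.sum_univ_two] at *
    rw [show 1 - P 0 = P 1 by linarith, show 1 - P 1 = P 0 by linarith]
    linarith
  | succ M hM ih =>
    have hM' : (1 : ℝ) ≤ M := by exact_mod_cast hM
    revert P
    generalize hNdef : M + 1 = N at ih ⊢
    intro P hP hsum
    have hN1 : 1 ≤ N := by omega
    have hNM : (N : ℝ) = M + 1 := by simp [← hNdef]
    have hN' : (1 : ℝ) ≤ N := by linarith
    set K := entropyRatio N with hK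
    have hK0 : 0 < K := entropyRatio_pos hN'
    have hK1 : K ≤ 1 := entropyRatio_le_one N hN1
    have hNK : 1 ≤ N * K := one_le_mul_entropyRatio N hN1
    have hKlog : K * log (N + 1) = N * log ((N + 1) / N) := entropyRatio_mul_log hN'
    set K' := entropyRatio M with hK'
    have hK'0 : 0 < K' := entropyRatio_pos hM'
    have hK'log : K' * log N = M * log (N / M) := by rw [hNM]; exact entropyRatio_mul_log hM'
    have hKK : K' ≤ K * (1 + K) := by
      rw [hK, ← hNdef]; exact entropyRatio_le_succ hM
    set θ := K / (1 + K) with hθ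
    have hθK : θ * (1 + K) = K := by rw [hθ]; field_simp
    by_cases hall : ∀ i, P i ≤ θ
    · have := (convexOn_negMulLog_one_sub_sub hK0 hθK).card_mul_le_sum (by omega) P
        fun i => ⟨hP i, hall i⟩
      rw [hsum, Finset.sum_sub_distrib, ← Finset.mul_sum] at this
      have e : ((N + 1 : ℕ) : ℝ) * (negMulLog (1 - 1 / ((N + 1 : ℕ) : ℝ))
          - K * negMulLog (1 / ((N + 1 : ℕ) : ℝ))) = 0 := by
        push_cast
        have h2 : 1 - 1 / ((N : ℝ) + 1) = N / (N + 1) := by field_simp; ring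
        rw [log_div (by linarith) (by linarith)] at hKlog
        rw [h2, negMulLog, negMulLog, log_div (by linarith) (by linarith),
          log_div (by linarith) (by linarith), log_one]
        field_simp
        linear_combination -hKlog
      rw [e] at this
      linarith
    · push Not at hall
      obtain ⟨j, hj⟩ := hall
      set z := 1 - P j with hz
      have hsplit := hsum
      rw [Fin.sum_univ_succAbove _ j] at hsplit ⊢
      rw [Fin.sum_univ_succAbove _ j]
      have hrest : ∑ i, P (j.succAbove i) = z := by rw [hz]; linarith
      have hz0 : 0 ≤ z := hrest ▸ sum_nonneg fun _ _ => hP _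
      have hPj : P j = 1 - z := by rw [hz]; ring
      clear_value z
      rcases hz0.eq_or_lt with hz00 | hzpos
      · have : ∀ i, P (j.succAbove i) = 0 := fun i =>
          (Finset.sum_eq_zero_iff_of_nonneg (fun _ _ => hP _)).1 (hrest.trans hz00.symm) i (mem_univ i)
        simp [hPj, this, ← hz00]
      set q : Fin N → ℝ := fun i => P (j.succAbove i) / z with hq
      have hPq : ∀ i, P (j.succAbove i) = z * q i := fun i => by simp only [hq]; field_simp
      have hq0 : ∀ i, 0 ≤ q i := fun i => div_nonneg (hP _) hz0
      have hq1 : ∑ i, q i = 1 := by rw [← Finset.sum_div, hrest]; field_simp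
      have hqle : ∀ i, q i ≤ 1 := fun i =>
        hq1 ▸ Finset.single_le_sum (fun i _ => hq0 i) (mem_univ i)
      have hθ0 : 0 < θ := by positivity
      have hz1 : z < 1 := by linarith
      have hzK : z * (1 + K) ≤ 1 := by nlinarith
      set κ := K / K' with hκ
      have hκK : κ * K' = K := by rw [hκ]; field_simp
      have hzκ : z ≤ κ := by
        rw [hκ, le_div_iff₀ hK'0]
        calc z * K' ≤ z * (K * (1 + K)) := by gcongr
          _ = (z * (1 + K)) * K := by ring
          _ ≤ 1 * K := by gcongr
          _ = K := one_mul K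
      have hzN : z ≤ N / (N + 1) := by
        rw [le_div_iff₀ (by linarith)]
        nlinarith
      have hbin := negMulLog_bound_of_equal_rest hN' hK1 hNK hKlog hz0 hzN
      have hih := ih q hq0 hq1
      have hJ := (convexOn_negMulLog_one_sub_mul_sub hzpos hzκ hz1).card_mul_le_sum
        (by omega) q fun i => ⟨hq0 i, hqle i⟩
      have e1 : N * negMulLog (1 - 1 / (N : ℝ)) = K' * log N := by
        have h2 : 1 - 1 / (N : ℝ) = M / N := by rw [hNM]; field_simp; ring
        rw [hK'log, h2, negMulLog, log_div (by linarith) (by linarith),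
          log_div (by linarith) (by linarith)]
        field_simp
        ring
      have e2 : ∑ i, negMulLog (z * q i) = negMulLog z + z * ∑ i, negMulLog (q i) := by
        simp only [negMulLog_mul, Finset.sum_add_distrib, ← Finset.sum_mul, ← Finset.mul_sum, hq1,
          one_mul]
      rw [hq1, Finset.sum_sub_distrib, ← Finset.mul_sum, mul_one_div] at hJ
      simp only [hPq, e2]
      rw [hPj, sub_sub_cancel]
      have e3 : κ * z * (K' * ∑ i, negMulLog (q i)) ≤ κ * z * ∑ i, negMulLog (1 - q i) :=
        mul_le_mul_of_nonneg_left hih (by positivity)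
      have e4 : κ * z * (K' * ∑ i, negMulLog (q i)) = K * (z * ∑ i, negMulLog (q i)) := by
        rw [← hκK]; ring
      have e5 : N * (negMulLog (1 - z / N) - κ * z * negMulLog (1 - 1 / (N : ℝ))) =
          N * negMulLog (1 - z / N) - K * z * log N := by
        rw [mul_sub, mul_left_comm, e1, ← hκK]; ring
      linarith

lemma entropyRatio_mul_sum_le_of_sum (N : ℕ) (hN : 1 ≤ N) (P : Fin (N + 1) → ℝ)
    (hP : ∀ i, 0 ≤ P i) :
    entropyRatio N * (∑ i, negMulLog (P i) - negMulLog (∑ i, P i)) + N * negMulLog (∑ i, P i) ≤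
      ∑ i, negMulLog (∑ j, P j - P i) := by
  set s := ∑ i, P i with hs
  have hs0 : 0 ≤ s := sum_nonneg fun i _ => hP i
  rcases hs0.eq_or_lt with h | h
  · have : ∀ i, P i = 0 := fun i =>
      (Finset.sum_eq_zero_iff_of_nonneg (fun _ _ => hP _)).1 h.symm i (mem_univ i)
    simp [this, ← h]
  clear_value s
  set q : Fin (N + 1) → ℝ := fun i => P i / s with hq
  have hPq : ∀ i, P i = s * q i := fun i => by simp only [hq]; field_simp
  have hq1 : ∑ i, q i = 1 := by rw [← Finset.sum_div, ← hs]; field_simp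
  have key := entropyRatio_mul_sum_le N hN q (fun i => div_nonneg (hP i) hs0) hq1
  have e1 : ∑ i, negMulLog (P i) = negMulLog s + s * ∑ i, negMulLog (q i) := by
    simp only [hPq, negMulLog_mul, Finset.sum_add_distrib, ← Finset.sum_mul, ← Finset.mul_sum, hq1,
      one_mul]
  have e2 : ∑ i, negMulLog (s - P i) = N * negMulLog s + s * ∑ i, negMulLog (1 - q i) := by
    have : ∀ i, s - P i = s * (1 - q i) := fun i => by rw [hPq]; ring
    simp only [this, negMulLog_mul, Finset.sum_add_distrib, ← Finset.sum_mul, ← Finset.mul_sum,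
      Finset.sum_sub_distrib, hq1]
    simp
  rw [e1, e2]
  nlinarith [mul_le_mul_of_nonneg_left key hs0]

/-- The exponent `α` with `n ^ (n * α) = n !`. -/
noncomputable def factorialExponent (n : ℕ) : ℝ := log n.factorial / (n * log n)

lemma factorialExponent_nonneg (n : ℕ) : 0 ≤ factorialExponent n :=
  div_nonneg (log_natCast_nonneg _) (mul_nonneg n.cast_nonneg (log_natCast_nonneg _))

lemma factorialExponent_mul (n : ℕ) : factorialExponent n * (n * log n) = log n.factorial := by
  rcases le_or_gt n 1 with h | h
  · interval_cases n <;> simp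
  · have : 0 < log n := log_pos (by exact_mod_cast h)
    exact div_mul_cancel₀ _ (by positivity)

lemma factorialExponent_succ (n : ℕ) (hn : 1 ≤ n) :
    (n + 1) * factorialExponent (n + 1) = 1 + factorialExponent n * (n - entropyRatio n) := by
  have hl : 0 < log ((n : ℝ) + 1) := log_pos (by have : (1 : ℝ) ≤ n := by exact_mod_cast hn
                                                 linarith)
  have hn0 : (0 : ℝ) < n := by exact_mod_cast hn
  have h1 := factorialExponent_mul (n + 1)
  have h2 := factorialExponent_mul n
  rw [Nat.factorial_succ, Nat.cast_mul, log_mul (by positivity) (by positivity)] at h1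
  push_cast at h1
  rw [entropyRatio, log_div (by positivity) (by positivity)]
  field_simp
  linear_combination h1 - h2

/-- Averaged over orderings, the tail logarithms are bounded by the entropy, with equality at the
uniform distribution. -/
lemma tailLogSum_le {n : ℕ} (hn : 1 ≤ n) (P : Fin n → ℝ) (hP : ∀ i, 0 ≤ P i) :
    tailLogSum P ≤ - n.factorial * ((1 - factorialExponent n) * ∑ i, negMulLog (P i) +
      factorialExponent n * negMulLog (∑ i, P i)) := by
  induction n, hn using Nat.le_induction with
  | base => simp [tailLogSum, factorialExponent, negMulLog]
  | succ n hn ih =>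
    rw [tailLogSum_succ]
    have hstep : ∀ p, tailLogSum (fun i : Fin n => P (Equiv.swap 0 p i.succ)) ≤
        - n.factorial * ((1 - factorialExponent n) * (∑ i, negMulLog (P i) - negMulLog (P p)) +
          factorialExponent n * negMulLog (∑ i, P i - P p)) := by
      intro p
      have hs : ∀ g : ℝ → ℝ, ∑ i : Fin n, g (P (Equiv.swap 0 p i.succ)) =
          ∑ i, g (P i) - g (P p) := by
        intro g
        rw [← Equiv.sum_comp (Equiv.swap 0 p) (fun i => g (P i)), Fin.sum_univ_succ]
        simp
      have := ih (fun i => P (Equiv.swap 0 p i.succ)) fun _ => hP _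
      rwa [hs negMulLog, hs fun x => x] at this
    have hsum := Finset.sum_le_sum fun p (_ : p ∈ univ) => hstep p
    rw [← Finset.mul_sum, Finset.sum_add_distrib, ← Finset.mul_sum, ← Finset.mul_sum,
      Finset.sum_sub_distrib] at hsum
    simp only [sum_const, card_univ, Fintype.card_fin, nsmul_eq_mul] at hsum
    have hent := mul_le_mul_of_nonneg_left (entropyRatio_mul_sum_le_of_sum n hn P hP)
      (mul_nonneg (Nat.cast_nonneg (α := ℝ) n.factorial) (factorialExponent_nonneg n))
    have hα := factorialExponent_succ n hn
    rw [Nat.factorial_succ]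
    push_cast at hsum ⊢
    have e : (∑ k, P k) * log (∑ k, P k) = - negMulLog (∑ k, P k) := by simp [negMulLog]
    rw [e]
    generalize ∑ i, negMulLog (P i) = H at *
    generalize negMulLog (∑ i, P i) = S at *
    generalize ∑ i, negMulLog (∑ j, P j - P i) = U at *
    refine (add_le_add_right hsum _).trans ?_
    have : -((n + 1) * (n.factorial : ℝ)) * ((1 - factorialExponent (n + 1)) * H + factorialExponent (n + 1) * S)
      = - (n.factorial : ℝ) * ((n + 1) * H + ((n + 1) * factorialExponent (n + 1)) * (S - H)) := by ring
    rw [this, hα]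
    linarith

/-- The entropy bound on the permanent, with the free weights chosen as the marginals. -/
lemma log_permanent_le {n : ℕ} (A : Fin n → Fin n → ℝ) (hA : ∀ i j, 0 ≤ A i j)
    (hpos : 0 < ∑ σ : Equiv.Perm (Fin n), ∏ i, A i (σ i)) :
    ∃ P : Fin n → Fin n → ℝ, (∀ i j, 0 ≤ P i j) ∧ (∀ i, ∑ j, P i j = 1) ∧
      (∀ i j, 0 < P i j → 0 < A i j) ∧
      n.factorial * log (∑ σ : Equiv.Perm (Fin n), ∏ i, A i (σ i)) ≤
        ∑ i, (n.factorial * ∑ j, P i j * (log (A i j) - log (P i j)) + tailLogSum (P i)) := by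
  set Z := ∑ σ : Equiv.Perm (Fin n), ∏ i, A i (σ i) with hZ
  set μ : Equiv.Perm (Fin n) → ℝ := fun σ => (∏ i, A i (σ i)) / Z with hμ
  have hμ0 : ∀ σ, 0 ≤ μ σ := fun σ => div_nonneg (prod_nonneg fun i _ => hA _ _) hpos.le
  have hμ1 : ∑ σ, μ σ = 1 := by rw [hμ, ← Finset.sum_div]; exact div_self hpos.ne'
  set P : Fin n → Fin n → ℝ := fun i j => ∑ σ, if σ i = j then μ σ else 0 with hP
  have hP0 : ∀ i j, 0 ≤ P i j := fun i j => sum_nonneg fun σ _ => by split_ifs <;> simp [hμ0]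
  have hmarg : ∀ i (g : Fin n → ℝ), ∑ j, P i j * g j = ∑ σ, μ σ * g (σ i) := by
    intro i g
    simp only [hP, Finset.sum_mul]
    rw [Finset.sum_comm]
    simp [ite_mul]
  have hAμ : ∀ σ, 0 < μ σ → ∀ i, 0 < A i (σ i) := by
    intro σ hσ i
    refine (hA _ _).lt_of_ne fun h => hσ.ne' ?_
    simp only [hμ]
    rw [Finset.prod_eq_zero (mem_univ i) h.symm, zero_div]
  have hPμ : ∀ σ i, μ σ ≤ P i (σ i) := by
    intro σ i
    have := Finset.single_le_sum (f := fun σ' : Equiv.Perm (Fin n) => if σ' i = σ i then μ σ' else 0)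
      (fun σ' _ => by split_ifs <;> simp [hμ0]) (mem_univ σ)
    simpa using this
  refine ⟨P, hP0, fun i => ?_, fun i j hij => ?_, ?_⟩
  · simpa [hμ1] using hmarg i fun _ => 1
  · obtain ⟨σ, -, hσ⟩ := Finset.exists_lt_of_sum_lt (s := univ) (f := fun _ => (0 : ℝ))
      (g := fun σ : Equiv.Perm (Fin n) => if σ i = j then μ σ else 0) (by simpa using hij)
    split_ifs at hσ with h
    · exact h ▸ hAμ σ hσ i
    · exact absurd hσ (lt_irrefl _)
  set T : Equiv.Perm (Fin n) → Equiv.Perm (Fin n) → Fin n → ℝ :=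
    fun τ σ i => ∑ k, if τ i ≤ τ k then P i (σ k) else 0 with hT
  have hTP : ∀ τ σ i, P i (σ i) ≤ T τ σ i := by
    intro τ σ i
    have := Finset.single_le_sum (f := fun k => if τ i ≤ τ k then P i (σ k) else 0)
      (fun k _ => by split_ifs <;> simp [hP0]) (mem_univ i)
    simpa using this
  have hτ : ∀ τ, log Z ≤
      ∑ σ, μ σ * ∑ i, (log (A i (σ i)) - log (P i (σ i)) + log (T τ σ i)) := by
    intro τ
    have hg := sum_mul_log_le_sum_mul_log μ (fun σ => ∏ i, (P i (σ i) / T τ σ i)) hμ0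
      (fun σ => prod_nonneg fun i _ => div_nonneg (hP0 _ _) ((hP0 _ _).trans (hTP τ σ i)))
      (fun σ hσ => prod_pos fun i _ => div_pos (hσ.trans_le (hPμ σ i))
        ((hσ.trans_le (hPμ σ i)).trans_le (hTP τ σ i)))
      (hμ1 ▸ sum_perm_prod_div_le_one_of_order P hP0 τ)
    have e : ∀ σ, μ σ * log (μ σ) - μ σ * log (∏ i, (P i (σ i) / T τ σ i)) =
        μ σ * ∑ i, (log (A i (σ i)) - log (P i (σ i)) + log (T τ σ i)) - μ σ * log Z := by
      intro σ
      rcases (hμ0 σ).eq_or_lt with h | h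
      · simp [← h]
      · have hPp : ∀ i, 0 < P i (σ i) := fun i => h.trans_le (hPμ σ i)
        have hTp : ∀ i, 0 < T τ σ i := fun i => (hPp i).trans_le (hTP τ σ i)
        have h1 : log (μ σ) = ∑ i, log (A i (σ i)) - log Z := by
          simp only [hμ]
          rw [log_div (prod_pos fun i _ => hAμ σ h i).ne' hpos.ne',
            log_prod fun i _ => (hAμ σ h i).ne']
        have h2 : log (∏ i, (P i (σ i) / T τ σ i)) =
            ∑ i, log (P i (σ i)) - ∑ i, log (T τ σ i) := by
          rw [log_prod fun i _ => (div_pos (hPp i) (hTp i)).ne', ← Finset.sum_sub_distrib]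
          exact Finset.sum_congr rfl fun i _ => log_div (hPp i).ne' (hTp i).ne'
        rw [h1, h2, Finset.sum_add_distrib, Finset.sum_sub_distrib]
        ring
    have e' := Finset.sum_congr rfl fun σ (_ : σ ∈ univ) => e σ
    rw [Finset.sum_sub_distrib, Finset.sum_sub_distrib, ← Finset.sum_mul, hμ1, one_mul] at e'
    linarith
  have hsum := Finset.sum_le_sum fun τ (_ : τ ∈ univ) => hτ τ
  simp only [sum_const, card_univ, Fintype.card_perm, Fintype.card_fin, nsmul_eq_mul] at hsum
  refine hsum.trans (le_of_eq ?_)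
  have hT' : ∀ σ i, ∑ τ, log (T τ σ i) =
      ∑ τ : Equiv.Perm (Fin n), log (∑ k, if τ (σ i) ≤ τ k then P i k else 0) := by
    intro σ i
    refine Eq.trans ?_ (Equiv.sum_comp (Equiv.mulRight σ⁻¹) _)
    refine Finset.sum_congr rfl fun τ _ => congrArg log (Eq.trans ?_ (Equiv.sum_comp σ _))
    simp [hT]
  have hi : ∀ i, n.factorial * ∑ j, P i j * (log (A i j) - log (P i j)) + tailLogSum (P i) =
      ∑ σ, μ σ * ∑ τ, (log (A i (σ i)) - log (P i (σ i)) + log (T τ σ i)) := by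
    intro i
    rw [tailLogSum_eq, hmarg i fun j => log (A i j) - log (P i j), hmarg, Finset.mul_sum,
      ← Finset.sum_add_distrib]
    refine Finset.sum_congr rfl fun σ _ => ?_
    rw [Finset.sum_add_distrib, hT']
    simp only [sum_const, card_univ, Fintype.card_perm, Fintype.card_fin, nsmul_eq_mul]
    ring
  simp only [hi]
  rw [Finset.sum_comm, Finset.sum_comm (s := univ (α := Fin n))]
  refine Finset.sum_congr rfl fun σ _ => ?_
  rw [← Finset.mul_sum, ← Finset.mul_sum, Finset.sum_comm]

/-- The variational bound for the logarithm of the `ℓ_p` norm. -/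
lemma sum_mul_log_add_entropy_le {n : ℕ} {p : ℝ} (hp : 1 ≤ p) (a P : Fin n → ℝ)
    (hP : ∀ j, 0 ≤ P j) (hP1 : ∑ j, P j = 1) (hPa : ∀ j, 0 < P j → 0 < a j) :
    ∑ j, P j * log (a j) + 1 / p * ∑ j, negMulLog (P j) ≤
      log ((∑ j, |a j| ^ p) ^ (1 / p)) := by
  have hp0 : 0 < p := by linarith
  set S := ∑ j, |a j| ^ p with hS
  have hS0 : 0 < S := by
    obtain ⟨j, -, hj⟩ := Finset.exists_lt_of_sum_lt (s := univ) (f := fun _ => (0 : ℝ)) (g := P)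
      (by simp [hP1])
    exact (rpow_pos_of_pos (abs_pos.2 (hPa j hj).ne') p).trans_le
      (Finset.single_le_sum (f := fun j => |a j| ^ p) (fun _ _ => by positivity) (mem_univ j))
  have hg := sum_mul_log_le_sum_mul_log P (fun j => |a j| ^ p / S) hP (fun j => by positivity)
    (fun j hj => div_pos (rpow_pos_of_pos (abs_pos.2 (hPa j hj).ne') p) hS0)
    (by rw [← Finset.sum_div, hP1]; exact (div_self hS0.ne').le)
  have e : ∀ j, P j * log (|a j| ^ p / S) = p * (P j * log (a j)) - P j * log S := by
    intro j
    rcases (hP j).eq_or_lt with h | h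
    · simp [← h]
    · have := hPa j h
      rw [log_div (by positivity) hS0.ne', log_rpow (by positivity), abs_of_pos this]
      ring
  simp only [e, Finset.sum_sub_distrib, ← Finset.mul_sum, ← Finset.sum_mul, hP1] at hg
  rw [log_rpow hS0]
  simp only [negMulLog, neg_mul, Finset.sum_neg_distrib]
  field_simp
  linarith

/-- Sharp upper bound on the permanent of a nonnegative matrix in terms of the
`ℓ_p` norms of its rows. -/
theorem stmt6 (n : ℕ) (hn : 1 ≤ n) (p : ℝ) (hp : 1 ≤ p)
    (A : Matrix (Fin n) (Fin n) ℝ) (hA : ∀ i j, 0 ≤ A i j) :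
    (∑ σ : Equiv.Perm (Fin n), ∏ i, A i (σ i)) ≤
      max 1 ((Nat.factorial n : ℝ) / (n : ℝ) ^ ((n : ℝ) / p)) *
        ∏ i, (∑ j, |A i j| ^ p) ^ (1 / p) := by
  have hp0 : 0 < p := by linarith
  have hn0 : (0 : ℝ) < n := by exact_mod_cast hn
  set C := max 1 ((Nat.factorial n : ℝ) / (n : ℝ) ^ ((n : ℝ) / p)) with hC
  have hC1 : 1 ≤ C := le_max_left _ _
  have hR0 : ∀ i, 0 ≤ (∑ j, |A i j| ^ p) ^ (1 / p) := fun i => by positivity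
  rcases le_or_gt (∑ σ : Equiv.Perm (Fin n), ∏ i, A i (σ i)) 0 with h0 | hpos
  · exact h0.trans (mul_nonneg (by linarith) (prod_nonneg fun i _ => hR0 i))
  obtain ⟨P, hP0, hP1, hPA, hlog⟩ := log_permanent_le A hA hpos
  have hf : (0 : ℝ) < n.factorial := by positivity
  have hlogC : max 0 (n * ((factorialExponent n - 1 / p) * log n)) ≤ log C := by
    refine max_le (log_nonneg hC1) ?_
    refine le_trans (le_of_eq ?_) (log_le_log (by positivity) (le_max_right _ _))
    rw [log_div (by positivity) (by positivity), log_rpow hn0, ← factorialExponent_mul]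
    ring
  have hRpos : ∀ i, 0 < (∑ j, |A i j| ^ p) ^ (1 / p) := by
    intro i
    obtain ⟨j, -, hj⟩ := Finset.exists_lt_of_sum_lt (s := univ) (f := fun _ => (0 : ℝ)) (g := P i)
      (by simp [hP1])
    refine rpow_pos_of_pos ((rpow_pos_of_pos (abs_pos.2 (hPA i j hj).ne') p).trans_le ?_) _
    exact Finset.single_le_sum (f := fun j => |A i j| ^ p) (fun _ _ => by positivity) (mem_univ j)
  have hrow : ∀ i, n.factorial * ∑ j, P i j * (log (A i j) - log (P i j)) + tailLogSum (P i) ≤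
      n.factorial * (log ((∑ j, |A i j| ^ p) ^ (1 / p)) + log C / n) := by
    intro i
    have h1 := tailLogSum_le hn (P i) (hP0 i)
    have h2 := sum_mul_log_add_entropy_le hp (A i) (P i) (hP0 i) (hP1 i) (hPA i)
    have h3 : ∑ j, P i j * (log (A i j) - log (P i j)) =
        ∑ j, P i j * log (A i j) + ∑ j, negMulLog (P i j) := by
      rw [← Finset.sum_add_distrib]
      exact Finset.sum_congr rfl fun j _ => by rw [negMulLog]; ring
    have hH0 : 0 ≤ ∑ j, negMulLog (P i j) := sum_nonneg fun j _ =>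
      negMulLog_nonneg (hP0 i j) (hP1 i ▸ Finset.single_le_sum (fun j _ => hP0 i j) (mem_univ j))
    have hHn : ∑ j, negMulLog (P i j) ≤ log n := by
      have := sum_mul_log_le_sum_mul_log (P i) (fun _ => 1 / (n : ℝ)) (hP0 i)
        (fun _ => by positivity) (fun _ _ => by positivity) (by rw [hP1]; simp; field_simp; rfl)
      rw [← Finset.sum_mul, hP1, one_div, log_inv] at this
      simp only [negMulLog, neg_mul, Finset.sum_neg_distrib]
      linarith
    have h4 : (factorialExponent n - 1 / p) * ∑ j, negMulLog (P i j) ≤ log C / n := by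
      rw [le_div_iff₀ hn0]
      refine le_trans ?_ hlogC
      rcases le_total (factorialExponent n - 1 / p) 0 with h | h
      · refine le_max_of_le_left (mul_nonpos_of_nonpos_of_nonneg
          (mul_nonpos_of_nonpos_of_nonneg h hH0) hn0.le)
      · refine le_max_of_le_right ?_
        rw [mul_comm]
        gcongr
    rw [hP1, negMulLog_one] at h1
    rw [h3]
    have h5 := mul_le_mul_of_nonneg_left (add_le_add h2 h4) hf.le
    linarith
  have htot := hlog.trans (Finset.sum_le_sum fun i _ => hrow i)
  rw [← Finset.mul_sum, mul_le_mul_iff_right₀ hf, Finset.sum_add_distrib,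
    ← log_prod fun i _ => (hRpos i).ne'] at htot
  simp only [sum_const, card_univ, Fintype.card_fin, nsmul_eq_mul] at htot
  rw [mul_div_cancel₀ _ hn0.ne', add_comm, ← log_mul (by linarith)
    (prod_pos fun i _ => hRpos i).ne'] at htot
  exact (log_le_log_iff hpos (mul_pos (by linarith) (prod_pos fun i _ => hRpos i))).1 htot
end

section
/- Let n ≥ 2 and p_c = n·log n / log(n!). For every f : S_n → ℝ≥0, ∑_{x∈V} Ent[μ(f|σ_x)] ≤ p_c · Ent f; that is, the sum over vertices x of the entropies of the one-coordinate marginals of f is at most (n log n / log(n!)) times the entropy of f with respect to the uniform distribution on S_n. -/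
open Finset

namespace Stmt7

variable {V : Type*} [Fintype V] [DecidableEq V]

/-- Expectation w.r.t. the uniform distribution `μ` on the symmetric group. -/
noncomputable def mean (f : Equiv.Perm V → ℝ) : ℝ :=
  (∑ σ : Equiv.Perm V, f σ) / (Fintype.card (Equiv.Perm V) : ℝ)

/-- The global entropy `Ent f = μ[f log (f / μ f)]`. -/
noncomputable def Ent (f : Equiv.Perm V → ℝ) : ℝ :=
  mean (fun σ => f σ * Real.log (f σ / mean f))

/-- The one-coordinate marginal `μ(f | σ_x = i)`: the average of `f` over permutations
sending `x` to `i`. -/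
noncomputable def marg (f : Equiv.Perm V → ℝ) (x i : V) : ℝ :=
  (∑ σ ∈ Finset.univ.filter (fun σ : Equiv.Perm V => σ x = i), f σ) /
    ((Finset.univ.filter (fun σ : Equiv.Perm V => σ x = i)).card : ℝ)

end Stmt7

/-- The function `t ↦ (1 - t) log (1 / (1 - t)) - K t log (1 / t)`. -/
noncomputable def entropyGap (K t : ℝ) : ℝ :=
  Real.negMulLog (1 - t) - K * Real.negMulLog t

lemma continuous_entropyGap (K : ℝ) : Continuous (entropyGap K) := by
  unfold entropyGap
  fun_prop

lemma hasDerivAt_entropyGap (K : ℝ) {t : ℝ} (h0 : t ≠ 0) (h1 : 1 - t ≠ 0) :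
    HasDerivAt (entropyGap K) (Real.log (1 - t) + 1 + K * (Real.log t + 1)) t := by
  have h2 := (Real.hasDerivAt_negMulLog h1).comp t ((hasDerivAt_id t).const_sub 1)
  have h3 := (Real.hasDerivAt_negMulLog h0).const_mul K
  exact (h2.sub h3).congr_deriv (by ring)

lemma hasDerivAt_deriv_entropyGap (K : ℝ) {t : ℝ} (h0 : t ≠ 0) (h1 : 1 - t ≠ 0) :
    HasDerivAt (fun t => Real.log (1 - t) + 1 + K * (Real.log t + 1))
      (K / t - 1 / (1 - t)) t := by
  have h2 := ((hasDerivAt_id t).const_sub 1).log h1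
  have h3 := ((Real.hasDerivAt_log h0).add_const 1).const_mul K
  exact ((h2.add_const 1).add h3).congr_deriv (by simp; ring)

lemma deriv2_entropyGap (K : ℝ) {t : ℝ} (h0 : 0 < t) (h1 : t < 1) :
    deriv^[2] (entropyGap K) t = K / t - 1 / (1 - t) := by
  have h : deriv (entropyGap K) =ᶠ[nhds t]
      fun t => Real.log (1 - t) + 1 + K * (Real.log t + 1) := by
    filter_upwards [Ioo_mem_nhds h0 h1] with s hs
    exact (hasDerivAt_entropyGap K hs.1.ne' (sub_pos.2 hs.2).ne').deriv
  simp only [Function.iterate_succ, Function.iterate_zero, Function.comp_apply, id_eq]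
  rw [h.deriv_eq]
  exact (hasDerivAt_deriv_entropyGap K h0.ne' (sub_pos.2 h1).ne').deriv

lemma strictConvexOn_entropyGap {K : ℝ} (hK : 0 < K) :
    StrictConvexOn ℝ (Set.Icc 0 (K / (1 + K))) (entropyGap K) := by
  refine strictConvexOn_of_deriv2_pos (convex_Icc _ _) (continuous_entropyGap K).continuousOn ?_
  intro t ht
  rw [interior_Icc] at ht
  have h2 : t * (1 + K) < K := (lt_div_iff₀ (by linarith)).1 ht.2
  have h1 : t < 1 := by nlinarith [ht.1]
  rw [deriv2_entropyGap K ht.1 h1, sub_pos, div_lt_div_iff₀ (by linarith) ht.1]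
  linarith

lemma strictConcaveOn_entropyGap {K : ℝ} (hK : 0 < K) :
    StrictConcaveOn ℝ (Set.Icc (K / (1 + K)) 1) (entropyGap K) := by
  refine strictConcaveOn_of_deriv2_neg (convex_Icc _ _) (continuous_entropyGap K).continuousOn ?_
  intro t ht
  rw [interior_Icc] at ht
  have h2 : K < t * (1 + K) := (div_lt_iff₀ (by linarith)).1 ht.1
  have h0 : 0 < t := (by positivity : 0 < K / (1 + K)).trans ht.1
  rw [deriv2_entropyGap K h0 ht.2, sub_neg, div_lt_div_iff₀ h0 (by linarith [ht.2])]
  linarith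

/-- Sums of a strictly convex-then-concave function over the simplex are minimised at points
having all but one of their coordinates equal. -/
lemma sum_nonneg_of_convex_concave {ι : Type*} [Fintype ι] [DecidableEq ι] [Nonempty ι]
    {φ : ℝ → ℝ} {T : ℝ} (hT0 : 0 ≤ T) (hφ : Continuous φ)
    (hconv : StrictConvexOn ℝ (Set.Icc 0 T) φ) (hconc : StrictConcaveOn ℝ (Set.Icc T 1) φ)
    (hF : ∀ s u : ℝ, 0 ≤ u → u ≤ s → s + ((Fintype.card ι : ℝ) - 1) * u = 1 →
      0 ≤ φ s + ((Fintype.card ι : ℝ) - 1) * φ u)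
    {p : ι → ℝ} (hp : p ∈ stdSimplex ℝ ι) : 0 ≤ ∑ i, φ (p i) := by
  have hcont : ContinuousOn (fun q : ι → ℝ => ∑ i, φ (q i)) (stdSimplex ℝ ι) := by
    fun_prop
  obtain ⟨q, hq, hmin⟩ := (isCompact_stdSimplex ℝ ι).exists_isMinOn ⟨p, hp⟩ hcont
  refine le_trans ?_ (hmin hp)
  have hsplit : ∀ (r : ι → ℝ) (i j : ι), i ≠ j →
      ∑ k, r k = r i + r j + ∑ k ∈ (univ.erase i).erase j, r k := by
    intro r i j hij
    rw [← add_sum_erase univ r (mem_univ i),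
      ← add_sum_erase (univ.erase i) r (mem_erase.2 ⟨hij.symm, mem_univ j⟩), add_assoc]
  have hexch : ∀ i j : ι, i ≠ j → ∀ a b : ℝ, 0 ≤ a → 0 ≤ b → a + b = q i + q j →
      φ (q i) + φ (q j) ≤ φ a + φ b := by
    intro i j hij a b ha hb hab
    set r : ι → ℝ := Function.update (Function.update q i a) j b with hr
    have hri : r i = a := by simp [hr, hij]
    have hrj : r j = b := by simp [hr]
    have hrk : ∀ k ∈ (univ.erase i).erase j, r k = q k := by
      intro k hk
      simp only [mem_erase] at hk
      simp [hr, hk.1, hk.2.1]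
    have hrs : r ∈ stdSimplex ℝ ι := by
      refine ⟨fun k => ?_, ?_⟩
      · by_cases hkj : k = j
        · rw [hkj, hrj]; exact hb
        by_cases hki : k = i
        · rw [hki, hri]; exact ha
        · rw [hrk k (by simp [hkj, hki])]; exact hq.1 k
      · rw [hsplit r i j hij, hri, hrj, sum_congr rfl hrk, hab, ← hsplit q i j hij]
        exact hq.2
    have h := hmin hrs
    simp only [Set.mem_ofPred_eq] at h
    rw [hsplit (fun k => φ (q k)) i j hij, hsplit (fun k => φ (r k)) i j hij, hri, hrj,
      sum_congr rfl (fun k hk => congrArg φ (hrk k hk))] at h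
    linarith
  obtain ⟨m, -, hm⟩ := exists_max_image univ q univ_nonempty
  have hsmall : ∀ j, j ≠ m → q j ≤ T := by
    intro j hj
    by_contra! hlt
    have hle := hm j (mem_univ j)
    have hsum : q m + q j ≤ 1 := by
      have h := hsplit q m j hj.symm
      have h' : 0 ≤ ∑ k ∈ (univ.erase m).erase j, q k := sum_nonneg fun k _ => hq.1 k
      linarith [hq.2]
    set B := q m + q j - T with hB
    have hTB : T < B := by linarith
    set l := (q m - T) / (B - T) with hl
    have hl0 : 0 < l := div_pos (by linarith) (by linarith)
    have hl1 : l < 1 := (div_lt_one (by linarith)).2 (by linarith)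
    have hlm : l * (B - T) = q m - T := div_mul_cancel₀ _ (by linarith)
    have hT : T ∈ Set.Icc T 1 := ⟨le_rfl, by linarith⟩
    have hB' : B ∈ Set.Icc T 1 := ⟨hTB.le, by linarith⟩
    have h1 := hconc.2 hT hB' hTB.ne (sub_pos.2 hl1) hl0 (by ring)
    have h2 := hconc.2 hT hB' hTB.ne hl0 (sub_pos.2 hl1) (by ring)
    simp only [smul_eq_mul] at h1 h2
    rw [show (1 - l) * T + l * B = q m by linarith] at h1
    rw [show l * T + (1 - l) * B = q j by linarith] at h2
    have h3 := hexch m j hj.symm T B hT0 (by linarith) (by linarith)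
    nlinarith
  have heq : ∀ j k, j ≠ m → k ≠ m → q j = q k := by
    intro j k hj hk
    by_contra hne
    have hjk : j ≠ k := fun h => hne (by rw [h])
    have h1 := hconv.2 ⟨hq.1 j, hsmall j hj⟩ ⟨hq.1 k, hsmall k hk⟩ hne
      (by norm_num : (0 : ℝ) < 1 / 2) (by norm_num : (0 : ℝ) < 1 / 2) (by norm_num)
    simp only [smul_eq_mul] at h1
    have h0 : 0 ≤ 1 / 2 * q j + 1 / 2 * q k := by linarith [hq.1 j, hq.1 k]
    have h2 := hexch j k hjk _ _ h0 h0 (by ring)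
    linarith
  obtain ⟨u, hu0, hum, hu⟩ : ∃ u, 0 ≤ u ∧ u ≤ q m ∧ ∀ j, j ≠ m → q j = u := by
    by_cases h : ∃ j, j ≠ m
    · obtain ⟨j, hj⟩ := h
      exact ⟨q j, hq.1 j, hm j (mem_univ j), fun k hk => heq k j hk hj⟩
    · push Not at h
      exact ⟨q m, hq.1 m, le_rfl, fun j hj => absurd (h j) hj⟩
  have hcard : ((univ.erase m).card : ℝ) = (Fintype.card ι : ℝ) - 1 := by
    rw [card_erase_of_mem (mem_univ m), Nat.cast_sub (card_pos.2 ⟨m, mem_univ m⟩), card_univ]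
    simp
  have hrest : ∀ g : ℝ → ℝ, ∑ k, g (q k) = g (q m) + ((Fintype.card ι : ℝ) - 1) * g u := by
    intro g
    rw [← add_sum_erase univ (fun k => g (q k)) (mem_univ m),
      sum_congr rfl fun k hk => by rw [hu k (ne_of_mem_erase hk)], sum_const, nsmul_eq_mul, hcard]
  change 0 ≤ ∑ k, φ (q k)
  rw [hrest φ]
  exact hF _ _ hu0 hum ((hrest id).symm.trans hq.2)

/-- The ratio between the two entropies `∑ (1 - p) log (1 / (1 - p))` and `∑ p log (1 / p)` of the
uniform distribution on `n` points. -/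
noncomputable def uniformRatio (n : ℝ) : ℝ :=
  (n - 1) * (Real.log n - Real.log (n - 1)) / Real.log n

lemma entropyGap_uniformRatio {n : ℝ} (hn : 2 ≤ n) :
    entropyGap (uniformRatio n) (1 / n) = 0 := by
  have hlog : Real.log n ≠ 0 := (Real.log_pos (by linarith)).ne'
  have h1 : 1 - 1 / n = (n - 1) / n := by field_simp
  unfold entropyGap uniformRatio
  rw [h1, Real.negMulLog, Real.negMulLog, Real.log_div (by linarith) (by linarith),
    Real.log_div one_ne_zero (by linarith), Real.log_one]
  field_simp
  ring

lemma one_le_uniformRatio_mul {n : ℕ} (hn : 2 ≤ n) :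
    1 ≤ uniformRatio n * ((n : ℝ) - 1) := by
  obtain ⟨m, rfl⟩ : ∃ m, n = m + 1 := ⟨n - 1, by omega⟩
  have hm : (1 : ℝ) ≤ m := by exact_mod_cast (by omega : 1 ≤ m)
  have hlog : 0 < Real.log ((m : ℝ) + 1) := Real.log_pos (by linarith)
  unfold uniformRatio
  push_cast
  rw [add_sub_cancel_right, div_mul_eq_mul_div, le_div_iff₀ hlog, one_mul,
    ← Real.log_div (by positivity) (by positivity)]
  have hb := one_add_mul_le_pow (a := 1 / (m : ℝ)) (by
    have : (0 : ℝ) ≤ 1 / m := by positivity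
    linarith) (m * m)
  have h1 : 1 + ((m * m : ℕ) : ℝ) * (1 / m) = m + 1 := by
    push_cast
    field_simp
    ring
  rw [h1] at hb
  have h2 := Real.log_le_log (by positivity) hb
  rw [Real.log_pow] at h2
  have h3 : 1 + 1 / (m : ℝ) = (m + 1) / m := by field_simp
  rw [h3] at h2
  push_cast at h2
  linarith

lemma uniformRatio_lt_one {n : ℝ} (hn : 3 ≤ n) : uniformRatio n < 1 := by
  have hlog : 1 < Real.log n := by
    rw [Real.lt_log_iff_exp_lt (by linarith)]
    linarith [Real.exp_one_lt_d9]
  unfold uniformRatio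
  rw [div_lt_one (by linarith), ← Real.log_div (by linarith) (by linarith)]
  have h := Real.log_le_sub_one_of_pos (x := n / (n - 1)) (div_pos (by linarith) (by linarith))
  have h1 : (n - 1) * (n / (n - 1) - 1) = 1 := by
    have : n - 1 ≠ 0 := by linarith
    field_simp
    ring
  nlinarith

lemma entropyGap_two_values {n : ℕ} (hn : 2 ≤ n) {s u : ℝ} (hu : 0 ≤ u) (hus : u ≤ s)
    (hsum : s + ((n : ℝ) - 1) * u = 1) :
    0 ≤ entropyGap (uniformRatio n) s + ((n : ℝ) - 1) * entropyGap (uniformRatio n) u := by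
  rcases hn.eq_or_lt with rfl | hn3
  · have hK : uniformRatio 2 = 1 := by
      have : Real.log 2 ≠ 0 := (Real.log_pos one_lt_two).ne'
      unfold uniformRatio
      norm_num [this]
    have hs : s = 1 - u := by push_cast at hsum; linarith
    push_cast
    rw [hK, hs]
    unfold entropyGap
    apply le_of_eq
    ring_nf
  have hK1 := one_le_uniformRatio_mul hn
  have hn3' : (3 : ℝ) ≤ n := by exact_mod_cast hn3
  have hK2 := uniformRatio_lt_one hn3'
  have hgap := entropyGap_uniformRatio (n := n) (by linarith)
  set K := uniformRatio n
  obtain ⟨m, hm⟩ : ∃ m : ℝ, m = (n : ℝ) - 1 := ⟨_, rfl⟩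
  have hnm : (n : ℝ) = m + 1 := by linarith
  rw [← hm] at hsum hK1 ⊢
  rw [hnm] at hgap hn3'
  have hm2 : 2 ≤ m := by linarith
  have hK0 : 0 < K := by nlinarith
  have hu' : u = (1 - s) / m := by field_simp; linarith
  set F : ℝ → ℝ := fun s => entropyGap K s + m * entropyGap K ((1 - s) / m) with hFdef
  set F' : ℝ → ℝ := fun s => (Real.log (1 - s) + 1 + K * (Real.log s + 1)) -
    (Real.log (1 - (1 - s) / m) + 1 + K * (Real.log ((1 - s) / m) + 1)) with hF'def
  have hgoal : entropyGap K s + m * entropyGap K u = F s := by rw [hu']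
  rw [hgoal]
  have hFcont : Continuous F := by
    have := continuous_entropyGap K
    simp only [hFdef]
    fun_prop
  have hpos : ∀ s : ℝ, 0 < s → s < 1 → 0 < (1 - s) / m ∧ 0 < 1 - (1 - s) / m := by
    intro s h0 h1
    refine ⟨div_pos (by linarith) (by linarith), ?_⟩
    rw [sub_pos, div_lt_one (by linarith)]
    linarith
  have hinner : ∀ s : ℝ, HasDerivAt (fun s : ℝ => (1 - s) / m) (-1 / m) s := fun s =>
    ((hasDerivAt_id s).const_sub 1).div_const m
  have hF : ∀ s, 0 < s → s < 1 → HasDerivAt F (F' s) s := by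
    intro s h0 h1
    obtain ⟨h2, h3⟩ := hpos s h0 h1
    have h4 := (hasDerivAt_entropyGap K h2.ne' h3.ne').comp s (hinner s)
    refine ((hasDerivAt_entropyGap K h0.ne' (sub_pos.2 h1).ne').add
      (h4.const_mul m)).congr_deriv ?_
    simp only [hF'def]
    field_simp
    ring
  have hF2 : ∀ s, 0 < s → s < 1 →
      HasDerivAt F' ((K * (m - 1) - s * (m - K)) / (s * (1 - s) * (m - 1 + s))) s := by
    intro s h0 h1
    obtain ⟨h2, h3⟩ := hpos s h0 h1
    have h4 := (hasDerivAt_deriv_entropyGap K h2.ne' h3.ne').comp s (hinner s)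
    refine ((hasDerivAt_deriv_entropyGap K h0.ne' (sub_pos.2 h1).ne').sub h4).congr_deriv ?_
    have h5 : 1 - s ≠ 0 := by linarith
    have h6 : m - 1 + s ≠ 0 := by linarith
    have h7 : 1 - (1 - s) / m = (m - 1 + s) / m := by field_simp; ring
    rw [h7]
    field_simp
    ring
  have hderiv : ∀ s, 0 < s → s < 1 → deriv F =ᶠ[nhds s] F' := by
    intro s h0 h1
    filter_upwards [Ioo_mem_nhds h0 h1] with t ht
    exact (hF t ht.1 ht.2).deriv
  have hden : ∀ s, 0 < s → s < 1 → 0 < s * (1 - s) * (m - 1 + s) := fun s h0 h1 =>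
    mul_pos (mul_pos h0 (by linarith)) (by linarith)
  have hd2 : ∀ s, 0 < s → s < 1 → deriv^[2] F s =
      (K * (m - 1) - s * (m - K)) / (s * (1 - s) * (m - 1 + s)) := by
    intro s h0 h1
    simp only [Function.iterate_succ, Function.iterate_zero, Function.comp_apply, id_eq]
    rw [(hderiv s h0 h1).deriv_eq]
    exact (hF2 s h0 h1).deriv
  set c := K * (m - 1) / (m - K) with hc
  have hmK : 0 < m - K := by linarith
  have hcm : c * (m - K) = K * (m - 1) := div_mul_cancel₀ _ hmK.ne'
  have hc1 : c < 1 := by rw [hc, div_lt_one hmK]; nlinarith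
  have hnc : 1 / (m + 1) ≤ c := by
    rw [hc, div_le_div_iff₀ (by linarith) hmK]; nlinarith
  have hn0 : 0 < 1 / (m + 1) := by positivity
  have hc0 := hn0.trans_le hnc
  have hconv : ConvexOn ℝ (Set.Icc (1 / (m + 1)) c) F := by
    refine convexOn_of_deriv2_nonneg (convex_Icc _ _) hFcont.continuousOn ?_ ?_ ?_ <;>
      rw [interior_Icc]
    · exact fun t ht => (hF t (hn0.trans ht.1) (ht.2.trans hc1)).differentiableAt
        |>.differentiableWithinAt
    · refine fun t ht => DifferentiableAt.differentiableWithinAt ?_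
      refine (hF2 t (hn0.trans ht.1) (ht.2.trans hc1)).differentiableAt.congr_of_eventuallyEq ?_
      exact hderiv t (hn0.trans ht.1) (ht.2.trans hc1)
    · intro t ht
      have ht0 := hn0.trans ht.1
      have ht1 := ht.2.trans hc1
      rw [hd2 t ht0 ht1]
      refine div_nonneg ?_ (hden t ht0 ht1).le
      nlinarith [ht.2]
  have hconc : ConcaveOn ℝ (Set.Icc c 1) F := by
    refine concaveOn_of_deriv2_nonpos (convex_Icc _ _) hFcont.continuousOn ?_ ?_ ?_ <;>
      rw [interior_Icc]
    · exact fun t ht => (hF t (hc0.trans ht.1) ht.2).differentiableAt.differentiableWithinAt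
    · refine fun t ht => DifferentiableAt.differentiableWithinAt ?_
      refine (hF2 t (hc0.trans ht.1) ht.2).differentiableAt.congr_of_eventuallyEq ?_
      exact hderiv t (hc0.trans ht.1) ht.2
    · intro t ht
      have ht0 := hc0.trans ht.1
      rw [hd2 t ht0 ht.2]
      refine div_nonpos_of_nonpos_of_nonneg ?_ (hden t ht0 ht.2).le
      nlinarith [ht.1]
  have hz : (1 - 1 / (m + 1)) / m = 1 / (m + 1) := by field_simp; ring
  have hF0 : F (1 / (m + 1)) = 0 := by simp only [hFdef, hz, hgap]; ring
  have hF'0 : F' (1 / (m + 1)) = 0 := by simp only [hF'def, hz]; ring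
  have hF1 : F 1 = 0 := by simp [hFdef, entropyGap]
  have hleft : ∀ t ∈ Set.Icc (1 / (m + 1)) c, 0 ≤ F t := by
    intro t ht
    rcases ht.1.eq_or_lt with rfl | hlt
    · exact hF0.ge
    have h := hconv.le_slope_of_hasDerivAt ⟨le_rfl, hnc⟩ ht hlt
      (hF _ hn0 (hlt.trans_le ht.2 |>.trans hc1))
    rw [hF'0, slope_def_field, hF0, sub_zero] at h
    rwa [le_div_iff₀ (sub_pos.2 hlt), zero_mul] at h
  have hs1 : s ≤ 1 := by nlinarith
  have hs0 : 1 / (m + 1) ≤ s := by rw [div_le_iff₀ (by linarith)]; nlinarith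
  rcases le_total s c with h | h
  · exact hleft s ⟨hs0, h⟩
  · have := hconc.min_le_of_mem_Icc ⟨le_rfl, hc1.le⟩ ⟨hc1.le, le_rfl⟩ ⟨h, hs1⟩
    rw [hF1] at this
    exact (le_min (hleft c ⟨hnc, le_rfl⟩) le_rfl).trans this

lemma sum_entropyGap_nonneg {ι : Type*} [Fintype ι] [DecidableEq ι] (hι : 2 ≤ Fintype.card ι)
    {p : ι → ℝ} (hp : p ∈ stdSimplex ℝ ι) :
    0 ≤ ∑ i, entropyGap (uniformRatio (Fintype.card ι)) (p i) := by
  have : Nonempty ι := Fintype.card_pos_iff.1 (by omega)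
  have hK1 := one_le_uniformRatio_mul hι
  have hι' : (2 : ℝ) ≤ Fintype.card ι := by exact_mod_cast hι
  have hK : 0 < uniformRatio (Fintype.card ι) := by nlinarith
  exact sum_nonneg_of_convex_concave (by positivity) (continuous_entropyGap _)
    (strictConvexOn_entropyGap hK) (strictConcaveOn_entropyGap hK)
    (fun s u hu hus hsum => entropyGap_two_values hι hu hus hsum) hp

/-- Homogeneous form of the comparison between `∑ (1 - p) log (1 / (1 - p))` and
`∑ p log (1 / p)`. -/
lemma sum_negMulLog_sub_le {ι : Type*} [DecidableEq ι] (W : Finset ι) (hW : 2 ≤ W.card)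
    {a : ι → ℝ} (ha : ∀ i ∈ W, 0 ≤ a i) {Z : ℝ} (hZ : ∑ i ∈ W, a i = Z) :
    ((W.card : ℝ) - 1) * ∑ i ∈ W, Real.negMulLog (a i) - ∑ i ∈ W, Real.negMulLog (Z - a i) ≤
      ((W.card : ℝ) - 1) * Real.log ((W.card : ℝ) - 1) / Real.log W.card *
        (∑ i ∈ W, Real.negMulLog (a i) - Real.negMulLog Z) := by
  have hZ0 : 0 ≤ Z := hZ ▸ sum_nonneg ha
  rcases hZ0.eq_or_lt with h0 | hZpos
  · have h : ∀ i ∈ W, a i = 0 := (sum_eq_zero_iff_of_nonneg ha).1 (hZ.trans h0.symm)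
    have h1 : ∑ i ∈ W, Real.negMulLog (a i) = 0 :=
      sum_eq_zero fun i hi => by rw [h i hi, Real.negMulLog_zero]
    have h2 : ∑ i ∈ W, Real.negMulLog (Z - a i) = 0 :=
      sum_eq_zero fun i hi => by rw [h i hi, ← h0, sub_zero, Real.negMulLog_zero]
    rw [h1, h2, ← h0]
    simp
  have hW' : (2 : ℝ) ≤ W.card := by exact_mod_cast hW
  have hlog : 0 < Real.log W.card := Real.log_pos (by linarith)
  have hsum : ∑ i ∈ W, a i / Z = 1 := by rw [← sum_div, hZ, div_self hZpos.ne']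
  have hmain := sum_entropyGap_nonneg (ι := W) (by simpa using hW) (p := fun i => a i / Z)
    ⟨fun i => div_nonneg (ha i i.2) hZ0, by rw [← hsum, ← sum_coe_sort W fun i => a i / Z]⟩
  rw [sum_coe_sort W fun i => entropyGap _ (a i / Z), Fintype.card_coe] at hmain
  simp only [entropyGap, sum_sub_distrib, ← mul_sum] at hmain
  have h1 : ∑ i ∈ W, Real.negMulLog (a i) =
      Real.negMulLog Z + Z * ∑ i ∈ W, Real.negMulLog (a i / Z) := by
    rw [mul_sum, ← one_mul (Real.negMulLog Z), ← hsum, sum_mul, ← sum_add_distrib]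
    refine sum_congr rfl fun i _ => ?_
    rw [← Real.negMulLog_mul, mul_div_cancel₀ _ hZpos.ne']
  have h2 : ∑ i ∈ W, Real.negMulLog (Z - a i) =
      ((W.card : ℝ) - 1) * Real.negMulLog Z + Z * ∑ i ∈ W, Real.negMulLog (1 - a i / Z) := by
    have h3 : (W.card : ℝ) - 1 = ∑ i ∈ W, (1 - a i / Z) := by simp [hsum]
    rw [h3, mul_sum, sum_mul, ← sum_add_distrib]
    refine sum_congr rfl fun i _ => ?_
    rw [← Real.negMulLog_mul, mul_sub, mul_one, mul_div_cancel₀ _ hZpos.ne']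
  rw [h1, h2]
  set S := ∑ i ∈ W, Real.negMulLog (a i / Z)
  set R := ∑ i ∈ W, Real.negMulLog (1 - a i / Z)
  set k := (W.card : ℝ)
  have h3 : uniformRatio k = (k - 1) - (k - 1) * Real.log (k - 1) / Real.log k := by
    unfold uniformRatio
    field_simp
  rw [h3] at hmain
  nlinarith

/-- Gibbs' inequality for unnormalised weights. -/
lemma sum_negMulLog_sub_le_of_le {ι : Type*} (s : Finset ι) {b q : ι → ℝ}
    (hb : ∀ j ∈ s, 0 ≤ b j) (hbq : ∀ j ∈ s, b j ≤ q j) :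
    ∑ j ∈ s, Real.negMulLog (b j) - Real.negMulLog (∑ j ∈ s, b j) ≤
      (∑ j ∈ s, b j) * Real.log (∑ j ∈ s, q j) - ∑ j ∈ s, b j * Real.log (q j) := by
  set A := ∑ j ∈ s, b j with hA
  set Q := ∑ j ∈ s, q j with hQ
  have hA0 : 0 ≤ A := sum_nonneg hb
  have hAQ : A ≤ Q := sum_le_sum hbq
  rcases hA0.eq_or_lt with h0 | hApos
  · have h : ∀ j ∈ s, b j = 0 := (sum_eq_zero_iff_of_nonneg hb).1 h0.symm
    rw [sum_eq_zero fun j hj => by rw [h j hj, Real.negMulLog_zero],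
      sum_eq_zero fun j hj => by rw [h j hj, zero_mul], ← h0]
    simp
  have hQpos := hApos.trans_le hAQ
  have hterm : ∀ j ∈ s, Real.negMulLog (b j) + b j * Real.log (q j) + b j * Real.log A
      - b j * Real.log Q ≤ A / Q * q j - b j := by
    intro j hj
    rcases (hb j hj).eq_or_lt with h | hpos
    · rw [← h]
      have : 0 ≤ q j := h.le.trans (hbq j hj)
      simp only [Real.negMulLog_zero, zero_mul]
      ring_nf
      positivity
    have hq := hpos.trans_le (hbq j hj)
    have h := Real.log_le_sub_one_of_pos (x := A / Q * q j / b j) (by positivity)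
    rw [Real.log_div (by positivity) hpos.ne', Real.log_mul (by positivity) hq.ne',
      Real.log_div hApos.ne' hQpos.ne'] at h
    have h2 := mul_le_mul_of_nonneg_left h hpos.le
    have h3 : b j * (A / Q * q j / b j - 1) = A / Q * q j - b j := by field_simp
    rw [h3] at h2
    rw [Real.negMulLog]
    linarith
  have h := sum_le_sum hterm
  simp only [sum_sub_distrib, sum_add_distrib, ← sum_mul, ← mul_sum] at h
  rw [← hA, ← hQ, div_mul_cancel₀ _ hQpos.ne', sub_self] at h
  have h4 : Real.negMulLog A = -(A * Real.log A) := by rw [Real.negMulLog]; ring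
  linarith

section Permutations

variable {V : Type*} [DecidableEq V]

/-- The restriction of a weight on permutations to those sending `x` to `i`. -/
def permRestrict (f : Equiv.Perm V → ℝ) (x i : V) (σ : Equiv.Perm V) : ℝ :=
  if σ x = i then f σ else 0

lemma permRestrict_nonneg {f : Equiv.Perm V → ℝ} (hf : ∀ σ, 0 ≤ f σ) (x i : V)
    (σ : Equiv.Perm V) : 0 ≤ permRestrict f x i σ := by
  unfold permRestrict
  split_ifs
  exacts [hf σ, le_rfl]

lemma permRestrict_le {f : Equiv.Perm V → ℝ} (hf : ∀ σ, 0 ≤ f σ) (x i : V)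
    (σ : Equiv.Perm V) : permRestrict f x i σ ≤ f σ := by
  unfold permRestrict
  split_ifs
  exacts [le_rfl, hf σ]

lemma permRestrict_comm (f : Equiv.Perm V → ℝ) (x i y j : V) :
    permRestrict (permRestrict f x i) y j = permRestrict (permRestrict f y j) x i := by
  ext σ
  unfold permRestrict
  split_ifs <;> rfl

variable [Fintype V]

/-- The Shannon entropy, multiplied by the total mass, of a weight on permutations. -/
noncomputable def permEntropy (f : Equiv.Perm V → ℝ) : ℝ :=
  ∑ σ, Real.negMulLog (f σ) - Real.negMulLog (∑ σ, f σ)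

/-- The Shannon entropy, multiplied by the total mass, of the image of `x`. -/
noncomputable def coordEntropy (f : Equiv.Perm V → ℝ) (x : V) : ℝ :=
  ∑ i, Real.negMulLog (∑ σ, permRestrict f x i σ) - Real.negMulLog (∑ σ, f σ)

lemma sum_sum_permRestrict (f : Equiv.Perm V → ℝ) (x : V) :
    ∑ i, ∑ σ, permRestrict f x i σ = ∑ σ, f σ := by
  rw [sum_comm]
  exact sum_congr rfl fun σ _ => by simp [permRestrict]

/-- The chain rule for the entropy of a random permutation. -/
lemma permEntropy_eq_coordEntropy_add (f : Equiv.Perm V → ℝ) (x : V) :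
    permEntropy f = coordEntropy f x + ∑ i, permEntropy (permRestrict f x i) := by
  have h : ∑ i, ∑ σ, Real.negMulLog (permRestrict f x i σ) = ∑ σ, Real.negMulLog (f σ) := by
    rw [sum_comm]
    refine sum_congr rfl fun σ _ => ?_
    rw [sum_eq_single (σ x)] <;> simp +contextual [permRestrict, eq_comm]
  unfold permEntropy coordEntropy
  rw [sum_sub_distrib, h]
  ring

lemma sum_coordEntropy_permRestrict_le {f : Equiv.Perm V → ℝ} (hf : ∀ σ, 0 ≤ f σ) {x y : V}
    (hxy : x ≠ y) :
    ∑ i, coordEntropy (permRestrict f x i) y ≤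
      ∑ j, Real.negMulLog (∑ σ, permRestrict f y j σ) +
        ∑ i, (∑ σ, permRestrict f x i σ) *
          Real.log (∑ σ, f σ - ∑ σ, permRestrict f y i σ) := by
  have hterm : ∀ i, coordEntropy (permRestrict f x i) y ≤
      (∑ σ, permRestrict f x i σ) * Real.log (∑ σ, f σ - ∑ σ, permRestrict f y i σ) -
        ∑ j, (∑ σ, permRestrict (permRestrict f x i) y j σ) *
          Real.log (∑ σ, permRestrict f y j σ) := by
    intro i
    obtain ⟨b, hb⟩ : ∃ b : V → ℝ, b = fun j => ∑ σ, permRestrict (permRestrict f x i) y j σ :=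
      ⟨_, rfl⟩
    have hi : b i = 0 := by
      rw [hb]
      refine sum_eq_zero fun σ _ => ?_
      unfold permRestrict
      split_ifs with h1 h2
      · exact absurd (σ.injective (h2.trans h1.symm)) hxy
      · rfl
      · rfl
    have h := sum_negMulLog_sub_le_of_le (univ.erase i) (b := b)
      (q := fun j => ∑ σ, permRestrict f y j σ)
      (fun j _ => hb ▸ sum_nonneg fun σ _ =>
        permRestrict_nonneg (permRestrict_nonneg hf x i) y j σ)
      (fun j _ => hb ▸ sum_le_sum fun σ _ => by
        rw [permRestrict_comm]
        exact permRestrict_le (permRestrict_nonneg hf y j) x i σ)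
    rw [sum_erase univ (f := b) hi,
      sum_erase univ (f := fun j => Real.negMulLog (b j)) (by rw [hi, Real.negMulLog_zero]),
      sum_erase univ (f := fun j => b j * Real.log (∑ σ, permRestrict f y j σ))
        (by rw [hi, zero_mul]),
      sum_erase_eq_sub (mem_univ i), sum_sum_permRestrict] at h
    subst hb
    rw [sum_sum_permRestrict] at h
    exact h
  refine (sum_le_sum fun i _ => hterm i).trans (le_of_eq ?_)
  rw [sum_sub_distrib, sum_comm (f := fun i j =>
    (∑ σ, permRestrict (permRestrict f x i) y j σ) * Real.log (∑ σ, permRestrict f y j σ)),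
    add_comm, sub_eq_add_neg, ← sum_neg_distrib]
  congr 1
  refine sum_congr rfl fun j _ => ?_
  rw [← sum_mul]
  simp only [permRestrict_comm f x _ y j]
  rw [sum_sum_permRestrict, Real.negMulLog]
  ring

lemma sum_permRestrict_coord {f : Equiv.Perm V → ℝ} {U : Finset V} {τ : Equiv.Perm V}
    (hτ : ∀ σ, f σ ≠ 0 → ∀ x ∉ U, σ x = τ x) (i : V) :
    ∑ x ∈ U, ∑ σ, permRestrict f x i σ = if τ.symm i ∈ U then ∑ σ, f σ else 0 := by
  have h : ∀ σ, ∑ x ∈ U, permRestrict f x i σ = if τ.symm i ∈ U then f σ else 0 := by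
    intro σ
    by_cases hσ : f σ = 0
    · simp [permRestrict, hσ]
    have hiff : σ.symm i ∈ U ↔ τ.symm i ∈ U := by
      constructor <;> intro h <;> by_contra hn
      · have h1 := hτ σ hσ _ hn
        rw [Equiv.apply_symm_apply, ← Equiv.eq_symm_apply] at h1
        exact hn (h1 ▸ h)
      · have h1 := hτ σ hσ _ hn
        rw [Equiv.apply_symm_apply, eq_comm, ← Equiv.eq_symm_apply] at h1
        exact hn (h1 ▸ h)
    simp only [permRestrict, ← Equiv.eq_symm_apply, sum_ite_eq', hiff]
  rw [sum_comm, sum_congr rfl fun σ _ => h σ]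
  split_ifs <;> simp

/-- The sum over `x` of the conditional entropies of the image of `y` given the image of `x`. -/
lemma sum_sum_coordEntropy_permRestrict_le {f : Equiv.Perm V → ℝ} (hf : ∀ σ, 0 ≤ f σ)
    {U : Finset V} (hU : 2 ≤ U.card) {τ : Equiv.Perm V}
    (hτ : ∀ σ, f σ ≠ 0 → ∀ x ∉ U, σ x = τ x) {y : V} (hy : y ∈ U) :
    ∑ x ∈ U.erase y, ∑ i, coordEntropy (permRestrict f x i) y ≤
      ((U.card : ℝ) - 1) * Real.log ((U.card : ℝ) - 1) / Real.log U.card *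
        coordEntropy f y := by
  set Z := ∑ σ, f σ with hZ
  set W := U.map τ.toEmbedding with hW
  have hcard : W.card = U.card := card_map _
  have hmem : ∀ i, i ∈ W ↔ τ.symm i ∈ U := fun i => by simp [hW]
  have hcoord : ∀ i, ∑ x ∈ U, ∑ σ, permRestrict f x i σ = if i ∈ W then Z else 0 := by
    intro i
    simp only [hmem]
    exact sum_permRestrict_coord hτ i
  have hnn : ∀ x i, 0 ≤ ∑ σ, permRestrict f x i σ := fun x i =>
    sum_nonneg fun σ _ => permRestrict_nonneg hf x i σ
  have hzero : ∀ x ∈ U, ∀ i ∉ W, ∑ σ, permRestrict f x i σ = 0 := by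
    intro x hx i hi
    have h := hcoord i
    rw [if_neg hi, sum_eq_zero_iff_of_nonneg fun x _ => hnn x i] at h
    exact h x hx
  have hsumW : ∑ i ∈ W, ∑ σ, permRestrict f y i σ = Z := by
    rw [hZ, ← sum_sum_permRestrict f y]
    exact sum_subset (subset_univ _) fun i _ hi => hzero y hy i hi
  have hsumN : ∑ i ∈ W, Real.negMulLog (∑ σ, permRestrict f y i σ) =
      ∑ i, Real.negMulLog (∑ σ, permRestrict f y i σ) :=
    sum_subset (subset_univ _) fun i _ hi => by rw [hzero y hy i hi, Real.negMulLog_zero]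
  have hlogs : ∑ x ∈ U.erase y, ∑ i, (∑ σ, permRestrict f x i σ) *
      Real.log (Z - ∑ σ, permRestrict f y i σ) =
      -∑ i ∈ W, Real.negMulLog (Z - ∑ σ, permRestrict f y i σ) := by
    rw [sum_comm, ← sum_neg_distrib]
    simp only [← sum_mul]
    rw [← sum_subset (subset_univ W)]
    · refine sum_congr rfl fun i hi => ?_
      rw [sum_erase_eq_sub hy, hcoord i, if_pos hi, Real.negMulLog]
      ring
    · intro i _ hi
      rw [sum_eq_zero fun x hx => hzero x (mem_of_mem_erase hx) i hi, zero_mul]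
  have hmain := sum_negMulLog_sub_le W (hcard ▸ hU) (fun i _ => hnn y i) hsumW
  rw [hcard, hsumN] at hmain
  refine le_trans ?_ hmain
  refine (sum_le_sum fun x hx =>
    sum_coordEntropy_permRestrict_le hf (ne_of_mem_erase hx)).trans (le_of_eq ?_)
  rw [sum_add_distrib, hlogs, sum_const, card_erase_of_mem hy, nsmul_eq_mul,
    Nat.cast_sub (by omega)]
  push_cast
  ring

/-- Among random permutations that are deterministic off `U`, the ratio of the entropy to the sum
of the entropies of the coordinates is maximised by the uniform one. -/
lemma permEntropy_le {f : Equiv.Perm V → ℝ} (hf : ∀ σ, 0 ≤ f σ)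
    {U : Finset V} (hU : 1 ≤ U.card) {τ : Equiv.Perm V}
    (hτ : ∀ σ, f σ ≠ 0 → ∀ x ∉ U, σ x = τ x) :
    permEntropy f ≤ Real.log (U.card).factorial / (U.card * Real.log U.card) *
      ∑ x ∈ U, coordEntropy f x := by
  obtain ⟨k, hk⟩ : ∃ k, k = U.card := ⟨_, rfl⟩
  rw [← hk] at hU ⊢
  induction k, hU using Nat.le_induction generalizing f U τ with
  | base =>
    obtain ⟨a, rfl⟩ := card_eq_one.1 hk.symm
    have h : ∀ σ, σ ≠ τ → f σ = 0 := by
      intro σ hσ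
      by_contra hne
      have hoff : ∀ x, x ≠ a → σ x = τ x := fun x hx => hτ σ hne x (by simpa using hx)
      refine hσ (Equiv.ext fun x => ?_)
      by_cases hx : x = a
      · subst hx
        by_contra hxx
        have h1 : τ.symm (σ x) ≠ x := fun h => hxx ((Equiv.symm_apply_eq τ).1 h)
        have h2 := hoff _ h1
        rw [Equiv.apply_symm_apply] at h2
        exact h1 (σ.injective h2)
      · exact hoff x hx
    unfold permEntropy
    rw [Fintype.sum_eq_single τ h,
      Fintype.sum_eq_single τ fun σ hσ => by rw [h σ hσ, Real.negMulLog_zero]]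
    simp
  | succ k hk1 ih =>
    have hstep : ∀ x ∈ U, permEntropy f ≤ coordEntropy f x +
        Real.log k.factorial / (k * Real.log k) *
          ∑ i, ∑ y ∈ U.erase x, coordEntropy (permRestrict f x i) y := by
      intro x hx
      rw [permEntropy_eq_coordEntropy_add f x, mul_sum]
      gcongr with i
      obtain ⟨τ', hτ'⟩ : ∃ τ' : Equiv.Perm V, ∀ σ, permRestrict f x i σ ≠ 0 →
          ∀ z ∉ U.erase x, σ z = τ' z := by
        have hfix : ∀ σ, permRestrict f x i σ ≠ 0 → σ x = i ∧ f σ ≠ 0 := by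
          intro σ hσ
          simpa [permRestrict] using hσ
        by_cases h : ∃ σ, permRestrict f x i σ ≠ 0
        · obtain ⟨σ₀, hσ₀⟩ := h
          refine ⟨σ₀, fun σ hσ z hz => ?_⟩
          by_cases hzx : z = x
          · rw [hzx, (hfix σ hσ).1, (hfix σ₀ hσ₀).1]
          · have hzU : z ∉ U := fun hzU => hz (mem_erase.2 ⟨hzx, hzU⟩)
            rw [hτ σ (hfix σ hσ).2 z hzU, hτ σ₀ (hfix σ₀ hσ₀).2 z hzU]
        · exact ⟨τ, fun σ hσ => absurd ⟨σ, hσ⟩ h⟩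
      exact ih (permRestrict_nonneg hf x i) hτ'
        (by rw [card_erase_of_mem hx, ← hk, Nat.add_sub_cancel])
    have hsum := sum_le_sum hstep
    have hswap : ∑ x ∈ U, ∑ i, ∑ y ∈ U.erase x, coordEntropy (permRestrict f x i) y =
        ∑ y ∈ U, ∑ x ∈ U.erase y, ∑ i, coordEntropy (permRestrict f x i) y := by
      simp only [sum_comm (s := univ)]
      refine sum_comm' fun x y => ?_
      simp only [mem_erase]
      tauto
    have hpair := sum_le_sum fun y (hy : y ∈ U) =>
      sum_sum_coordEntropy_permRestrict_le hf (by omega) hτ hy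
    rw [← hk, ← mul_sum] at hpair
    rw [sum_const, ← hk, nsmul_eq_mul, sum_add_distrib, ← mul_sum, hswap] at hsum
    push_cast at hsum hpair ⊢
    rw [add_sub_cancel_right] at hpair
    set C := ∑ x ∈ U, coordEntropy f x
    have hk0 : (1 : ℝ) ≤ k := by exact_mod_cast hk1
    have hlog : 0 < Real.log ((k : ℝ) + 1) := Real.log_pos (by linarith)
    have hc0 : 0 ≤ Real.log k.factorial / (k * Real.log k) := by positivity
    have hc : Real.log k.factorial / (k * Real.log k) *
        (k * Real.log k / Real.log (k + 1) * C) =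
        Real.log k.factorial / Real.log (k + 1) * C := by
      rcases hk1.eq_or_lt with rfl | hk2
      · simp
      · have : 0 < Real.log k := Real.log_pos (by exact_mod_cast hk2)
        field_simp
    have h := hsum.trans (add_le_add_right (mul_le_mul_of_nonneg_left hpair hc0) _)
    rw [hc] at h
    have hfac : Real.log (k + 1).factorial = Real.log (k + 1) + Real.log k.factorial := by
      rw [Nat.factorial_succ]
      push_cast
      exact Real.log_mul (by positivity) (by positivity)
    rw [hfac, div_mul_eq_mul_div, le_div_iff₀ (by positivity)]
    rw [div_mul_eq_mul_div, ← sub_le_iff_le_add', le_div_iff₀ hlog] at h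
    linarith

lemma card_filter_perm_apply_eq (x i : V) :
    Fintype.card V * #{σ : Equiv.Perm V | σ x = i} = (Fintype.card V).factorial := by
  have h : ∀ j, #{σ : Equiv.Perm V | σ x = j} = #{σ : Equiv.Perm V | σ x = i} := by
    intro j
    refine card_equiv (Equiv.mulLeft (Equiv.swap j i)) fun σ => ?_
    simp [Equiv.swap_apply_eq_iff]
  have h1 := card_eq_sum_card_fiberwise (s := univ) (f := fun σ : Equiv.Perm V => σ x)
    (t := univ) (by simp)
  rw [sum_congr rfl fun j _ => h j, sum_const, card_univ, card_univ, Fintype.card_perm,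
    smul_eq_mul] at h1
  exact h1.symm

end Permutations

lemma mul_log_div_eq {a b : ℝ} (hb : b ≠ 0) :
    a * Real.log (a / b) = -Real.negMulLog a - a * Real.log b := by
  rcases eq_or_ne a 0 with rfl | ha
  · simp
  · rw [Real.log_div ha hb, Real.negMulLog]
    ring

open Stmt7 in
theorem stmt7 {V : Type*} [Fintype V] [DecidableEq V]
    (n : ℕ) (hn : 2 ≤ n) (hcard : Fintype.card V = n)
    (f : Equiv.Perm V → ℝ) (hf : ∀ σ, 0 ≤ f σ) :
    ∑ x : V, (1 / (n : ℝ)) * ∑ i : V, marg f x i * Real.log (marg f x i / mean f)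
      ≤ ((n : ℝ) * Real.log n / Real.log (Nat.factorial n)) * Ent f := by
  set Z := ∑ σ, f σ with hZ
  have hn0 : (2 : ℝ) ≤ n := by exact_mod_cast hn
  have hlog : 0 < Real.log n := Real.log_pos (by linarith)
  have hfac : (2 : ℝ) ≤ n.factorial := by exact_mod_cast hn.trans n.self_le_factorial
  have hlogfac : 0 < Real.log n.factorial := Real.log_pos (by linarith)
  have hN : (Fintype.card (Equiv.Perm V) : ℝ) = n.factorial := by
    rw [Fintype.card_perm, hcard]
  have hmean : mean f = Z / n.factorial := by rw [mean, hN]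
  have hZ0 : 0 ≤ Z := sum_nonneg fun σ _ => hf σ
  rcases hZ0.eq_or_lt with h0 | hpos
  · have h : mean f = 0 := by rw [hmean, ← h0, zero_div]
    have hEnt : Ent f = 0 := by
      unfold Ent
      simp only [h, div_zero, Real.log_zero, mul_zero]
      simp [mean]
    simp [h, hEnt]
  have hEnt : Ent f = (Z * Real.log n.factorial - permEntropy f) / n.factorial := by
    rw [Ent, mean, hN]
    congr 1
    rw [sum_congr rfl fun σ _ => mul_log_div_eq (by rw [hmean]; positivity), sum_sub_distrib,
      sum_neg_distrib, ← sum_mul, ← hZ, hmean, Real.log_div hpos.ne' (by positivity), permEntropy,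
      ← hZ, Real.negMulLog]
    ring
  have hmarg : ∀ x, 1 / (n : ℝ) * ∑ i : V, marg f x i * Real.log (marg f x i / mean f) =
      (Z * Real.log n - coordEntropy f x) / n.factorial := by
    intro x
    have hterm : ∀ i, marg f x i * Real.log (marg f x i / mean f) = n / n.factorial *
        (-Real.negMulLog (∑ σ, permRestrict f x i σ) -
          (∑ σ, permRestrict f x i σ) * Real.log (Z / n)) := by
      intro i
      have hc : (n : ℝ) * (#{σ : Equiv.Perm V | σ x = i} : ℝ) = n.factorial := by
        have h := card_filter_perm_apply_eq x i
        rw [hcard] at h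
        exact_mod_cast h
      have hm : marg f x i = n / n.factorial * ∑ σ, permRestrict f x i σ := by
        have h0 : (#{σ : Equiv.Perm V | σ x = i} : ℝ) ≠ 0 := by
          intro h
          rw [h] at hc
          linarith
        simp only [permRestrict]
        rw [marg, sum_filter, ← hc]
        field_simp
      rw [← mul_log_div_eq (by positivity), ← mul_assoc, ← hm, hmean, hm]
      congr 2
      field_simp
    rw [sum_congr rfl fun i _ => hterm i, ← mul_sum, sum_sub_distrib, sum_neg_distrib, ← sum_mul,
      sum_sum_permRestrict, ← hZ, coordEntropy, ← hZ, Real.log_div hpos.ne' (by positivity)]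
    rw [Real.negMulLog.eq_1 Z]
    field_simp
    ring
  have hmain := permEntropy_le hf (U := univ) (τ := 1) (by rw [card_univ]; omega)
    (fun σ _ x hx => absurd (mem_univ x) hx)
  rw [card_univ, hcard] at hmain
  rw [sum_congr rfl fun x _ => hmarg x, ← sum_div, hEnt, ← mul_div_assoc,
    sum_sub_distrib, sum_const, card_univ, hcard, nsmul_eq_mul]
  gcongr
  set S := ∑ x, coordEntropy f x
  rw [div_mul_eq_mul_div, le_div_iff₀ (by positivity)] at hmain
  rw [div_mul_eq_mul_div, le_div_iff₀ hlogfac]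
  linarith
end

section
/- Let n ≥ 2 and p_c = n·log n / log(n!). For any family of functions φ_x : V → ℝ≥0 indexed by x ∈ V, the uniform distribution μ on S_n satisfies μ[∏_{x∈V} φ_x(σ_x)] ≤ ∏_{x∈V} (μ[φ_x(σ_x)^{p_c}])^{1/p_c}, where μ[φ_x(σ_x)^{p}] = (1/n)∑_{i∈V} φ_x(i)^{p}. -/
open Finset

/-- The constant `K` for which `∑ η(1 - aᵢ) = K * ∑ η(aᵢ)`, `η = Real.negMulLog`, at the uniform
probability vector `a` on `n + 1` points. -/
noncomputable def coEntropyConst (n : ℕ) : ℝ :=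
  n * (Real.log (n + 1) - Real.log n) / Real.log (n + 1)

lemma coEntropyConst_nonneg (n : ℕ) : 0 ≤ coEntropyConst n := by
  rcases Nat.eq_zero_or_pos n with rfl | hn
  · simp [coEntropyConst]
  have h1 : (1 : ℝ) ≤ n := by exact_mod_cast hn
  have h2 : Real.log n ≤ Real.log (n + 1) := Real.log_le_log (by linarith) (by linarith)
  exact div_nonneg (mul_nonneg (by linarith) (by linarith)) (Real.log_nonneg (by linarith))

lemma coEntropyConst_one : coEntropyConst 1 = 1 := by
  have : Real.log 2 ≠ 0 := (Real.log_pos (by norm_num)).ne'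
  norm_num [coEntropyConst, this]

lemma coEntropyConst_le_one (n : ℕ) : coEntropyConst n ≤ 1 := by
  rcases Nat.lt_or_ge n 2 with hn | hn
  · interval_cases n
    · simp [coEntropyConst]
    · exact coEntropyConst_one.le
  have h1 : (2 : ℝ) ≤ n := by exact_mod_cast hn
  have h2 : Real.log (n + 1) - Real.log n ≤ 1 / n := by
    rw [← Real.log_div (by positivity) (by positivity)]
    have := Real.log_le_sub_one_of_pos (x := ((n : ℝ) + 1) / n) (by positivity)
    have e : ((n : ℝ) + 1) / n - 1 = 1 / n := by field_simp; ring
    linarith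
  have h3 : 1 ≤ Real.log (n + 1) := by
    rw [Real.le_log_iff_exp_le (by positivity)]
    have := Real.exp_one_lt_d9
    linarith
  rw [coEntropyConst, div_le_one (by linarith)]
  calc (n : ℝ) * (Real.log (n + 1) - Real.log n) ≤ n * (1 / n) := by gcongr
    _ = 1 := by field_simp
    _ ≤ _ := h3

lemma one_le_coEntropyConst_mul {n : ℕ} (hn : 1 ≤ n) : 1 ≤ coEntropyConst n * n := by
  rcases hn.eq_or_lt with rfl | hn
  · simp [coEntropyConst_one]
  have h1 : (2 : ℝ) ≤ n := by exact_mod_cast hn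
  have h2 : 1 / ((n : ℝ) + 1) ≤ Real.log (n + 1) - Real.log n := by
    rw [← Real.log_div (by positivity) (by positivity)]
    have := Real.one_sub_inv_le_log_of_pos (x := ((n : ℝ) + 1) / n) (by positivity)
    have e : 1 - (((n : ℝ) + 1) / n)⁻¹ = 1 / (n + 1) := by field_simp; ring
    linarith
  have h3 : Real.log (n + 1) ≤ (n : ℝ) ^ 2 / (n + 1) := by
    have h4 : Real.log ((n + 1) / 2) ≤ ((n : ℝ) + 1) / 2 - 1 :=
      Real.log_le_sub_one_of_pos (by positivity)
    rw [Real.log_div (by positivity) (by norm_num)] at h4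
    have h5 := Real.log_two_lt_d9
    rw [le_div_iff₀ (by positivity)]
    have h6 : Real.log (n + 1) ≤ (n : ℝ) / 2 + 0.1931471808 := by linarith
    rcases Nat.lt_or_ge n 3 with h7 | h7
    · obtain rfl : n = 2 := by omega
      norm_num at h6 ⊢
      linarith
    · have h8 : (3 : ℝ) ≤ n := by exact_mod_cast h7
      nlinarith
  have h9 : 0 < Real.log ((n : ℝ) + 1) := Real.log_pos (by linarith)
  rw [coEntropyConst, div_mul_eq_mul_div, le_div_iff₀ h9, one_mul]
  calc Real.log (n + 1) ≤ (n : ℝ) ^ 2 / (n + 1) := h3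
    _ = n * (1 / ((n : ℝ) + 1)) * n := by field_simp
    _ ≤ _ := by gcongr

/-- `a ↦ η(1 - a) - K η(a)`, whose sum over a probability vector is to be bounded below. -/
noncomputable def coEntropyGap (K a : ℝ) : ℝ := Real.negMulLog (1 - a) - K * Real.negMulLog a

@[fun_prop] lemma continuous_coEntropyGap (K : ℝ) : Continuous (coEntropyGap K) := by
  unfold coEntropyGap; fun_prop

lemma hasDerivAt_coEntropyGap {K a : ℝ} (h0 : a ≠ 0) (h1 : 1 - a ≠ 0) :
    HasDerivAt (coEntropyGap K) (Real.log (1 - a) + 1 + K * (Real.log a + 1)) a := by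
  have e1 := (Real.hasDerivAt_negMulLog h1).comp a ((hasDerivAt_id a).const_sub 1)
  have e2 := (Real.hasDerivAt_negMulLog h0).const_mul K
  exact (e1.sub e2).congr_deriv (by ring)

lemma hasDerivAt_deriv_coEntropyGap {K a : ℝ} (h0 : a ≠ 0) (h1 : 1 - a ≠ 0) :
    HasDerivAt (fun a ↦ Real.log (1 - a) + 1 + K * (Real.log a + 1)) (K / a - 1 / (1 - a)) a := by
  have e1 := (Real.hasDerivAt_log h1).comp a ((hasDerivAt_id a).const_sub 1)
  have e2 := ((Real.hasDerivAt_log h0).add_const 1).const_mul K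
  exact ((e1.add_const 1).add e2).congr_deriv (by simp; ring)

lemma convexOn_coEntropyGap {K : ℝ} (hK : 0 ≤ K) :
    ConvexOn ℝ (Set.Icc 0 (K / (1 + K))) (coEntropyGap K) := by
  have hc : K / (1 + K) < 1 := by rw [div_lt_one (by linarith)]; linarith
  refine convexOn_of_hasDerivWithinAt2_nonneg (convex_Icc _ _) (by fun_prop)
    (f' := fun a ↦ Real.log (1 - a) + 1 + K * (Real.log a + 1))
    (f'' := fun a ↦ K / a - 1 / (1 - a)) ?_ ?_ ?_ <;> rw [interior_Icc] <;> rintro a ⟨h0, h1⟩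
  · exact (hasDerivAt_coEntropyGap h0.ne' (by linarith)).hasDerivWithinAt
  · exact (hasDerivAt_deriv_coEntropyGap h0.ne' (by linarith)).hasDerivWithinAt
  · rw [sub_nonneg, div_le_div_iff₀ (by linarith) h0]
    rw [lt_div_iff₀ (by linarith)] at h1
    linarith

lemma concaveOn_coEntropyGap {K : ℝ} (hK : 0 ≤ K) :
    ConcaveOn ℝ (Set.Icc (K / (1 + K)) 1) (coEntropyGap K) := by
  have hc : 0 ≤ K / (1 + K) := by positivity
  refine concaveOn_of_hasDerivWithinAt2_nonpos (convex_Icc _ _) (by fun_prop)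
    (f' := fun a ↦ Real.log (1 - a) + 1 + K * (Real.log a + 1))
    (f'' := fun a ↦ K / a - 1 / (1 - a)) ?_ ?_ ?_ <;> rw [interior_Icc] <;> rintro a ⟨h0, h1⟩
  · exact (hasDerivAt_coEntropyGap (by linarith) (by linarith)).hasDerivWithinAt
  · exact (hasDerivAt_deriv_coEntropyGap (by linarith) (by linarith)).hasDerivWithinAt
  · rw [sub_nonpos, div_le_div_iff₀ (by linarith) (by linarith)]
    rw [div_lt_iff₀ (by linarith)] at h0
    linarith

lemma coEntropyGap_uniform {n : ℕ} (hn : 1 ≤ n) :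
    coEntropyGap (coEntropyConst n) (1 / (n + 1)) = 0 := by
  have h1 : (1 : ℝ) ≤ n := by exact_mod_cast hn
  have h2 : Real.log ((n : ℝ) + 1) ≠ 0 := (Real.log_pos (by linarith)).ne'
  have e : 1 - 1 / ((n : ℝ) + 1) = n / (n + 1) := by field_simp; ring
  rw [coEntropyGap, e, Real.negMulLog, Real.negMulLog, Real.log_div (by positivity) (by positivity),
    one_div, Real.log_inv, coEntropyConst]
  field_simp
  ring

/-- The two-level case: one atom of mass `1 - s`, the others of mass `s / n`. -/
lemma two_level_coEntropyGap_nonneg {n : ℕ} (hn : 1 ≤ n) {s : ℝ} (hs : s ∈ Set.Icc (0 : ℝ) 1) :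
    0 ≤ n * coEntropyGap (coEntropyConst n) (s / n) + coEntropyGap (coEntropyConst n) (1 - s) := by
  set K := coEntropyConst n with hKdef
  have hK1 : K ≤ 1 := coEntropyConst_le_one n
  have hKn : 1 ≤ K * n := one_le_coEntropyConst_mul hn
  have hn1 : (1 : ℝ) ≤ n := by exact_mod_cast hn
  have hn0 : (n : ℝ) ≠ 0 := by positivity
  set φ : ℝ → ℝ := fun s ↦ n * coEntropyGap K (s / n) + coEntropyGap K (1 - s) with hφ
  set φ' : ℝ → ℝ := fun s ↦ (Real.log (1 - s / n) + 1 + K * (Real.log (s / n) + 1)) -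
    (Real.log (1 - (1 - s)) + 1 + K * (Real.log (1 - s) + 1)) with hφ'
  set φ'' : ℝ → ℝ := fun s ↦ (K / (s / n) - 1 / (1 - s / n)) / n +
    (K / (1 - s) - 1 / (1 - (1 - s))) with hφ''
  have hlt : ∀ s : ℝ, 0 < s → s < 1 → 0 < 1 - s / n := fun s h0 h1 ↦ by
    rw [sub_pos, div_lt_one (by linarith)]; linarith
  have hcont : Continuous φ := by fun_prop
  have hd1 : ∀ s : ℝ, 0 < s → s < 1 → HasDerivAt φ (φ' s) s := fun s h0 h1 ↦ by
    have e1 := ((hasDerivAt_coEntropyGap (K := K) (a := s / n) (by positivity)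
      (hlt s h0 h1).ne').comp s ((hasDerivAt_id s).div_const (n : ℝ))).const_mul (n : ℝ)
    have e2 := (hasDerivAt_coEntropyGap (K := K) (a := 1 - s) (by linarith)
      (by linarith)).comp s ((hasDerivAt_id s).const_sub 1)
    exact (e1.add e2).congr_deriv (by simp only [hφ']; field_simp; ring)
  have hd2 : ∀ s : ℝ, 0 < s → s < 1 → HasDerivAt φ' (φ'' s) s := fun s h0 h1 ↦ by
    have e1 := ((hasDerivAt_deriv_coEntropyGap (K := K) (a := s / n) (by positivity)
      (hlt s h0 h1).ne').comp s ((hasDerivAt_id s).div_const (n : ℝ)))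
    have e2 := (hasDerivAt_deriv_coEntropyGap (K := K) (a := 1 - s) (by linarith)
      (by linarith)).comp s ((hasDerivAt_id s).const_sub 1)
    exact (e1.sub e2).congr_deriv (by simp only [hφ'']; ring)
  have hsign : ∀ s : ℝ, 0 < s → s < 1 →
      φ'' s = ((1 - K) * n - s * (n - K)) * (-1 / (s * (1 - s) * (n - s))) := fun s h0 h1 ↦ by
    have : (n : ℝ) - s ≠ 0 := by linarith
    have h3 : 1 - s ≠ 0 := by linarith
    have h4 : 1 - s / n = (n - s) / n := by field_simp
    simp only [hφ'', h4, sub_sub_cancel]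
    field_simp
    ring
  have hneg : ∀ s : ℝ, 0 < s → s < 1 → -1 / (s * (1 - s) * (n - s)) ≤ 0 := fun s h0 h1 ↦
    div_nonpos_of_nonpos_of_nonneg (by norm_num)
      (mul_nonneg (mul_nonneg h0.le (by linarith)) (by linarith))
  obtain ⟨s₀, h00, h01, hlow, hhigh⟩ : ∃ s₀ : ℝ, 0 ≤ s₀ ∧ s₀ ≤ n / (n + 1) ∧
      (∀ s, s ≤ s₀ → 0 ≤ (1 - K) * n - s * (n - K)) ∧
      (∀ s, s₀ ≤ s → (1 - K) * n - s * (n - K) ≤ 0) := by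
    rcases (hK1.trans hn1).eq_or_lt with h | h
    · have : K = 1 := by linarith
      exact ⟨0, le_rfl, by positivity, fun s _ ↦ by simp [← h, this], fun s _ ↦ by simp [← h, this]⟩
    · have h' : 0 < n - K := by linarith
      refine ⟨(1 - K) * n / (n - K), div_nonneg (mul_nonneg (by linarith) (by linarith)) h'.le,
        ?_, fun s hs ↦ ?_, fun s hs ↦ ?_⟩
      · rw [div_le_div_iff₀ h' (by linarith)]
        nlinarith
      · rw [le_div_iff₀ h'] at hs; linarith
      · rw [div_le_iff₀ h'] at hs; linarith
  have hs1 : (n : ℝ) / (n + 1) < 1 := by rw [div_lt_one (by linarith)]; linarith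
  have hs1' : 0 < (n : ℝ) / (n + 1) := by positivity
  have e1 : (n : ℝ) / (n + 1) / n = 1 / (n + 1) := by field_simp
  have e2 : 1 - (n : ℝ) / (n + 1) = 1 / (n + 1) := by field_simp; ring
  have e3 : 1 - 1 / ((n : ℝ) + 1) = n / (n + 1) := by field_simp; ring
  have hφ1 : φ (n / (n + 1)) = 0 := by
    simp only [hφ, e1, e2, hKdef, coEntropyGap_uniform hn]; simp
  have hφ1' : HasDerivAt φ 0 (n / (n + 1)) :=
    (hd1 _ hs1' hs1).congr_deriv (by simp only [hφ', e1, e2, e3]; ring)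
  have hvex : ConvexOn ℝ (Set.Icc s₀ 1) φ := by
    refine convexOn_of_hasDerivWithinAt2_nonneg (convex_Icc _ _) hcont.continuousOn
      (f' := φ') (f'' := φ'') ?_ ?_ ?_ <;> rw [interior_Icc] <;> rintro a ⟨h0, h1⟩
    · exact (hd1 a (by linarith) h1).hasDerivWithinAt
    · exact (hd2 a (by linarith) h1).hasDerivWithinAt
    · rw [hsign a (by linarith) h1]
      exact mul_nonneg_of_nonpos_of_nonpos (hhigh a h0.le) (hneg a (by linarith) h1)
  have hcave : ConcaveOn ℝ (Set.Icc 0 s₀) φ := by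
    refine concaveOn_of_hasDerivWithinAt2_nonpos (convex_Icc _ _) hcont.continuousOn
      (f' := φ') (f'' := φ'') ?_ ?_ ?_ <;> rw [interior_Icc] <;> rintro a ⟨h0, h1⟩
    · exact (hd1 a h0 (by linarith)).hasDerivWithinAt
    · exact (hd2 a h0 (by linarith)).hasDerivWithinAt
    · rw [hsign a h0 (by linarith)]
      exact mul_nonpos_of_nonneg_of_nonpos (hlow a h1.le) (hneg a h0 (by linarith))
  have hright : ∀ s ∈ Set.Icc s₀ 1, 0 ≤ φ s := by
    intro s hs
    have hmem : (n : ℝ) / (n + 1) ∈ Set.Icc s₀ 1 := ⟨h01, hs1.le⟩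
    rcases lt_trichotomy s (n / (n + 1)) with h | h | h
    · have := hvex.slope_le_of_hasDerivAt hs hmem h hφ1'
      rw [slope_def_field, hφ1, div_nonpos_iff] at this
      rcases this with h' | h' <;> linarith [h'.1, h'.2]
    · rw [h, hφ1]
    · have := hvex.le_slope_of_hasDerivAt hmem hs h hφ1'
      rw [slope_def_field, hφ1, div_nonneg_iff] at this
      rcases this with h' | h' <;> linarith [h'.1, h'.2]
  change 0 ≤ φ s
  rcases le_total s s₀ with h | h
  · have hφ0 : φ 0 = 0 := by simp [hφ, coEntropyGap]
    have := hcave.min_le_of_mem_Icc (Set.left_mem_Icc.2 h00) (Set.right_mem_Icc.2 h00) ⟨hs.1, h⟩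
    refine le_trans (le_min hφ0.ge (hright s₀ ⟨le_rfl, by linarith⟩)) this
  · exact hright s ⟨h, hs.2⟩

lemma card_mul_coEntropyGap_le {ι : Type*} {s : Finset ι} {K : ℝ} (hK : 0 ≤ K) {b : ι → ℝ}
    (hb : ∀ i ∈ s, b i ∈ Set.Icc 0 (K / (1 + K))) (hs : s.Nonempty) :
    #s * coEntropyGap K ((∑ i ∈ s, b i) / #s) ≤ ∑ i ∈ s, coEntropyGap K (b i) := by
  have hc : (0 : ℝ) < #s := by exact_mod_cast hs.card_pos
  have := (convexOn_coEntropyGap hK).map_sum_le (t := s) (w := fun _ ↦ (#s : ℝ)⁻¹) (p := b)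
    (fun _ _ ↦ by positivity) (by simp [hc.ne']) hb
  simp only [smul_eq_mul, ← Finset.mul_sum] at this
  rw [div_eq_inv_mul]
  calc _ ≤ (#s : ℝ) * ((#s : ℝ)⁻¹ * ∑ i ∈ s, coEntropyGap K (b i)) := by gcongr
    _ = _ := by field_simp

lemma sum_coEntropyGap_nonneg {ι : Type*} {s : Finset ι} {n : ℕ} (hn : 1 ≤ n) (hs : #s = n + 1)
    {a : ι → ℝ} (ha : ∀ i ∈ s, 0 ≤ a i) (hsum : ∑ i ∈ s, a i = 1) :
    0 ≤ ∑ i ∈ s, coEntropyGap (coEntropyConst n) (a i) := by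
  classical
  have hK : 0 ≤ coEntropyConst n := coEntropyConst_nonneg n
  set K := coEntropyConst n with hKdef
  set c := K / (1 + K) with hc
  have hc0 : 0 ≤ c := by positivity
  have hsne : s.Nonempty := by rw [← Finset.card_pos]; omega
  by_cases hJ : ∀ i ∈ s, a i ≤ c
  · have := card_mul_coEntropyGap_le hK (fun i hi ↦ ⟨ha i hi, hJ i hi⟩) hsne
    rw [hsum, hs] at this
    push_cast at this
    rwa [hKdef, coEntropyGap_uniform hn, mul_zero] at this
  push Not at hJ
  obtain ⟨j, hj, hjc⟩ := hJ
  set b : ι → ℝ := fun i ↦ min (a i) c with hb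
  have hba : ∀ i, b i ≤ a i := fun i ↦ min_le_left _ _
  have hbj : b j = c := min_eq_right hjc.le
  set v := c + ∑ i ∈ s, (a i - b i) with hv
  have hle : ∀ i ∈ s, a i - b i ≤ v - c := fun i hi ↦ by
    have := Finset.single_le_sum (f := fun i ↦ a i - b i) (fun i _ ↦ sub_nonneg.2 (hba i)) hi
    linarith
  have hvc : c < v := by have := hle j hj; linarith
  have hbsum : ∑ i ∈ s.erase j, b i = 1 - v := by
    rw [hv, Finset.sum_sub_distrib, hsum, ← Finset.add_sum_erase s b hj, hbj]; ring
  have hb0 : ∀ i ∈ s, 0 ≤ b i := fun i hi ↦ le_min (ha i hi) hc0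
  have hv1 : v ≤ 1 := by
    have := Finset.sum_nonneg fun i hi ↦ hb0 i (Finset.mem_of_mem_erase (a := j) hi)
    linarith
  have hchord : ∀ i ∈ s, coEntropyGap K (b i) +
      (a i - b i) * ((coEntropyGap K v - coEntropyGap K c) / (v - c)) ≤ coEntropyGap K (a i) := by
    intro i hi
    rcases le_total (a i) c with h | h
    · simp [hb, h]
    · have hbi : b i = c := min_eq_right h
      have h1 := hle i hi
      rw [hbi] at h1 ⊢
      have hvc' : 0 < v - c := by linarith
      have hcI : c ∈ Set.Icc (K / (1 + K)) 1 := ⟨le_rfl, by linarith⟩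
      have hvI : v ∈ Set.Icc (K / (1 + K)) 1 := ⟨hvc.le, hv1⟩
      have h2 : (a i - c) / (v - c) ≤ 1 := by rwa [div_le_one hvc']
      have h3 : 0 ≤ (a i - c) / (v - c) := div_nonneg (by linarith) hvc'.le
      have := (concaveOn_coEntropyGap hK).2 hcI hvI (sub_nonneg.2 h2) h3 (sub_add_cancel _ _)
      have e : (1 - (a i - c) / (v - c)) * c + (a i - c) / (v - c) * v = a i := by
        field_simp; ring
      simp only [smul_eq_mul, e] at this
      refine le_trans (le_of_eq ?_) this
      ring
  have hcard : #(s.erase j) = n := by rw [Finset.card_erase_of_mem hj, hs]; rfl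
  have hJ := card_mul_coEntropyGap_le hK (s := s.erase j) (b := b)
    (fun i hi ↦ ⟨hb0 i (Finset.mem_of_mem_erase hi), min_le_right _ _⟩)
    (by rw [← Finset.card_pos]; omega)
  rw [hbsum, hcard] at hJ
  have h2 := two_level_coEntropyGap_nonneg hn (s := 1 - v) ⟨by linarith, by linarith⟩
  rw [sub_sub_cancel] at h2
  have h3 := Finset.sum_le_sum hchord
  have e : (v - c) * ((coEntropyGap K v - coEntropyGap K c) / (v - c)) =
      coEntropyGap K v - coEntropyGap K c := mul_div_cancel₀ _ (by linarith)
  rw [Finset.sum_add_distrib, ← Finset.sum_mul, show ∑ i ∈ s, (a i - b i) = v - c by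
    rw [hv]; ring, e, ← Finset.add_sum_erase s _ hj, hbj] at h3
  linarith

/-- Homogeneous form of the comparison between `∑ η(1 - aᵢ)` and `∑ η(aᵢ)`. -/
lemma coEntropyConst_mul_le {ι : Type*} {s : Finset ι} {n : ℕ} (hn : 1 ≤ n) (hs : #s = n + 1)
    {b : ι → ℝ} (hb : ∀ i ∈ s, 0 ≤ b i) {W : ℝ} (hW : ∑ i ∈ s, b i = W) :
    coEntropyConst n * (∑ i ∈ s, Real.negMulLog (b i) - Real.negMulLog W) ≤
      ∑ i ∈ s, Real.negMulLog (W - b i) - n * Real.negMulLog W := by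
  rcases (hW ▸ Finset.sum_nonneg hb : 0 ≤ W).eq_or_lt with h | h
  · have : ∀ i ∈ s, b i = 0 := (Finset.sum_eq_zero_iff_of_nonneg hb).1 (by rw [hW, h])
    rw [← h, Finset.sum_eq_zero fun i hi ↦ by rw [this i hi, Real.negMulLog_zero],
      Finset.sum_eq_zero fun i hi ↦ by rw [this i hi, sub_zero, Real.negMulLog_zero]]
    simp
  have hsum : ∑ i ∈ s, b i / W = 1 := by rw [← Finset.sum_div, hW, div_self h.ne']
  have := sum_coEntropyGap_nonneg hn hs (a := fun i ↦ b i / W)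
    (fun i hi ↦ div_nonneg (hb i hi) h.le) hsum
  have e1 : ∀ i, Real.negMulLog (b i) =
      b i / W * Real.negMulLog W + W * Real.negMulLog (b i / W) := fun i ↦ by
    rw [← Real.negMulLog_mul, mul_div_cancel₀ _ h.ne']
  have e2 : ∀ i, Real.negMulLog (W - b i) =
      (1 - b i / W) * Real.negMulLog W + W * Real.negMulLog (1 - b i / W) := fun i ↦ by
    rw [← Real.negMulLog_mul, mul_sub, mul_div_cancel₀ _ h.ne', mul_one]
  simp only [e1, e2, Finset.sum_add_distrib, ← Finset.sum_mul, ← Finset.mul_sum, hsum,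
    Finset.sum_sub_distrib, Finset.sum_const, hs, coEntropyGap] at this ⊢
  simp only [nsmul_eq_mul, mul_one]
  push_cast
  nlinarith [mul_nonneg h.le this]

/-- The log-sum inequality. -/
lemma sum_negMulLog_add_le {ι : Type*} {s : Finset ι} {M q : ι → ℝ} (hM : ∀ i ∈ s, 0 ≤ M i)
    (hq : ∀ i ∈ s, 0 ≤ q i) (hMq : ∀ i ∈ s, q i = 0 → M i = 0) {m Q : ℝ}
    (hm : ∑ i ∈ s, M i = m) (hQ : ∑ i ∈ s, q i = Q) :
    ∑ i ∈ s, Real.negMulLog (M i) + ∑ i ∈ s, M i * Real.log (q i) ≤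
      Real.negMulLog m + m * Real.log Q := by
  rcases (hm ▸ Finset.sum_nonneg hM : 0 ≤ m).eq_or_lt with h | h
  · have : ∀ i ∈ s, M i = 0 := (Finset.sum_eq_zero_iff_of_nonneg hM).1 (by rw [hm, h])
    rw [← h, Finset.sum_eq_zero fun i hi ↦ by rw [this i hi, Real.negMulLog_zero],
      Finset.sum_eq_zero fun i hi ↦ by rw [this i hi, zero_mul]]
    simp
  have hQ0 : 0 < Q := by
    refine (hQ ▸ Finset.sum_nonneg hq : 0 ≤ Q).lt_of_ne fun hQ' ↦ h.ne ?_
    have := (Finset.sum_eq_zero_iff_of_nonneg hq).1 (by rw [hQ, ← hQ'])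
    rw [← hm, Finset.sum_eq_zero fun i hi ↦ hMq i hi (this i hi)]
  have hterm : ∀ i ∈ s, Real.negMulLog (M i) + M i * Real.log (q i) ≤
      M i * (Real.log Q - Real.log m) + (q i * (m / Q) - M i) := by
    intro i hi
    rcases (hM i hi).eq_or_lt with h0 | h0
    · rw [← h0]
      simpa using mul_nonneg (hq i hi) (by positivity)
    · have hq0 : 0 < q i := (hq i hi).lt_of_ne fun hq' ↦ h0.ne' (hMq i hi hq'.symm)
      have := Real.log_le_sub_one_of_pos (x := q i * m / (M i * Q)) (by positivity)
      rw [Real.log_div (by positivity) (by positivity), Real.log_mul hq0.ne' h.ne',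
        Real.log_mul h0.ne' hQ0.ne'] at this
      have h2 := mul_le_mul_of_nonneg_left this h0.le
      have e : M i * (q i * m / (M i * Q) - 1) = q i * (m / Q) - M i := by field_simp
      rw [e] at h2
      rw [Real.negMulLog]
      linarith
  have := Finset.sum_le_sum hterm
  rw [Finset.sum_add_distrib, Finset.sum_add_distrib, Finset.sum_sub_distrib, ← Finset.sum_mul,
    ← Finset.sum_mul, hm, hQ, mul_div_cancel₀ _ hQ0.ne'] at this
  rw [Real.negMulLog]
  linarith

/-- The reciprocal of the critical exponent on `n` points. -/
noncomputable def permEntropyConst (n : ℕ) : ℝ := Real.log n.factorial / (n * Real.log n)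

lemma permEntropyConst_nonneg (n : ℕ) : 0 ≤ permEntropyConst n :=
  div_nonneg (Real.log_natCast_nonneg _) (mul_nonneg n.cast_nonneg (Real.log_natCast_nonneg _))

lemma permEntropyConst_succ {n : ℕ} (hn : 1 ≤ n) :
    1 + permEntropyConst n * (n - coEntropyConst n) = (n + 1) * permEntropyConst (n + 1) := by
  rcases hn.eq_or_lt with rfl | hn
  · have : Real.log 2 ≠ 0 := (Real.log_pos (by norm_num)).ne'
    norm_num [permEntropyConst, this]
    field_simp
  have h1 : (2 : ℝ) ≤ n := by exact_mod_cast hn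
  have h2 : Real.log (n : ℝ) ≠ 0 := (Real.log_pos (by linarith)).ne'
  have h3 : Real.log ((n : ℝ) + 1) ≠ 0 := (Real.log_pos (by linarith)).ne'
  have h4 : (n : ℝ) + 1 ≠ 0 := by positivity
  rw [permEntropyConst, permEntropyConst, coEntropyConst, Nat.factorial_succ]
  push_cast
  rw [Real.log_mul h4 (by positivity)]
  field_simp
  ring

lemma sum_negMulLog_of_card_le_one {V : Type*} {w : Equiv.Perm V → ℝ}
    {Ω : Finset (Equiv.Perm V)} {s t : Finset V} (ht : #t ≤ 1) (hΩ : ∀ σ ∈ Ω, ∀ x ∈ s, σ x ∈ t)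
    (hdet : ∀ σ ∈ Ω, ∀ τ ∈ Ω, (∀ x ∈ s, σ x = τ x) → σ = τ) :
    ∑ σ ∈ Ω, Real.negMulLog (w σ) = Real.negMulLog (∑ σ ∈ Ω, w σ) := by
  have hcard : #Ω ≤ 1 := Finset.card_le_one.2 fun σ hσ τ hτ ↦ hdet σ hσ τ hτ fun x hx ↦
    Finset.card_le_one.1 ht _ (hΩ σ hσ x hx) _ (hΩ τ hτ x hx)
  rcases Finset.card_le_one_iff_subset_singleton.1 hcard with ⟨σ, hσ⟩
  rcases Finset.subset_singleton_iff.1 hσ with rfl | rfl <;> simp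

section

variable {V : Type*} [DecidableEq V]

/-- The total weight of the permutations in `Ω` sending `x` to `i`. -/
noncomputable def fiberMass (w : Equiv.Perm V → ℝ) (Ω : Finset (Equiv.Perm V)) (x i : V) : ℝ :=
  ∑ σ ∈ Ω with σ x = i, w σ

variable {w : Equiv.Perm V → ℝ} {Ω : Finset (Equiv.Perm V)} {s t : Finset V}

lemma fiberMass_nonneg (hw : ∀ σ, 0 ≤ w σ) (x i : V) : 0 ≤ fiberMass w Ω x i :=
  Finset.sum_nonneg fun σ _ ↦ hw σ

lemma sum_fiberMass {x : V} (hx : ∀ σ ∈ Ω, σ x ∈ t) :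
    ∑ i ∈ t, fiberMass w Ω x i = ∑ σ ∈ Ω, w σ :=
  Finset.sum_fiberwise_of_maps_to hx w

lemma image_eq_of_maps (hst : #s = #t) {σ : Equiv.Perm V} (h : ∀ x ∈ s, σ x ∈ t) :
    s.image σ = t :=
  Finset.eq_of_subset_of_card_le (Finset.image_subset_iff.2 h)
    (by rw [Finset.card_image_of_injective _ σ.injective, hst])

lemma sum_fiberMass_left (hst : #s = #t) (hΩ : ∀ σ ∈ Ω, ∀ x ∈ s, σ x ∈ t) {i : V} (hi : i ∈ t) :
    ∑ x ∈ s, fiberMass w Ω x i = ∑ σ ∈ Ω, w σ := by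
  rw [← Finset.sum_fiberwise_of_maps_to (s := Ω) (t := s) (g := fun σ ↦ σ.symm i)]
  · refine Finset.sum_congr rfl fun x _ ↦ ?_
    refine Finset.sum_congr (Finset.filter_congr fun σ _ ↦ ?_) fun _ _ ↦ rfl
    rw [Equiv.symm_apply_eq, eq_comm]
  · intro σ hσ
    rw [← image_eq_of_maps hst (hΩ σ hσ), Finset.mem_image] at hi
    obtain ⟨x, hx, rfl⟩ := hi
    simpa using hx

lemma fiberMass_filter_comm (x y i j : V) :
    fiberMass w {σ ∈ Ω | σ y = j} x i = fiberMass w {σ ∈ Ω | σ x = i} y j := by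
  rw [fiberMass, fiberMass, Finset.filter_comm]

lemma fiberMass_filter_le (hw : ∀ σ, 0 ≤ w σ) (x y i j : V) :
    fiberMass w {σ ∈ Ω | σ y = j} x i ≤ fiberMass w Ω x i :=
  Finset.sum_le_sum_of_subset_of_nonneg
    (Finset.filter_subset_filter _ (Finset.filter_subset _ _)) fun σ _ _ ↦ hw σ

/-- The entropy of `σ x` given `σ y`, bounded using only the law of `σ x` and the
injectivity of `σ`. -/
lemma conditional_entropy_le (hw : ∀ σ, 0 ≤ w σ) {x y : V} (hxy : x ≠ y)
    (hx : ∀ σ ∈ Ω, σ x ∈ t) (hy : ∀ σ ∈ Ω, σ y ∈ t) :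
    ∑ j ∈ t, (∑ i ∈ t.erase j, Real.negMulLog (fiberMass w {σ ∈ Ω | σ y = j} x i) -
        Real.negMulLog (fiberMass w Ω y j)) ≤
      ∑ i ∈ t, Real.negMulLog (fiberMass w Ω x i) +
        ∑ j ∈ t, fiberMass w Ω y j * Real.log (∑ σ ∈ Ω, w σ - fiberMass w Ω x j) := by
  have hjj : ∀ j, fiberMass w {σ ∈ Ω | σ y = j} x j = 0 := fun j ↦ by
    rw [fiberMass, Finset.filter_filter, Finset.filter_false_of_mem, Finset.sum_empty]
    rintro σ _ ⟨h1, h2⟩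
    exact hxy (σ.injective (h2.trans h1.symm))
  have hterm : ∀ j ∈ t, ∑ i ∈ t.erase j, Real.negMulLog (fiberMass w {σ ∈ Ω | σ y = j} x i) -
        Real.negMulLog (fiberMass w Ω y j) ≤
      fiberMass w Ω y j * Real.log (∑ σ ∈ Ω, w σ - fiberMass w Ω x j) -
      ∑ i ∈ t, fiberMass w {σ ∈ Ω | σ y = j} x i * Real.log (fiberMass w Ω x i) := by
    intro j hj
    have := sum_negMulLog_add_le (s := t.erase j) (M := fiberMass w {σ ∈ Ω | σ y = j} x)
      (q := fiberMass w Ω x) (m := fiberMass w Ω y j) (Q := ∑ σ ∈ Ω, w σ - fiberMass w Ω x j)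
      (fun i _ ↦ fiberMass_nonneg hw x i) (fun i _ ↦ fiberMass_nonneg hw x i)
      (fun i _ h ↦ le_antisymm (h ▸ fiberMass_filter_le hw x y i j) (fiberMass_nonneg hw x i))
      (by
        rw [Finset.sum_erase _ (hjj j), sum_fiberMass fun σ hσ ↦ hx σ (Finset.mem_filter.1 hσ).1]
        rfl)
      (by rw [← sum_fiberMass hx, ← Finset.add_sum_erase t _ hj]; ring)
    rw [Finset.sum_erase (f := fun i ↦ fiberMass w {σ ∈ Ω | σ y = j} x i *
      Real.log (fiberMass w Ω x i)) _ (by rw [hjj, zero_mul])] at this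
    linarith
  refine (Finset.sum_le_sum hterm).trans (le_of_eq ?_)
  rw [Finset.sum_sub_distrib, Finset.sum_comm (s := t) (t := t)]
  have : ∀ i ∈ t, ∑ j ∈ t, fiberMass w {σ ∈ Ω | σ y = j} x i * Real.log (fiberMass w Ω x i) =
      -Real.negMulLog (fiberMass w Ω x i) := fun i _ ↦ by
    simp only [fiberMass_filter_comm x y i]
    rw [← Finset.sum_mul, sum_fiberMass fun σ hσ ↦ hy σ (Finset.mem_filter.1 hσ).1,
      Real.negMulLog, neg_mul, neg_neg]
    rfl
  rw [Finset.sum_congr rfl this, Finset.sum_neg_distrib]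
  ring

lemma sum_conditional_entropy_le (hw : ∀ σ, 0 ≤ w σ) {n : ℕ} (hn : 1 ≤ n) (hs : #s = n + 1)
    (ht : #t = n + 1) (hΩ : ∀ σ ∈ Ω, ∀ x ∈ s, σ x ∈ t) {x : V} (hx : x ∈ s) :
    ∑ y ∈ s.erase x, ∑ j ∈ t,
        (∑ i ∈ t.erase j, Real.negMulLog (fiberMass w {σ ∈ Ω | σ y = j} x i) -
          Real.negMulLog (fiberMass w Ω y j)) ≤
      (n - coEntropyConst n) * (∑ i ∈ t, Real.negMulLog (fiberMass w Ω x i) -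
        Real.negMulLog (∑ σ ∈ Ω, w σ)) := by
  have h1 := Finset.sum_le_sum fun y (hy : y ∈ s.erase x) ↦
    conditional_entropy_le (Ω := Ω) (t := t) hw (Finset.ne_of_mem_erase hy).symm
      (fun σ hσ ↦ hΩ σ hσ x hx) (fun σ hσ ↦ hΩ σ hσ y (Finset.mem_of_mem_erase hy))
  have h2 := coEntropyConst_mul_le hn ht (b := fiberMass w Ω x)
    (fun i _ ↦ fiberMass_nonneg hw x i) (sum_fiberMass fun σ hσ ↦ hΩ σ hσ x hx)
  have h3 : ∑ y ∈ s.erase x, ∑ j ∈ t,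
      fiberMass w Ω y j * Real.log (∑ σ ∈ Ω, w σ - fiberMass w Ω x j) =
      -∑ j ∈ t, Real.negMulLog (∑ σ ∈ Ω, w σ - fiberMass w Ω x j) := by
    rw [Finset.sum_comm, ← Finset.sum_neg_distrib]
    refine Finset.sum_congr rfl fun j hj ↦ ?_
    rw [← Finset.sum_mul, Real.negMulLog, neg_mul, neg_neg,
      ← sum_fiberMass_left (hs.trans ht.symm) hΩ hj, ← Finset.add_sum_erase s _ hx,
      add_sub_cancel_left]
  rw [Finset.sum_add_distrib, Finset.sum_const, Finset.card_erase_of_mem hx, hs, h3,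
    nsmul_eq_mul, Nat.add_sub_cancel] at h1
  linarith

/-- Entropy subadditivity for (unnormalised) laws of random permutations. -/
theorem entropy_perm_le (hw : ∀ σ, 0 ≤ w σ) (n : ℕ) (hs : #s = n) (ht : #t = n)
    (hΩ : ∀ σ ∈ Ω, ∀ x ∈ s, σ x ∈ t)
    (hdet : ∀ σ ∈ Ω, ∀ τ ∈ Ω, (∀ x ∈ s, σ x = τ x) → σ = τ) :
    ∑ σ ∈ Ω, Real.negMulLog (w σ) - Real.negMulLog (∑ σ ∈ Ω, w σ) ≤
      permEntropyConst n * ∑ x ∈ s, (∑ i ∈ t, Real.negMulLog (fiberMass w Ω x i) -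
        Real.negMulLog (∑ σ ∈ Ω, w σ)) := by
  induction n generalizing Ω s t with
  | zero => simp [sum_negMulLog_of_card_le_one (w := w) (by omega) hΩ hdet, permEntropyConst]
  | succ n ih =>
    rcases Nat.eq_zero_or_pos n with rfl | hn
    · simp [sum_negMulLog_of_card_le_one (w := w) (by omega) hΩ hdet, permEntropyConst]
    have hcond : ∀ y ∈ s, ∑ σ ∈ Ω, Real.negMulLog (w σ) - Real.negMulLog (∑ σ ∈ Ω, w σ) ≤
        (∑ j ∈ t, Real.negMulLog (fiberMass w Ω y j) - Real.negMulLog (∑ σ ∈ Ω, w σ)) +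
        permEntropyConst n * ∑ x ∈ s.erase y, ∑ j ∈ t,
          (∑ i ∈ t.erase j, Real.negMulLog (fiberMass w {σ ∈ Ω | σ y = j} x i) -
            Real.negMulLog (fiberMass w Ω y j)) := by
      intro y hy
      have hj := Finset.sum_le_sum fun j (hj : j ∈ t) ↦
        ih (Ω := {σ ∈ Ω | σ y = j}) (s := s.erase y) (t := t.erase j)
        (by rw [Finset.card_erase_of_mem hy, hs]; rfl)
        (by rw [Finset.card_erase_of_mem hj, ht]; rfl)
        (by
          intro σ hσ x hx
          rw [Finset.mem_filter] at hσ
          rw [Finset.mem_erase] at hx ⊢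
          exact ⟨fun h ↦ hx.1 (σ.injective (h.trans hσ.2.symm)), hΩ σ hσ.1 x hx.2⟩)
        (by
          intro σ hσ τ hτ h
          rw [Finset.mem_filter] at hσ hτ
          refine hdet σ hσ.1 τ hτ.1 fun x hx ↦ ?_
          rcases eq_or_ne x y with rfl | hxy
          · rw [hσ.2, hτ.2]
          · exact h x (Finset.mem_erase.2 ⟨hxy, hx⟩))
      rw [← Finset.mul_sum, Finset.sum_comm (s := t), Finset.sum_sub_distrib,
        Finset.sum_fiberwise_of_maps_to (fun σ hσ ↦ hΩ σ hσ y hy)] at hj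
      change _ - ∑ j ∈ t, Real.negMulLog (fiberMass w Ω y j) ≤ permEntropyConst n *
        ∑ x ∈ s.erase y, ∑ j ∈ t,
          (∑ i ∈ t.erase j, Real.negMulLog (fiberMass w {σ ∈ Ω | σ y = j} x i) -
            Real.negMulLog (fiberMass w Ω y j)) at hj
      linarith
    have hsum := Finset.sum_le_sum hcond
    rw [Finset.sum_add_distrib, ← Finset.mul_sum, Finset.sum_const, hs, nsmul_eq_mul,
      Finset.sum_comm' (t' := s) (s' := fun x ↦ s.erase x) (by
        intro x y
        simp only [Finset.mem_erase]
        tauto)] at hsum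
    have h2 := Finset.sum_le_sum fun x (hx : x ∈ s) ↦
      sum_conditional_entropy_le hw hn hs ht hΩ hx
    rw [← Finset.mul_sum] at h2
    have h3 := mul_le_mul_of_nonneg_left h2 (permEntropyConst_nonneg n)
    have h4 := permEntropyConst_succ hn
    push_cast at hsum
    have h5 : (0 : ℝ) < n + 1 := by positivity
    refine le_of_mul_le_mul_left ?_ h5
    rw [← mul_assoc, ← h4, add_mul, one_mul]
    linarith

end

/-- Generalized Hölder-type inequality for the uniform measure on permutations at the
critical exponent `p_c = n log n / log (n!)`. -/
theorem stmt8 {V : Type*} [Fintype V] [DecidableEq V]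
    (n : ℕ) (hn : 2 ≤ n) (hcard : Fintype.card V = n)
    (pc : ℝ) (hpc : pc = (n : ℝ) * Real.log n / Real.log (Nat.factorial n))
    (φ : V → V → ℝ) (hφ : ∀ x i, 0 ≤ φ x i) :
    (∑ σ : Equiv.Perm V, ∏ x : V, φ x (σ x)) / (Fintype.card (Equiv.Perm V) : ℝ) ≤
      ∏ x : V, ((1 / (n : ℝ)) * ∑ i : V, φ x i ^ pc) ^ (1 / pc) := by
  have hn' : (2 : ℝ) ≤ n := by exact_mod_cast hn
  have hlogn : 0 < Real.log n := Real.log_pos (by linarith)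
  have hlogf : 0 < Real.log n.factorial := by
    refine Real.log_pos ?_
    exact_mod_cast hn.trans (Nat.self_le_factorial n)
  have hpc0 : 0 < pc := by rw [hpc]; positivity
  have hconst : permEntropyConst n = 1 / pc := by rw [permEntropyConst, hpc, one_div_div]
  set w : Equiv.Perm V → ℝ := fun σ ↦ ∏ x, φ x (σ x) with hwdef
  have hw : ∀ σ, 0 ≤ w σ := fun σ ↦ Finset.prod_nonneg fun x _ ↦ hφ x _
  have hpow : ∀ x i, 0 ≤ φ x i ^ pc := fun x i ↦ Real.rpow_nonneg (hφ x i) _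
  have hQ0 : ∀ x, 0 ≤ ∑ i, φ x i ^ pc := fun x ↦ Finset.sum_nonneg fun i _ ↦ hpow x i
  have hmain : ∑ σ, w σ ≤ ∏ x, (∑ i, φ x i ^ pc) ^ (1 / pc) := by
    rcases (Finset.sum_nonneg fun σ _ ↦ hw σ : 0 ≤ ∑ σ, w σ).eq_or_lt with hW | hW
    · rw [← hW]
      exact Finset.prod_nonneg fun x _ ↦ Real.rpow_nonneg (hQ0 x) _
    set W := ∑ σ, w σ
    have hwφ : ∀ σ x, φ x (σ x) = 0 → w σ = 0 := fun σ x h ↦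
      Finset.prod_eq_zero (Finset.mem_univ x) h
    have hmφ : ∀ x i, φ x i = 0 → fiberMass w univ x i = 0 := fun x i h ↦
      Finset.sum_eq_zero fun σ hσ ↦ hwφ σ x (by rw [(Finset.mem_filter.1 hσ).2, h])
    have hm : ∀ x, ∑ i, fiberMass w univ x i = W := fun x ↦
      sum_fiberMass fun σ _ ↦ Finset.mem_univ _
    have hQ : ∀ x, 0 < ∑ i, φ x i ^ pc := fun x ↦ by
      refine (hQ0 x).lt_of_ne fun h ↦ hW.ne ?_
      have := (Finset.sum_eq_zero_iff_of_nonneg fun i _ ↦ hpow x i).1 h.symm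
      rw [← hm x, Finset.sum_eq_zero fun i hi ↦ hmφ x i
        ((Real.rpow_eq_zero (hφ x i) hpc0.ne').1 (this i hi))]
    have hent := entropy_perm_le (Ω := univ) (s := univ) (t := univ) hw n
      (by rw [Finset.card_univ, hcard]) (by rw [Finset.card_univ, hcard])
      (fun _ _ _ _ ↦ Finset.mem_univ _)
      (fun σ _ τ _ h ↦ Equiv.ext fun x ↦ h x (Finset.mem_univ x))
    have hlog : ∑ σ, Real.negMulLog (w σ) =
        -∑ x, ∑ i, fiberMass w univ x i * Real.log (φ x i) := by
      have h1 : ∀ σ, Real.negMulLog (w σ) = -∑ x, w σ * Real.log (φ x (σ x)) := fun σ ↦ by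
        rcases (hw σ).eq_or_lt with h | h
        · simp [← h]
        · rw [← Finset.mul_sum, Real.negMulLog, hwdef, Real.log_prod, neg_mul]
          exact fun x _ hx ↦ h.ne' (hwφ σ x hx)
      simp only [h1, Finset.sum_neg_distrib]
      rw [Finset.sum_comm]
      congr 1
      refine Finset.sum_congr rfl fun x _ ↦ ?_
      rw [← Finset.sum_fiberwise_of_maps_to (s := univ) (t := univ)
        (g := fun σ : Equiv.Perm V ↦ σ x) (fun _ _ ↦ Finset.mem_univ _)]
      refine Finset.sum_congr rfl fun i _ ↦ ?_
      rw [fiberMass, Finset.sum_mul]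
      exact Finset.sum_congr rfl fun σ hσ ↦ by rw [(Finset.mem_filter.1 hσ).2]
    have hgibbs : ∀ x ∈ (univ : Finset V),
        ∑ i, Real.negMulLog (fiberMass w univ x i) - Real.negMulLog W ≤
        W * Real.log (∑ i, φ x i ^ pc) -
          pc * ∑ i, fiberMass w univ x i * Real.log (φ x i) := fun x _ ↦ by
      have h1 := sum_negMulLog_add_le (s := univ) (M := fiberMass w univ x)
        (q := fun i ↦ φ x i ^ pc) (fun i _ ↦ fiberMass_nonneg hw x i) (fun i _ ↦ hpow x i)
        (fun i _ h ↦ hmφ x i ((Real.rpow_eq_zero (hφ x i) hpc0.ne').1 h)) (hm x) rfl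
      have h2 : ∀ i, fiberMass w univ x i * Real.log (φ x i ^ pc) =
          pc * (fiberMass w univ x i * Real.log (φ x i)) := fun i ↦ by
        rcases (hφ x i).eq_or_lt with h | h
        · simp [hmφ x i h.symm]
        · rw [Real.log_rpow h]; ring
      simp only [h2, ← Finset.mul_sum] at h1
      linarith
    have h1 := hent.trans (mul_le_mul_of_nonneg_left (Finset.sum_le_sum hgibbs)
      (permEntropyConst_nonneg n))
    rw [hlog, hconst, Finset.sum_sub_distrib, ← Finset.mul_sum, ← Finset.mul_sum, mul_sub,
      ← mul_assoc (1 / pc) pc, one_div_mul_cancel hpc0.ne', one_mul, Real.negMulLog] at h1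
    have h2 : Real.log W ≤ 1 / pc * ∑ x, Real.log (∑ i, φ x i ^ pc) := by
      refine le_of_mul_le_mul_left ?_ hW
      linarith
    rw [← Real.log_le_log_iff hW (Finset.prod_pos fun x _ ↦ Real.rpow_pos_of_pos (hQ x) _),
      Real.log_prod fun x _ ↦ (Real.rpow_pos_of_pos (hQ x) _).ne']
    simpa only [Real.log_rpow (hQ _), ← Finset.mul_sum] using h2
  have hfact : (1 / (n : ℝ)) ^ (1 / pc * n) = 1 / n.factorial := by
    rw [Real.rpow_def_of_pos (by positivity), one_div, one_div ((n.factorial : ℕ) : ℝ),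
      Real.log_inv, hpc, ← Real.exp_log (show (0 : ℝ) < (n.factorial : ℝ)⁻¹ by positivity),
      Real.log_inv]
    congr 1
    field_simp
  simp only [Real.mul_rpow (show 0 ≤ 1 / (n : ℝ) by positivity) (hQ0 _)]
  rw [Finset.prod_mul_distrib, Finset.prod_const, Finset.card_univ, hcard, ← Real.rpow_natCast,
    ← Real.rpow_mul (by positivity), hfact, Fintype.card_perm, hcard, div_eq_mul_one_div, mul_comm]
  gcongr
end
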